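/- arXiv:0708.2342 — 7 statements merged into one kernel-verified Lean document; each statement's English description precedes it below -/
import Mathlib

section
/- Assume F is strictly convex on [0,a], strictly concave on [a,1], and ∫₀¹ F(s) ds > 0, and assume moreover |F(s)| ≤ 1 for all s ∉ [0,1] (so that all solutions of the system are globally defined and the Poincaré map ψ exists and is uniquely determined). Let 0 < α < β be fixed. Then there exists ω* > m₀* such that for all n₀, n₁ with 0 < n₀ < m₀* and n₁ > ω*, the Poincaré map ψ = ψ_{n₀,n₁,α,β} admits a nonempty compact set Λ ⊆ (a,1) × (0,+∞) with ψ(Λ) = Λ and a continuous surjection h : Λ → Σ₂ such that h(ψ(z)) = σ(h(z)) for all z ∈ Λ; moreover, for every sequence s ∈ Σ₂ which is ℓ-periodic for some ℓ ≥ 1 (i.e. s_{k+ℓ} = s_k for all k ∈ ℤ) there exists z ∈ Λ with h(z) = s and ψ^ℓ(z) = z. -/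
open Set Filter intervalIntegral

/-- `m₀* = g / (max_{s ∈ [a,1]} F(s)/s)`. -/
noncomputable def m0star (g : ℝ) (F : ℝ → ℝ) (a : ℝ) : ℝ :=
  g / sSup ((fun s => F s / s) '' Set.Icc a 1)

section

open Set Filter

namespace PMir

/-- vertex number `m` of the Freudenthal simplex `(v, π)` -/
def vtx {n : ℕ} (v : Fin n → ℕ) (π : Equiv.Perm (Fin n)) (m : ℕ) : Fin n → ℕ :=
  fun i => v i + if (π i : ℕ) < m then 1 else 0

lemma vtx_congr {n : ℕ} {v v' : Fin n → ℕ} {π π' : Equiv.Perm (Fin n)} {m m' : ℕ} {i : Fin n}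
    (h : v i = v' i) (h2 : (π i : ℕ) < m ↔ (π' i : ℕ) < m') : vtx v π m i = vtx v' π' m' i := by
  unfold vtx
  rw [h]
  by_cases h3 : (π i : ℕ) < m
  · rw [if_pos h3, if_pos (h2.1 h3)]
  · rw [if_neg h3, if_neg (fun h4 => h3 (h2.2 h4))]

lemma vtx_lt {n : ℕ} (v : Fin n → ℕ) (π : Equiv.Perm (Fin n)) (m : ℕ) (i : Fin n)
    (h : (π i : ℕ) < m) : vtx v π m i = v i + 1 := by
  unfold vtx; rw [if_pos h]

lemma vtx_ge {n : ℕ} (v : Fin n → ℕ) (π : Equiv.Perm (Fin n)) (m : ℕ) (i : Fin n)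
    (h : m ≤ (π i : ℕ)) : vtx v π m i = v i := by
  unfold vtx; rw [if_neg (by omega)]; rfl

open Classical in
lemma door_count (N : ℕ) (lam : ℕ → ℕ) (hl : ∀ m ≤ N, lam m ≤ N) :
    (∑ j ∈ Finset.range (N+1),
      (if ∀ c < N, ∃ m ≤ N, m ≠ j ∧ lam m = c then (1 : ZMod 2) else 0))
      = if ∀ c ≤ N, ∃ m ≤ N, lam m = c then 1 else 0 := by
  by_cases hfull : ∀ c ≤ N, ∃ m ≤ N, lam m = c
  · rw [if_pos hfull]
    have hinj : Set.InjOn lam (Finset.range (N+1) : Set ℕ) := by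
      apply Finset.injOn_of_surjOn_of_card_le lam (t := Finset.range (N+1))
      · intro x hx
        simp at hx ⊢
        have := hl x (by omega); omega
      · intro c hc
        simp at hc
        obtain ⟨m, hm, rfl⟩ := hfull c (by omega)
        exact ⟨m, by simp; omega, rfl⟩
      · simp
    obtain ⟨j0, hj0, hj0'⟩ := hfull N le_rfl
    rw [Finset.sum_eq_single j0]
    · rw [if_pos]
      intro c hc
      obtain ⟨m, hm, hm'⟩ := hfull c hc.le
      exact ⟨m, hm, by rintro rfl; omega, hm'⟩
    · intro j hj hjne
      rw [if_neg]
      intro H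
      simp at hj
      have h1 : lam j ≠ N := by
        intro h
        exact hjne (hinj (by simp; omega) (by simp; omega) (h.trans hj0'.symm))
      have h2 := hl j (by omega)
      obtain ⟨m, hm, hmj, hm'⟩ := H (lam j) (by omega)
      exact hmj (hinj (by simp; omega) (by simp; omega) hm')
    · intro h; simp at h; omega
  · rw [if_neg hfull]
    by_cases hg : ∃ j ≤ N, ∀ c < N, ∃ m ≤ N, m ≠ j ∧ lam m = c
    · obtain ⟨j0, hj0, hgood⟩ := hg
      have hlt0 : lam j0 < N := by
        have := hl j0 hj0
        rcases this.lt_or_eq with h | h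
        · exact h
        · exfalso
          apply hfull
          intro c hc
          rcases hc.lt_or_eq with h' | h'
          · obtain ⟨m, hm, _, h3⟩ := hgood c h'
            exact ⟨m, hm, h3⟩
          · exact ⟨j0, hj0, by omega⟩
      have himg : Finset.range N = ((Finset.range (N+1)).erase j0).image lam := by
        apply Finset.eq_of_subset_of_card_le
        · intro c hc
          simp at hc
          obtain ⟨m, hm, hmj, h3⟩ := hgood c hc
          simp only [Finset.mem_image, Finset.mem_erase, Finset.mem_range]
          exact ⟨m, ⟨hmj, by omega⟩, h3⟩
        · refine Finset.card_image_le.trans ?_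
          rw [Finset.card_erase_of_mem (by simp; omega)]
          simp
      have hinj : Set.InjOn lam ((Finset.range (N+1)).erase j0 : Set ℕ) := by
        apply Finset.injOn_of_card_image_eq
        rw [← himg, Finset.card_erase_of_mem (by simp; omega)]
        simp
      have hI : ∀ p q, p ≤ N → q ≤ N → p ≠ j0 → q ≠ j0 → lam p = lam q → p = q := by
        intro p q hp hq hp0 hq0 h
        exact hinj (by simp; omega) (by simp; omega) h
      have hlt : ∀ p ≤ N, lam p < N := by
        intro p hp
        by_cases h : p = j0
        · rw [h]; exact hlt0
        · have : lam p ∈ Finset.range N := by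
            rw [himg]; exact Finset.mem_image_of_mem _ (by simp; omega)
          simpa using this
      obtain ⟨j1, hj1, hj10, hj1'⟩ := hgood (lam j0) hlt0
      have hsub : ∀ j ∈ Finset.range (N+1), j ∉ ({j0, j1} : Finset ℕ) →
          (if ∀ c < N, ∃ m ≤ N, m ≠ j ∧ lam m = c then (1 : ZMod 2) else 0) = 0 := by
        intro j hj hjn
        simp at hj hjn
        rw [if_neg]
        intro H
        obtain ⟨m, hm, hmj, h3⟩ := H (lam j) (hlt j (by omega))
        by_cases hm0 : m = j0
        · subst hm0
          exact hjn.2 (hI j j1 (by omega) hj1 hjn.1 hj10 (by omega))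
        · exact hmj (hI m j hm (by omega) hm0 hjn.1 h3)
      rw [← Finset.sum_subset (s₁ := {j0, j1}) _ hsub]
      · rw [Finset.sum_pair (Ne.symm hj10), if_pos hgood, if_pos]
        · decide
        · intro c hc
          obtain ⟨m, hm, hm0, h3⟩ := hgood c hc
          by_cases h : m = j1
          · exact ⟨j0, hj0, Ne.symm hj10, by rw [← h3, h, hj1']⟩
          · exact ⟨m, hm, h, h3⟩
      · intro x hx; simp at hx ⊢; omega
    · push Not at hg
      apply Finset.sum_eq_zero
      intro j hj
      simp at hj
      rw [if_neg]
      intro H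
      obtain ⟨c, hc, h⟩ := hg j (by omega)
      obtain ⟨m, hm, hmj, h3⟩ := H c hc
      exact h m hm hmj h3

/-- extension of a permutation fixing the last element -/
def ext {n : ℕ} (σ : Equiv.Perm (Fin n)) : Equiv.Perm (Fin (n+1)) :=
  (finSuccEquivLast.trans (Equiv.optionCongr σ)).trans finSuccEquivLast.symm

lemma ext_castSucc {n : ℕ} (σ : Equiv.Perm (Fin n)) (i : Fin n) :
    ext σ i.castSucc = (σ i).castSucc := by
  simp [ext]

lemma ext_last {n : ℕ} (σ : Equiv.Perm (Fin n)) : ext σ (Fin.last n) = Fin.last n := by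
  simp [ext]

lemma sum_perm_fix {n : ℕ} (f : Equiv.Perm (Fin (n+1)) → ZMod 2)
    (hf : ∀ π, π (Fin.last n) ≠ Fin.last n → f π = 0) :
    ∑ π, f π = ∑ σ : Equiv.Perm (Fin n), f (ext σ) := by
  symm
  apply Finset.sum_of_injOn (e := ext)
  · intro s _ t _ h
    ext i
    have := congrArg (fun e : Equiv.Perm (Fin (n+1)) => (e i.castSucc : ℕ)) h
    simpa [ext_castSucc] using this
  · simp
  · intro π _ hπ
    apply hf
    intro hl
    apply hπ
    set e : Option (Fin n) ≃ Option (Fin n) :=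
      (finSuccEquivLast.symm.trans π).trans finSuccEquivLast with he
    have hn : e none = none := by simp [he, hl]
    refine ⟨Equiv.removeNone e, by simp, ?_⟩
    have : Equiv.optionCongr (Equiv.removeNone e) = e := by
      ext1 o
      cases o with
      | none => simp [hn]
      | some x =>
        have hx : ∃ x', e (some x) = some x' := by
          cases h : e (some x) with
          | none =>
            have := e.injective (h.trans hn.symm)
            simp at this
          | some y => exact ⟨y, rfl⟩
        rw [Equiv.optionCongr_apply, Option.map_some]
        exact Equiv.removeNone_some e hx
    unfold ext
    rw [this]
    ext i
    simp [he]
  · simp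


lemma vtx_snoc {n : ℕ} (v : Fin n → ℕ) (σ : Equiv.Perm (Fin n)) (m : ℕ) (hm : m ≤ n) :
    vtx (Fin.snoc v 0 : Fin (n+1) → ℕ) (ext σ) m = (Fin.snoc (vtx v σ m) 0 : Fin (n+1) → ℕ) := by
  funext i
  refine Fin.lastCases ?_ (fun i => ?_) i
  · simp [vtx, ext_last]; omega
  · simp [vtx, ext_castSucc]

open Classical in
/-- parity form of Kuhn's cubical Sperner lemma -/
theorem kuhn_parity (k : ℕ) (hk : 0 < k) : ∀ (n : ℕ) (r : (Fin n → ℕ) → ℕ),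
    (∀ x, r x ≤ n) → (∀ (x : Fin n → ℕ) (i : Fin n), x i = 0 → r x ≤ (i : ℕ)) →
    (∀ (x : Fin n → ℕ) (i : Fin n), x i = k → r x ≠ (i : ℕ)) →
    (∑ v ∈ Fintype.piFinset (fun _ : Fin n => Finset.range k), ∑ π : Equiv.Perm (Fin n),
      if ∀ c ≤ n, ∃ m ≤ n, r (vtx v π m) = c then (1 : ZMod 2) else 0) = 1 := by
  intro n
  induction n with
  | zero =>
    intro r hr _ _
    have : ∀ (v : Fin 0 → ℕ) (π : Equiv.Perm (Fin 0)),
        (∀ c ≤ 0, ∃ m ≤ 0, r (vtx v π m) = c) := by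
      intro v π c hc
      exact ⟨0, le_rfl, by have := hr (vtx v π 0); omega⟩
    simp only [if_pos (this _ _)]
    simp
  | succ n ih =>
    intro r hr h0 h1
    set B := Fintype.piFinset (fun _ : Fin (n+1) => Finset.range k) with hB
    have hBm : ∀ v, v ∈ B ↔ ∀ i, v i < k := by intro v; simp [hB]
    let G : (Fin (n+1) → ℕ) → Equiv.Perm (Fin (n+1)) → ℕ → ZMod 2 := fun v π j =>
      if ∀ c < n+1, ∃ m ≤ n+1, m ≠ j ∧ r (vtx v π m) = c then 1 else 0
    have hGdef : ∀ v π j, G v π j =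
      if ∀ c < n+1, ∃ m ≤ n+1, m ≠ j ∧ r (vtx v π m) = c then 1 else 0 := fun _ _ _ => rfl
    have hstep1 : ∀ v π, (if ∀ c ≤ n+1, ∃ m ≤ n+1, r (vtx v π m) = c then (1 : ZMod 2) else 0)
        = G v π 0 + ∑ j ∈ Finset.range n, G v π (j+1) + G v π (n+1) := by
      intro v π
      rw [← door_count (n+1) (fun m => r (vtx v π m)) (fun m _ => hr _)]
      rw [Finset.sum_range_succ, Finset.sum_range_succ', add_comm (∑ k ∈ _, _)]
    have hmid : ∀ v, ∀ j ∈ Finset.range n, ∑ π, G v π (j+1) = 0 := by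
      intro v j hj
      simp at hj
      let p : Fin (n+1) := ⟨j, by omega⟩
      let q : Fin (n+1) := ⟨j+1, by omega⟩
      have hpq : p ≠ q := by simp [p, q]
      have hv : ∀ (π : Equiv.Perm (Fin (n+1))) m, m ≠ j+1 →
          vtx v (Equiv.swap p q * π) m = vtx v π m := by
        intro π m hm
        funext i
        apply vtx_congr rfl
        rw [Equiv.Perm.mul_apply]
        by_cases h1 : π i = p
        · rw [h1, Equiv.swap_apply_left]
          simp only [p, q]
          omega
        · by_cases h2 : π i = q
          · rw [h2, Equiv.swap_apply_right]
            simp only [p, q]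
            omega
          · rw [Equiv.swap_apply_of_ne_of_ne h1 h2]
      have hG : ∀ π : Equiv.Perm (Fin (n+1)), G v (Equiv.swap p q * π) (j+1) = G v π (j+1) := by
        intro π
        rw [hGdef, hGdef]
        congr 1
        simp only [eq_iff_iff]
        refine forall_congr' fun c => forall_congr' fun _ => exists_congr fun m => ?_
        constructor
        · rintro ⟨a, b, d⟩; exact ⟨a, b, by rw [← hv π m b]; exact d⟩
        · rintro ⟨a, b, d⟩; exact ⟨a, b, by rw [hv π m b]; exact d⟩
      apply Finset.sum_involution (fun π _ => Equiv.swap p q * π)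
      · intro π _; rw [hG]; exact CharTwo.add_self_eq_zero _
      · intro π _ _ h
        have h' : Equiv.swap p q = 1 := by simpa using h
        exact hpq (Equiv.swap_eq_one_iff.1 h')
      · simp
      · intro π _; simp
    let e : Equiv.Perm (Fin (n+1)) → Fin (n+1) := fun π => π.symm (Fin.last n)
    have he : ∀ π : Equiv.Perm (Fin (n+1)), π (e π) = Fin.last n := by intro π; simp [e]
    have hshift : ∀ v π, G v (finRotate (n+1) * π) 0
        = G (Function.update v (e π) (v (e π) + 1)) π (n+1) := by
      intro v π
      have hv : ∀ m ≤ n, vtx v (finRotate (n+1) * π) (m+1)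
          = vtx (Function.update v (e π) (v (e π) + 1)) π m := by
        intro m hm
        funext i
        by_cases hi : i = e π
        · subst hi
          rw [vtx_lt, vtx_ge]
          · simp
          · rw [he]; simpa using hm
          · rw [Equiv.Perm.mul_apply, he, finRotate_last]; simp
        · apply vtx_congr (by rw [Function.update_of_ne hi])
          have : π i ≠ Fin.last n := by
            intro h; apply hi; simp [e, ← h]
          have h2 : ((finRotate (n+1) (π i) : Fin (n+1)) : ℕ) = (π i : ℕ) + 1 := by
            exact coe_finRotate_of_ne_last this
          rw [Equiv.Perm.mul_apply, h2]
          omega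
      rw [hGdef, hGdef]
      congr 1
      simp only [eq_iff_iff]
      refine forall_congr' fun c => forall_congr' fun _ => ?_
      constructor
      · rintro ⟨m, hm, hm0, h⟩
        obtain ⟨m, rfl⟩ : ∃ m', m = m' + 1 := ⟨m - 1, by omega⟩
        exact ⟨m, by omega, by omega, by rw [← hv m (by omega)]; exact h⟩
      · rintro ⟨m, hm, hm0, h⟩
        exact ⟨m+1, by omega, by omega, by rw [hv m (by omega)]; exact h⟩
    have hgk : ∀ v π, v (e π) = k → G v π (n+1) = 0 := by
      intro v π hv
      rw [hGdef, if_neg]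
      intro H
      obtain ⟨m, hm, hmj, h⟩ := H (e π) (e π).2
      refine h1 _ (e π) ?_ h
      rw [vtx_ge _ _ _ _ (by rw [he]; simp; omega), hv]
    have hg0 : ∀ v π, v (e π) = 0 → e π ≠ Fin.last n → G v π (n+1) = 0 := by
      intro v π hv hne
      rw [hGdef, if_neg]
      intro H
      obtain ⟨m, hm, hmj, h⟩ := H n (by omega)
      have h3 := h0 (vtx v π m) (e π) (by
        rw [vtx_ge _ _ _ _ (by rw [he]; simp; omega), hv])
      have h4 : (e π : ℕ) < n := by
        have := (e π).2
        have h5 : (e π : ℕ) ≠ n := fun h' => hne (Fin.ext h')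
        omega
      omega
    have htel : ∀ π, ∑ v ∈ B, (G (Function.update v (e π) (v (e π) + 1)) π (n+1) + G v π (n+1))
        = ∑ v ∈ B with v (e π) = 0, G v π (n+1) := by
      intro π
      rw [Finset.sum_add_distrib]
      have h2 : ∑ v ∈ B, G (Function.update v (e π) (v (e π) + 1)) π (n+1)
          = ∑ v ∈ B with v (e π) ≠ 0, G v π (n+1) := by
        have h3 : ∑ v ∈ B, G (Function.update v (e π) (v (e π) + 1)) π (n+1)
          = ∑ v ∈ B with v (e π) + 1 ≠ k, G (Function.update v (e π) (v (e π) + 1)) π (n+1) := by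
          symm
          apply Finset.sum_filter_of_ne
          intro v _ hne h
          exact hne (hgk _ _ (by simpa using h))
        rw [h3]
        apply Finset.sum_nbij' (fun v => Function.update v (e π) (v (e π) + 1))
          (fun v => Function.update v (e π) (v (e π) - 1))
        · intro v hv
          simp only [Finset.mem_filter, hBm] at hv ⊢
          refine ⟨fun i => ?_, by simp⟩
          by_cases hi : i = e π
          · subst hi
            have := hv.1 (e π)
            have := hv.2
            simp; omega
          · simpa [hi] using hv.1 i
        · intro v hv
          simp only [Finset.mem_filter, hBm] at hv ⊢
          have ha := hv.1 (e π)
          have hb := hv.2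
          refine ⟨fun i => ?_, by simp; omega⟩
          by_cases hi : i = e π
          · subst hi
            simp; omega
          · simpa [hi] using hv.1 i
        · intro v hv; simp
        · intro v hv
          simp only [Finset.mem_filter] at hv
          have : v (e π) - 1 + 1 = v (e π) := by have := hv.2; omega
          simp [this]
        · intro v hv; rfl
      rw [h2]
      have h4 := Finset.sum_filter_add_sum_filter_not B (fun v => v (e π) = 0)
        (fun v => G v π (n+1))
      rw [← h4, add_left_comm]
      rw [CharTwo.add_self_eq_zero, add_zero]
    have hmain : (∑ v ∈ B, ∑ π : Equiv.Perm (Fin (n+1)),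
        if ∀ c ≤ n+1, ∃ m ≤ n+1, r (vtx v π m) = c then (1 : ZMod 2) else 0)
        = ∑ π : Equiv.Perm (Fin (n+1)), ∑ v ∈ B with v (e π) = 0, G v π (n+1) := by
      calc _ = ∑ v ∈ B, ∑ π, (G v π 0 + ∑ j ∈ Finset.range n, G v π (j+1) + G v π (n+1)) := by
            simp only [hstep1]
        _ = ∑ v ∈ B, (∑ π, G v π 0 + ∑ π, G v π (n+1)) := by
            apply Finset.sum_congr rfl
            intro v _
            rw [Finset.sum_add_distrib, Finset.sum_add_distrib, Finset.sum_comm (s := Finset.univ),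
              Finset.sum_eq_zero (hmid v), add_zero]
        _ = ∑ v ∈ B, (∑ π, G (Function.update v (e π) (v (e π) + 1)) π (n+1)
              + ∑ π, G v π (n+1)) := by
            apply Finset.sum_congr rfl
            intro v _
            congr 1
            rw [← Equiv.sum_comp (Equiv.mulLeft (finRotate (n+1)))]
            apply Finset.sum_congr rfl
            intro π _
            exact hshift v π
        _ = ∑ v ∈ B, ∑ π, (G (Function.update v (e π) (v (e π) + 1)) π (n+1)
              + G v π (n+1)) := by
            simp only [Finset.sum_add_distrib]
        _ = ∑ π, ∑ v ∈ B, (G (Function.update v (e π) (v (e π) + 1)) π (n+1)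
              + G v π (n+1)) := Finset.sum_comm
        _ = _ := Finset.sum_congr rfl (fun π _ => htel π)
    rw [hmain, sum_perm_fix]
    · rw [← ih (fun x => r (Fin.snoc x 0 : Fin (n+1) → ℕ)) ?_ ?_ ?_, Finset.sum_comm]
      · apply Finset.sum_congr rfl
        intro σ _
        have hel : e (ext σ) = Fin.last n := by
          simp [e, Equiv.symm_apply_eq, ext_last]
        rw [hel]
        symm
        apply Finset.sum_nbij' (fun v => (Fin.snoc v 0 : Fin (n+1) → ℕ)) (fun v i => v i.castSucc)
        · intro v hv
          simp only [Fintype.mem_piFinset, Finset.mem_range] at hv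
          simp only [Finset.mem_filter, hBm]
          refine ⟨fun i => ?_, by simp⟩
          refine Fin.lastCases ?_ (fun i => ?_) i
          · simpa using hk
          · simpa using hv i
        · intro v hv
          simp only [Finset.mem_filter, hBm] at hv
          simp only [Fintype.mem_piFinset, Finset.mem_range]
          intro i
          exact hv.1 i.castSucc
        · intro v _; simp
        · intro v hv
          simp only [Finset.mem_filter] at hv
          rw [← hv.2]; exact Fin.snoc_init_self v
        · intro v hv
          rw [hGdef]
          congr 1
          simp only [eq_iff_iff]
          constructor
          · intro H c hc
            obtain ⟨m, hm, h⟩ := H c (by omega)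
            exact ⟨m, by omega, by omega, by rw [vtx_snoc v σ m hm]; exact h⟩
          · intro H c hc
            obtain ⟨m, hm, hm', h⟩ := H c (by omega)
            exact ⟨m, by omega, by rw [← vtx_snoc v σ m (by omega)]; exact h⟩
      · intro x
        have := h0 (Fin.snoc x 0 : Fin (n+1) → ℕ) (Fin.last n) (by simp)
        simpa using this
      · intro x i hi
        have := h0 (Fin.snoc x 0 : Fin (n+1) → ℕ) i.castSucc (by simpa using hi)
        simpa using this
      · intro x i hi
        have := h1 (Fin.snoc x 0 : Fin (n+1) → ℕ) i.castSucc (by simpa using hi)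
        simpa using this
    · intro π hπ
      apply Finset.sum_eq_zero
      intro v hv
      simp only [Finset.mem_filter] at hv
      apply hg0 _ _ hv.2
      intro h
      apply hπ
      have h6 := he π
      rw [h] at h6
      exact h6

end PMir

end

section
open Set Filter

namespace PMir

lemma kuhn_exists {n : ℕ} (k : ℕ) (hk : 0 < k) (A : (Fin n → ℕ) → Fin n → Prop)
    (h0 : ∀ x i, x i = 0 → A x i) (h1 : ∀ x i, x i = k → ¬ A x i) :
    ∃ v : Fin n → ℕ, ∃ π : Equiv.Perm (Fin n), (∀ i, v i < k) ∧
      (∀ i, ∃ m, A (vtx v π m) i) ∧ ∃ m, ∀ i, ¬ A (vtx v π m) i := by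
  classical
  let S : (Fin n → ℕ) → Set ℕ := fun x => {c | c = n ∨ ∃ i : Fin n, (i : ℕ) = c ∧ A x i}
  let r : (Fin n → ℕ) → ℕ := fun x => sInf (S x)
  have hne : ∀ x, (S x).Nonempty := fun x => ⟨n, Or.inl rfl⟩
  have hmem : ∀ x, r x ∈ S x := fun x => Nat.sInf_mem (hne x)
  have hle : ∀ x c, c ∈ S x → r x ≤ c := fun x c h => Nat.sInf_le h
  have hA : ∀ x (i : Fin n), r x = i → A x i := by
    intro x i h
    rcases hmem x with h' | ⟨j, hj, hj'⟩
    · have := i.2; omega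
    · have : j = i := Fin.ext (by omega)
      rwa [← this]
  have key := kuhn_parity k hk n r (fun x => hle x n (Or.inl rfl))
    (fun x i hi => hle x i (Or.inr ⟨i, rfl, h0 x i hi⟩))
    (fun x i hi h => h1 x i hi (hA x i h))
  obtain ⟨v, hv, hv'⟩ := Finset.exists_ne_zero_of_sum_ne_zero (by rw [key]; exact one_ne_zero)
  obtain ⟨π, _, hπ⟩ := Finset.exists_ne_zero_of_sum_ne_zero hv'
  have hfull : ∀ c ≤ n, ∃ m ≤ n, r (vtx v π m) = c := by
    by_contra hcon
    exact hπ (if_neg hcon)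
  refine ⟨v, π, by simpa using hv, ?_, ?_⟩
  · intro i
    obtain ⟨m, _, hm⟩ := hfull i i.2.le
    exact ⟨m, hA _ _ hm⟩
  · obtain ⟨m, _, hm⟩ := hfull n le_rfl
    refine ⟨m, fun i hi => ?_⟩
    have := hle _ i (Or.inr ⟨i, rfl, hi⟩)
    have := i.2
    omega

theorem miranda_unit {n : ℕ} (f : (Fin n → ℝ) → (Fin n → ℝ))
    (hf : ContinuousOn f (Icc 0 1))
    (h0 : ∀ x ∈ Icc (0 : Fin n → ℝ) 1, ∀ i, x i = 0 → f x i ≤ 0)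
    (h1 : ∀ x ∈ Icc (0 : Fin n → ℝ) 1, ∀ i, x i = 1 → 0 ≤ f x i) :
    ∃ x ∈ Icc (0 : Fin n → ℝ) 1, f x = 0 := by
  by_contra hcon
  push Not at hcon
  have hcomp : IsCompact (Icc (0 : Fin n → ℝ) 1) := isCompact_Icc
  obtain ⟨x0, hx0, hmin⟩ := hcomp.exists_isMinOn ⟨0, by simp⟩ hf.norm
  set ε := ‖f x0‖ with hε
  have hεpos : 0 < ε := norm_pos_iff.2 (hcon x0 hx0)
  have hu := hcomp.uniformContinuousOn_of_continuous hf
  rw [Metric.uniformContinuousOn_iff] at hu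
  obtain ⟨δ, hδ, hu⟩ := hu ε hεpos
  obtain ⟨k, hk⟩ := exists_nat_gt (1/δ)
  have hkpos : (0:ℝ) < k := lt_trans (by positivity) hk
  have hk0 : 0 < k := by exact_mod_cast hkpos
  have hkδ : 1/(k:ℝ) < δ := by
    rw [div_lt_iff₀ hδ] at hk
    rw [div_lt_iff₀ hkpos]; linarith
  let sc : (Fin n → ℕ) → (Fin n → ℝ) := fun x i => (x i : ℝ) / k
  obtain ⟨v, π, hv, hneg, m1, hpos⟩ := kuhn_exists k hk0
    (fun x i => x i = 0 ∨ (x i ≠ k ∧ f (sc x) i ≤ 0)) (fun x i h => Or.inl h)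
    (by rintro x i h (h' | h')
        · omega
        · exact h'.1 h)
  have hvt : ∀ m i, v i ≤ vtx v π m i ∧ vtx v π m i ≤ v i + 1 := by
    intro m i; unfold vtx; constructor <;> split_ifs <;> omega
  have hin : ∀ x : Fin n → ℕ, (∀ i, x i ≤ k) → sc x ∈ Icc (0 : Fin n → ℝ) 1 := by
    intro x hx
    constructor
    · intro i; simp only [sc, Pi.zero_apply]; positivity
    · intro i; simp only [sc, Pi.one_apply]
      rw [div_le_one hkpos]; exact_mod_cast hx i
  have hvin := hin v (fun i => (hv i).le)
  have hvm : ∀ m, sc (vtx v π m) ∈ Icc (0 : Fin n → ℝ) 1 := fun m => hin _ (fun i => by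
    have := hv i; have := hvt m i; omega)
  have hd : ∀ m, dist (sc (vtx v π m)) (sc v) < δ := by
    intro m
    rw [dist_pi_lt_iff hδ]
    intro i
    simp only [sc]
    rw [Real.dist_eq, ← sub_div, abs_div, abs_of_pos hkpos]
    refine lt_of_le_of_lt ?_ hkδ
    gcongr
    have h1 : (v i : ℝ) ≤ (vtx v π m i : ℝ) := by exact_mod_cast (hvt m i).1
    have h2 : (vtx v π m i : ℝ) ≤ v i + 1 := by exact_mod_cast (hvt m i).2
    rw [abs_le]; constructor <;> linarith
  have hfd : ∀ m i, |f (sc (vtx v π m)) i - f (sc v) i| < ε := by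
    intro m i
    have := hu _ (hvm m) _ hvin (hd m)
    rw [dist_pi_lt_iff hεpos] at this
    exact this i
  have hlt : ‖f (sc v)‖ < ε := by
    rw [pi_norm_lt_iff hεpos]
    intro i
    rw [Real.norm_eq_abs, abs_lt]
    constructor
    · obtain h := hpos i
      have h' := abs_lt.1 (hfd m1 i)
      have : 0 ≤ f (sc (vtx v π m1)) i := by
        by_cases hh : vtx v π m1 i = k
        · apply h1 _ (hvm m1)
          simp only [sc, hh]; field_simp
        · by_contra hlt
          exact h (Or.inr ⟨hh, by linarith⟩)
      linarith
    · obtain ⟨m, hm⟩ := hneg i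
      have h' := abs_lt.1 (hfd m i)
      have : f (sc (vtx v π m)) i ≤ 0 := by
        rcases hm with hm | hm
        · apply h0 _ (hvm m)
          simp only [sc, hm]; simp
        · exact hm.2
      linarith
  exact absurd (hmin hvin) (by simpa using hlt)

/-- Poincaré–Miranda theorem on a box -/
theorem miranda {ι : Type*} [Fintype ι] (l u : ι → ℝ) (hlu : ∀ i, l i ≤ u i)
    (f : (ι → ℝ) → ι → ℝ) (hf : ContinuousOn f (Icc l u))
    (h0 : ∀ x ∈ Icc l u, ∀ i, x i = l i → f x i ≤ 0)
    (h1 : ∀ x ∈ Icc l u, ∀ i, x i = u i → 0 ≤ f x i) :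
    ∃ x ∈ Icc l u, ∀ i, f x i = 0 := by
  classical
  let e := Fintype.equivFin ι
  let X : (Fin (Fintype.card ι) → ℝ) → ι → ℝ := fun x i => l i + x (e i) * (u i - l i)
  have hX : Continuous X := by fun_prop
  have hmaps : MapsTo X (Icc 0 1) (Icc l u) := by
    intro x hx
    constructor
    · intro i
      have := hx.1 (e i)
      have h2 := hlu i
      simp only [X]; simp only [Pi.zero_apply] at this
      nlinarith
    · intro i
      have := hx.2 (e i)
      have h2 := hlu i
      simp only [X]; simp only [Pi.one_apply] at this
      nlinarith
  obtain ⟨x, hx, hx0⟩ := miranda_unit (fun x j => f (X x) (e.symm j))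
    (by
      have := hf.comp hX.continuousOn hmaps
      rw [continuousOn_pi] at this ⊢
      intro j
      exact this (e.symm j))
    (by intro x hx j hj
        apply h0 _ (hmaps hx)
        simp [X, hj])
    (by intro x hx j hj
        apply h1 _ (hmaps hx)
        simp [X, hj])
  refine ⟨X x, hmaps hx, fun i => ?_⟩
  have := congrFun hx0 (e i)
  simpa using this

end PMir

end

section
open Set Filter
open scoped NNReal

namespace Flow

variable {E : Type*} [NormedAddCommGroup E] [NormedSpace ℝ E]

lemma uniq_Ioo {V : E → E} {K : ℝ≥0} (hV : LipschitzWith K V) {f g : ℝ → E} {a b t₀ : ℝ}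
    (ht : t₀ ∈ Ioo a b) (hf : ∀ t ∈ Ioo a b, HasDerivAt f (V (f t)) t)
    (hg : ∀ t ∈ Ioo a b, HasDerivAt g (V (g t)) t) (h : f t₀ = g t₀) : EqOn f g (Ioo a b) :=
  ODE_solution_unique_of_mem_Ioo (v := fun _ => V) (s := fun _ => univ) (K := K)
    (fun _ _ => hV.lipschitzOnWith) ht
    (fun t ht => ⟨hf t ht, mem_univ _⟩) (fun t ht => ⟨hg t ht, mem_univ _⟩) h

lemma uniq {V : E → E} {K : ℝ≥0} (hV : LipschitzWith K V) {f g : ℝ → E} {t₀ : ℝ}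
    (hf : ∀ t, HasDerivAt f (V (f t)) t)
    (hg : ∀ t, HasDerivAt g (V (g t)) t) (h : f t₀ = g t₀) : f = g :=
  ODE_solution_unique_univ (v := fun _ => V) (s := fun _ => univ) (K := K)
    (fun _ => hV.lipschitzOnWith)
    (fun t => ⟨hf t, mem_univ _⟩) (fun t => ⟨hg t, mem_univ _⟩) h

lemma local_exist [CompleteSpace E] {V : E → E} {K : ℝ≥0} (hV : LipschitzWith K V) (z : E) :
    ∃ γ : ℝ → E, γ 0 = z ∧ ∀ t ∈ Ioo (-(1/(2*((K:ℝ)+1)))) (1/(2*((K:ℝ)+1))),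
      HasDerivAt γ (V (γ t)) t := by
  set T := 1/(2*((K:ℝ)+1)) with hT
  have hTpos : 0 < T := by positivity
  have hPL : IsPicardLindelof (fun _ => V) (tmin := -T) (tmax := T)
      ⟨0, by constructor <;> linarith⟩ z ‖V z‖₊ 0 (‖V z‖₊ + K * ‖V z‖₊) K := by
    refine ⟨fun _ _ => hV.lipschitzOnWith, fun _ _ => continuousOn_const, ?_, ?_⟩
    · intro t _ x hx
      have h1 := hV.dist_le_mul x z
      rw [dist_eq_norm] at h1
      have h2 : ‖V x‖ ≤ ‖V z‖ + ‖V x - V z‖ := by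
        have := norm_add_le (V z) (V x - V z); simpa using this
      rw [Metric.mem_closedBall] at hx
      push_cast
      have h3 : (K:ℝ) * dist x z ≤ K * ‖V z‖ := by
        gcongr; exact hx
      linarith
    · push_cast
      simp only [sub_zero, zero_sub, neg_neg, max_self]
      have : (‖V z‖ + K * ‖V z‖) * T = ‖V z‖ * (((K:ℝ)+1) * T) := by ring
      rw [this]
      have h2 : ((K:ℝ)+1) * T = 1/2 := by rw [hT]; field_simp
      rw [h2]
      have := norm_nonneg (V z)
      linarith
  obtain ⟨γ, h0, h1⟩ := hPL.exists_eq_forall_mem_Icc_hasDerivWithinAt₀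
  exact ⟨γ, h0, fun t ht => (h1 t ⟨ht.1.le, ht.2.le⟩).hasDerivAt (Icc_mem_nhds ht.1 ht.2)⟩

lemma shift_deriv {V : E → E} {γ : ℝ → E} {s t : ℝ}
    (h : HasDerivAt γ (V (γ (t + s))) (t + s)) :
    HasDerivAt (fun t => γ (t + s)) (V (γ (t+s))) t := h.comp_add_const t s

lemma neg_deriv {V : E → E} {γ : ℝ → E} {t : ℝ} (h : HasDerivAt γ (V (γ (-t))) (-t)) :
    HasDerivAt (fun t => γ (-t)) (- V (γ (-t))) t := by
  have := h.scomp t (hasDerivAt_neg t)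
  simpa [Function.comp_def] using this

def PE (E : Type*) [NormedAddCommGroup E] [NormedSpace ℝ E] (K : ℝ≥0) (A B : ℝ) : Prop :=
  ∀ V : E → E, LipschitzWith K V → ∀ z, ∃ γ : ℝ → E, γ 0 = z ∧
    ∀ t ∈ Ioo (-A) B, HasDerivAt γ (V (γ t)) t

lemma PE_swap {K : ℝ≥0} {A B : ℝ} (h : PE E K A B) : PE E K B A := by
  intro V hV z
  obtain ⟨γ, h0, h1⟩ := h (fun x => - V x) hV.neg z
  refine ⟨fun t => γ (-t), by simpa using h0, fun t ht => ?_⟩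
  have := neg_deriv (V := fun x => - V x) (h1 (-t) ⟨by linarith [ht.2], by linarith [ht.1]⟩)
  simpa using this

lemma PE_step [CompleteSpace E] {K : ℝ≥0} {A B T : ℝ} (hT : T = 1/(2*((K:ℝ)+1)))
    (hA : T ≤ A) (hB : T ≤ B) (h : PE E K A B) : PE E K A (B + T/2) := by
  intro V hV z
  have hTpos : 0 < T := by rw [hT]; positivity
  obtain ⟨γ, h0, h1⟩ := h V hV z
  set s := B - T/2 with hs
  obtain ⟨η, h2, h3⟩ := local_exist hV (γ s)
  rw [← hT] at h3
  have hη : ∀ t ∈ Ioo (s - T) (s + T), HasDerivAt (fun t => η (t + -s)) (V (η (t + -s))) t := by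
    intro t ht
    exact shift_deriv (h3 _ ⟨by linarith [ht.1], by linarith [ht.2]⟩)
  have heq : EqOn γ (fun t => η (t + -s)) (Ioo (max (-A) (s-T)) B) := by
    apply uniq_Ioo hV (t₀ := s)
    · constructor
      · apply max_lt <;> linarith
      · linarith
    · intro t ht
      exact h1 t ⟨lt_of_le_of_lt (le_max_left _ _) ht.1, ht.2⟩
    · intro t ht
      exact hη t ⟨lt_of_le_of_lt (le_max_right _ _) ht.1, by linarith [ht.2]⟩
    · simp [h2]
  refine ⟨fun t => if t ≤ s then γ t else η (t + -s), ?_, ?_⟩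
  · have : (0:ℝ) ≤ s := by linarith
    simp only [if_pos this]; exact h0
  · intro t ht
    by_cases hts : t ≤ s
    · have hev : (fun t => if t ≤ s then γ t else η (t + -s)) =ᶠ[nhds t] γ := by
        filter_upwards [Iio_mem_nhds (show t < B by linarith)] with u hu
        split_ifs with hus
        · rfl
        · push Not at hus
          symm; apply heq
          refine ⟨max_lt ?_ ?_, hu⟩ <;> linarith
      simp only [if_pos hts]
      exact (h1 t ⟨ht.1, by linarith⟩).congr_of_eventuallyEq hev
    · push Not at hts
      have hev : (fun t => if t ≤ s then γ t else η (t + -s)) =ᶠ[nhds t] (fun t => η (t + -s)) := by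
        filter_upwards [Ioi_mem_nhds hts] with u hu
        rw [if_neg (not_le.2 (mem_Ioi.1 hu))]
      simp only [if_neg (not_le.2 hts)]
      exact (hη t ⟨by linarith, by linarith [ht.2]⟩).congr_of_eventuallyEq hev

theorem global_exist [CompleteSpace E] {V : E → E} {K : ℝ≥0} (hV : LipschitzWith K V) (z : E) :
    ∃ γ : ℝ → E, γ 0 = z ∧ ∀ t, HasDerivAt γ (V (γ t)) t := by
  set T := 1/(2*((K:ℝ)+1)) with hT
  have hTpos : 0 < T := by rw [hT]; positivity
  have hn : ∀ n : ℕ, PE E K (T + n*(T/2)) (T + n*(T/2)) := by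
    intro n
    induction n with
    | zero =>
      intro V hV z
      have := local_exist hV z
      rw [← hT] at this
      simpa using this
    | succ n ih =>
      have hnn : 0 ≤ (n:ℝ)*(T/2) := by positivity
      have h1 := PE_step hT (by linarith) (by linarith) ih
      have h2 := PE_step hT (by linarith) (by linarith) (PE_swap h1)
      have : T + n*(T/2) + T/2 = T + ((n+1:ℕ):ℝ)*(T/2) := by push_cast; ring
      rwa [this] at h2
  have hR : ∀ R : ℝ, ∃ γ : ℝ → E, γ 0 = z ∧ ∀ t ∈ Ioo (-R) R, HasDerivAt γ (V (γ t)) t := by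
    intro R
    obtain ⟨n, hnR⟩ := exists_nat_gt (R/(T/2))
    rw [div_lt_iff₀ (by positivity)] at hnR
    obtain ⟨γ, h0, h1⟩ := hn n V hV z
    exact ⟨γ, h0, fun t ht => h1 t ⟨by linarith [ht.1], by linarith [ht.2]⟩⟩
  choose γ h0 h1 using hR
  have heq : ∀ R R', 0 < R → R ≤ R' → EqOn (γ R) (γ R') (Ioo (-R) R) := by
    intro R R' hR hRR
    apply uniq_Ioo hV (t₀ := 0) ⟨by linarith, hR⟩ (h1 R)
    · intro t ht; exact h1 R' t ⟨by linarith [ht.1], by linarith [ht.2]⟩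
    · rw [h0, h0]
  refine ⟨fun t => γ (|t|+1) t, by simp [h0], fun t => ?_⟩
  have hev : (fun t => γ (|t|+1) t) =ᶠ[nhds t] γ (|t|+2) := by
    have : ∀ᶠ u in nhds t, |u| < |t| + 1 := by
      apply (continuous_abs.tendsto t).eventually (p := fun y => y < |t| + 1)
      exact Iio_mem_nhds (by linarith)
    filter_upwards [this] with u hu
    apply heq _ _ (by positivity) (by linarith)
    rw [mem_Ioo, ← abs_lt]; linarith
  have h2 : γ (|t|+1) t = γ (|t|+2) t := by
    apply heq _ _ (by positivity) (by linarith)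
    rw [mem_Ioo, ← abs_lt]; linarith
  show HasDerivAt (fun t => γ (|t|+1) t) (V (γ (|t|+1) t)) t
  rw [h2]
  refine (h1 (|t|+2) t ?_).congr_of_eventuallyEq hev
  rw [mem_Ioo, ← abs_lt]; linarith

end Flow

end

section
open Set Filter
open scoped NNReal

namespace Flow

/-- the vector field `(y, ν x - μ f x)` -/
def fld (f : ℝ → ℝ) (ν μ : ℝ) (z : ℝ × ℝ) : ℝ × ℝ := (z.2, ν * z.1 - μ * f z.1)

open Classical in
/-- the flow of `fld` -/
noncomputable def flow (f : ℝ → ℝ) (ν μ t : ℝ) (z : ℝ × ℝ) : ℝ × ℝ :=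
  if h : ∃ γ : ℝ → ℝ × ℝ, γ 0 = z ∧ ∀ t, HasDerivAt γ (fld f ν μ (γ t)) t then h.choose t else z

variable {f : ℝ → ℝ} {K : ℝ≥0}

lemma fld_lip (hf : LipschitzWith K f) {ν μ : ℝ} {M : ℝ≥0} (hM : 1 + |ν| + |μ| * K ≤ M) :
    LipschitzWith M (fld f ν μ) := by
  apply LipschitzWith.of_dist_le_mul
  intro z w
  rw [Prod.dist_eq]
  have h1 : dist z.1 w.1 ≤ dist z w := by rw [Prod.dist_eq]; exact le_max_left _ _
  have h2 : dist z.2 w.2 ≤ dist z w := by rw [Prod.dist_eq]; exact le_max_right _ _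
  have hd : 0 ≤ dist z w := dist_nonneg
  have hK := hf.dist_le_mul z.1 w.1
  rw [Real.dist_eq] at hK h1
  have hM1 : (1 + |ν| + |μ| * K) * dist z w ≤ M * dist z w := by gcongr
  have e1 : 0 ≤ |ν| * dist z w := by positivity
  have e2 : 0 ≤ |μ| * K * dist z w := by positivity
  apply max_le
  · simp only [fld]
    nlinarith
  · simp only [fld, Real.dist_eq]
    have : ν * z.1 - μ * f z.1 - (ν * w.1 - μ * f w.1) = ν * (z.1 - w.1) - μ * (f z.1 - f w.1) := by
      ring
    rw [this]
    refine (abs_sub _ _).trans ?_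
    rw [abs_mul, abs_mul]
    have e3 : |ν| * |z.1 - w.1| ≤ |ν| * dist z w := by gcongr
    have e4 : |μ| * |f z.1 - f w.1| ≤ |μ| * (K * dist z w) := by
      gcongr
      refine hK.trans ?_
      rw [Real.dist_eq]
      gcongr
    nlinarith

lemma fld_lip' (hf : LipschitzWith K f) (ν μ : ℝ) : ∃ M : ℝ≥0, LipschitzWith M (fld f ν μ) :=
  ⟨Real.toNNReal (1 + |ν| + |μ| * K), fld_lip hf (Real.le_coe_toNNReal _)⟩

lemma flow_spec (hf : LipschitzWith K f) (ν μ : ℝ) (z : ℝ × ℝ) :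
    flow f ν μ 0 z = z ∧ ∀ t, HasDerivAt (fun t => flow f ν μ t z) (fld f ν μ (flow f ν μ t z)) t := by
  obtain ⟨M, hM⟩ := fld_lip' hf ν μ
  have h := global_exist hM z
  unfold flow
  simp only [dif_pos h]
  exact h.choose_spec

lemma flow_zero (hf : LipschitzWith K f) (ν μ : ℝ) (z : ℝ × ℝ) : flow f ν μ 0 z = z :=
  (flow_spec hf ν μ z).1

lemma flow_deriv (hf : LipschitzWith K f) (ν μ : ℝ) (z : ℝ × ℝ) (t : ℝ) :
    HasDerivAt (fun t => flow f ν μ t z) (fld f ν μ (flow f ν μ t z)) t :=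
  (flow_spec hf ν μ z).2 t

lemma flow_deriv1 (hf : LipschitzWith K f) (ν μ : ℝ) (z : ℝ × ℝ) (t : ℝ) :
    HasDerivAt (fun t => (flow f ν μ t z).1) (flow f ν μ t z).2 t := by
  have h := (hasFDerivAt_fst (𝕜 := ℝ) (p := flow f ν μ t z)).comp_hasDerivAt t (flow_deriv hf ν μ z t)
  simpa [fld, Function.comp_def] using h

lemma flow_deriv2 (hf : LipschitzWith K f) (ν μ : ℝ) (z : ℝ × ℝ) (t : ℝ) :
    HasDerivAt (fun t => (flow f ν μ t z).2)
      (ν * (flow f ν μ t z).1 - μ * f (flow f ν μ t z).1) t := by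
  have h := (hasFDerivAt_snd (𝕜 := ℝ) (p := flow f ν μ t z)).comp_hasDerivAt t (flow_deriv hf ν μ z t)
  simpa [fld, Function.comp_def] using h

lemma flow_unique (hf : LipschitzWith K f) {ν μ : ℝ} {γ : ℝ → ℝ × ℝ}
    (hγ : ∀ t, HasDerivAt γ (fld f ν μ (γ t)) t) (t : ℝ) : γ t = flow f ν μ t (γ 0) := by
  obtain ⟨M, hM⟩ := fld_lip' hf ν μ
  exact congrFun (uniq hM (t₀ := 0) hγ (flow_deriv hf ν μ (γ 0)) (flow_zero hf ν μ _).symm) t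

lemma flow_add (hf : LipschitzWith K f) (ν μ s t : ℝ) (z : ℝ × ℝ) :
    flow f ν μ (t + s) z = flow f ν μ t (flow f ν μ s z) := by
  have := flow_unique hf (γ := fun t => flow f ν μ (t + s) z)
    (fun t => shift_deriv (flow_deriv hf ν μ z (t + s))) t
  simpa using this

lemma flow_rev (hf : LipschitzWith K f) (ν μ t : ℝ) (z : ℝ × ℝ) :
    flow f ν μ (-t) z = ((flow f ν μ t (z.1, -z.2)).1, -(flow f ν μ t (z.1, -z.2)).2) := by
  symm
  have h := flow_unique hf (ν := ν) (μ := μ)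
    (γ := fun s => ((flow f ν μ (-s) (z.1, -z.2)).1, -(flow f ν μ (-s) (z.1, -z.2)).2)) ?_ (-t)
  · simpa [flow_zero hf] using h
  · intro s
    have h1 := (flow_deriv1 hf ν μ (z.1, -z.2) (-s)).scomp s (hasDerivAt_neg s)
    have h2 := ((flow_deriv2 hf ν μ (z.1, -z.2) (-s)).scomp s (hasDerivAt_neg s)).neg
    have := h1.prodMk h2
    simpa [fld, Function.comp_def] using this

/-- scaling of time -/
lemma flow_scale (hf : LipschitzWith K f) (ν : ℝ) (w : ℝ) (hw : w ≠ 0) (t : ℝ) (z : ℝ × ℝ) :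
    flow f ν (w^2) t z = ((flow f (ν / w^2) 1 (w * t) (z.1, z.2 / w)).1,
      w * (flow f (ν / w^2) 1 (w * t) (z.1, z.2 / w)).2) := by
  symm
  have h := flow_unique hf (ν := ν) (μ := w^2)
    (γ := fun s => ((flow f (ν / w^2) 1 (w * s) (z.1, z.2 / w)).1,
      w * (flow f (ν / w^2) 1 (w * s) (z.1, z.2 / w)).2)) ?_ t
  · have e : w * (z.2 / w) = z.2 := by field_simp
    simpa [flow_zero hf, e] using h
  · intro s
    have h0 : HasDerivAt (fun s : ℝ => w * s) w s := by simpa using (hasDerivAt_id s).const_mul w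
    have h1 := (flow_deriv1 hf (ν / w^2) 1 (z.1, z.2 / w) (w * s)).scomp s h0
    have h2 := ((flow_deriv2 hf (ν / w^2) 1 (z.1, z.2 / w) (w * s)).scomp s h0).const_mul w
    have := h1.prodMk h2
    refine HasDerivAt.congr_deriv (f := fun s => ((flow f (ν / w^2) 1 (w * s) (z.1, z.2 / w)).1,
      w * (flow f (ν / w^2) 1 (w * s) (z.1, z.2 / w)).2)) this ?_
    simp only [fld, smul_eq_mul, Prod.mk.injEq, true_and]
    field_simp

lemma flow_cont_nonneg (hf : LipschitzWith K f) (μ : ℝ) :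
    Continuous (fun p : ℝ × ℝ × (ℝ × ℝ) => flow f p.1 μ |p.2.1| p.2.2) := by
  rw [continuous_iff_continuousAt]
  rintro ⟨ν0, t0, z0⟩
  set T := |t0| + 1 with hT
  set L : ℝ≥0 := Real.toNNReal (1 + (|ν0| + 1) + |μ| * K) with hL
  have hLc : (L : ℝ) = 1 + (|ν0| + 1) + |μ| * K := Real.coe_toNNReal _ (by positivity)
  have hL1 : (1:ℝ) ≤ L := by
    rw [hLc]; have := abs_nonneg ν0; have : 0 ≤ |μ| * K := by positivity
    linarith
  have hc0 : Continuous (fun t => flow f ν0 μ t z0) :=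
    continuous_iff_continuousAt.2 fun t => (flow_deriv hf ν0 μ z0 t).continuousAt
  obtain ⟨M, hM⟩ : ∃ M, ∀ t ∈ Icc 0 T, ‖(flow f ν0 μ t z0).1‖ ≤ M :=
    (isCompact_Icc.exists_bound_of_continuousOn (continuous_fst.comp hc0).continuousOn)
  have hM0 : 0 ≤ M := (norm_nonneg _).trans (hM 0 ⟨le_rfl, by positivity⟩)
  have key : ∀ ν z, |ν - ν0| ≤ 1 → ∀ t ∈ Icc 0 T, dist (flow f ν μ t z) (flow f ν0 μ t z0)
      ≤ (dist z z0 + |ν - ν0| * M) * Real.exp (L * T) := by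
    intro ν z hν t ht
    have hlip : LipschitzWith L (fld f ν μ) := by
      apply fld_lip hf
      rw [hLc]
      have : |ν| ≤ |ν0| + 1 := by
        have := abs_sub_abs_le_abs_sub ν ν0; linarith
      linarith
    have hcν : Continuous (fun t => flow f ν μ t z) :=
      continuous_iff_continuousAt.2 fun t => (flow_deriv hf ν μ z t).continuousAt
    have h := dist_le_of_approx_trajectories_ODE (v := fun _ => fld f ν μ) (K := L)
      (f := fun t => flow f ν μ t z) (g := fun t => flow f ν0 μ t z0)
      (f' := fun t => fld f ν μ (flow f ν μ t z)) (g' := fun t => fld f ν0 μ (flow f ν0 μ t z0))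
      (a := 0) (b := T) (εf := 0) (εg := |ν - ν0| * M) (δ := dist z z0)
      (fun _ => hlip) hcν.continuousOn
      (fun t _ => (flow_deriv hf ν μ z t).hasDerivWithinAt) (fun t _ => by simp)
      hc0.continuousOn (fun t _ => (flow_deriv hf ν0 μ z0 t).hasDerivWithinAt)
      (fun t ht => by
        have := hM t ⟨ht.1, ht.2.le⟩
        rw [Real.norm_eq_abs] at this
        simp only [fld, Prod.dist_eq, dist_self, Real.dist_eq]
        apply max_le (by positivity)
        have e : ν0 * (flow f ν0 μ t z0).1 - μ * f (flow f ν0 μ t z0).1 -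
          (ν * (flow f ν0 μ t z0).1 - μ * f (flow f ν0 μ t z0).1) =
            (ν0 - ν) * (flow f ν0 μ t z0).1 := by ring
        rw [e, abs_mul, abs_sub_comm]
        gcongr)
      (by rw [flow_zero hf, flow_zero hf]) t ht
    refine h.trans ?_
    rw [gronwallBound_of_K_ne_0 (by positivity)]
    simp only [zero_add, sub_zero]
    have e1 : Real.exp (L * t) ≤ Real.exp (L * T) := by
      apply Real.exp_le_exp.2; have := ht.2; gcongr
    have e2 : |ν - ν0| * M / L ≤ |ν - ν0| * M := by
      apply div_le_self (by positivity) hL1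
    have e3 : 0 < Real.exp (L * t) := Real.exp_pos _
    have e4 : 0 ≤ |ν - ν0| * M / L := by positivity
    have e5 : 0 ≤ |ν - ν0| * M := by positivity
    have e6 : (dist z z0 + |ν - ν0| * M) * Real.exp (L * t) ≤
      (dist z z0 + |ν - ν0| * M) * Real.exp (L * T) := by gcongr
    have e7 : |ν - ν0| * M / L * Real.exp (L*t) ≤ |ν - ν0| * M * Real.exp (L*t) := by gcongr
    nlinarith
  have hlim : Tendsto (fun p : ℝ × ℝ × (ℝ × ℝ) =>
      (dist p.2.2 z0 + |p.1 - ν0| * M) * Real.exp (L * T)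
        + dist (flow f ν0 μ |p.2.1| z0) (flow f ν0 μ |t0| z0)) (nhds (ν0, t0, z0)) (nhds 0) := by
    have hc : Continuous (fun p : ℝ × ℝ × (ℝ × ℝ) =>
      (dist p.2.2 z0 + |p.1 - ν0| * M) * Real.exp (L * T)
        + dist (flow f ν0 μ |p.2.1| z0) (flow f ν0 μ |t0| z0)) := by
      have : Continuous (fun p : ℝ × ℝ × (ℝ × ℝ) => flow f ν0 μ |p.2.1| z0) :=
        hc0.comp (by fun_prop)
      fun_prop
    have := hc.tendsto (ν0, t0, z0)
    simpa using this
  show Tendsto _ _ _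
  rw [tendsto_iff_dist_tendsto_zero]
  refine squeeze_zero' (Eventually.of_forall fun _ => dist_nonneg) ?_ hlim
  have h1 : ∀ᶠ p : ℝ × ℝ × (ℝ × ℝ) in nhds (ν0, t0, z0), |p.1 - ν0| < 1 := by
    have hc : Continuous (fun p : ℝ × ℝ × (ℝ × ℝ) => |p.1 - ν0|) := by fun_prop
    exact hc.continuousAt.eventually_lt continuousAt_const (by simp)
  have h2 : ∀ᶠ p : ℝ × ℝ × (ℝ × ℝ) in nhds (ν0, t0, z0), |p.2.1| < T := by
    have hc : Continuous (fun p : ℝ × ℝ × (ℝ × ℝ) => |p.2.1|) := by fun_prop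
    exact hc.continuousAt.eventually_lt continuousAt_const (by simp [hT])
  filter_upwards [h1, h2] with p hp1 hp2
  refine (dist_triangle _ (flow f ν0 μ |p.2.1| z0) _).trans ?_
  gcongr
  exact key p.1 p.2.2 hp1.le |p.2.1| ⟨abs_nonneg _, hp2.le⟩

lemma flow_cont (hf : LipschitzWith K f) (μ : ℝ) :
    Continuous (fun p : ℝ × ℝ × (ℝ × ℝ) => flow f p.1 μ p.2.1 p.2.2) := by
  have h0 := flow_cont_nonneg hf μ
  have h1 : Continuous (fun p : ℝ × ℝ × (ℝ × ℝ) => flow f p.1 μ |p.2.1| (p.2.2.1, -p.2.2.2)) :=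
    h0.comp (f := fun p : ℝ × ℝ × (ℝ × ℝ) => (p.1, p.2.1, (p.2.2.1, -p.2.2.2))) (by fun_prop)
  have h2 : Continuous (fun p : ℝ × ℝ × (ℝ × ℝ) =>
      if 0 ≤ p.2.1 then flow f p.1 μ |p.2.1| p.2.2 else
        ((flow f p.1 μ |p.2.1| (p.2.2.1, -p.2.2.2)).1,
          -(flow f p.1 μ |p.2.1| (p.2.2.1, -p.2.2.2)).2)) := by
    apply Continuous.if_le h0 (by fun_prop) continuous_const (by fun_prop)
    intro p hp
    rw [← hp]
    simp [flow_zero hf]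
  convert h2 using 2 with p
  split_ifs with h
  · rw [abs_of_nonneg h]
  · push Not at h
    rw [abs_of_neg h, ← flow_rev hf, neg_neg]

lemma flow_cont_z (hf : LipschitzWith K f) (ν μ t : ℝ) :
    Continuous (fun z : ℝ × ℝ => flow f ν μ t z) :=
  (flow_cont hf μ).comp (f := fun z => (ν, t, z)) (by fun_prop)

lemma flow_cont_t (hf : LipschitzWith K f) (ν μ : ℝ) (z : ℝ × ℝ) :
    Continuous (fun t : ℝ => flow f ν μ t z) :=
  (flow_cont hf μ).comp (f := fun t => (ν, t, z)) (by fun_prop)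

end Flow

end

section
open Set Filter
open scoped NNReal

namespace Flow

/-- standing assumptions on the (truncated) nonlinearity -/
structure Nag (f : ℝ → ℝ) (K : ℝ≥0) (a : ℝ) : Prop where
  lip : LipschitzWith K f
  ha0 : 0 < a
  ha1 : a < 1
  f0 : f 0 = 0
  fa : f a = 0
  f1 : f 1 = 0
  neg : ∀ s, 0 < s → s < a → f s < 0
  pos : ∀ s, a < s → s < 1 → 0 < f s
  int_pos : 0 < ∫ s in (0:ℝ)..1, f s

/-- potential -/
noncomputable def pot (f : ℝ → ℝ) (x : ℝ) : ℝ := ∫ s in (0:ℝ)..x, f s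

variable {f : ℝ → ℝ} {K : ℝ≥0} {a : ℝ}

namespace Nag

lemma pot_deriv (h : Nag f K a) (x : ℝ) : HasDerivAt (pot f) (f x) x :=
  h.lip.continuous.integral_hasStrictDerivAt 0 x |>.hasDerivAt

lemma pot_cont (h : Nag f K a) : Continuous (pot f) :=
  continuous_iff_continuousAt.2 fun x => (h.pot_deriv x).continuousAt

lemma pot_zero : pot f 0 = 0 := by simp [pot]

lemma pot_anti (h : Nag f K a) : StrictAntiOn (pot f) (Icc 0 a) := by
  apply strictAntiOn_of_deriv_neg (convex_Icc 0 a) h.pot_cont.continuousOn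
  intro x hx
  rw [interior_Icc] at hx
  rw [(h.pot_deriv x).deriv]
  exact h.neg x hx.1 hx.2

lemma pot_mono (h : Nag f K a) : StrictMonoOn (pot f) (Icc a 1) := by
  apply strictMonoOn_of_deriv_pos (convex_Icc a 1) h.pot_cont.continuousOn
  intro x hx
  rw [interior_Icc] at hx
  rw [(h.pot_deriv x).deriv]
  exact h.pos x hx.1 hx.2

lemma pot_a (h : Nag f K a) : pot f a < 0 := by
  have := h.pot_anti (left_mem_Icc.2 h.ha0.le) (right_mem_Icc.2 h.ha0.le) h.ha0
  rwa [pot_zero] at this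

lemma exists_xh (h : Nag f K a) : ∃ xh, a < xh ∧ xh < 1 ∧ pot f xh = 0 := by
  have h1 : 0 < pot f 1 := h.int_pos
  obtain ⟨x, hx, hx0⟩ := intermediate_value_Ioo h.ha1.le h.pot_cont.continuousOn
    (show (0:ℝ) ∈ Ioo (pot f a) (pot f 1) from ⟨h.pot_a, h1⟩)
  exact ⟨x, hx.1, hx.2, hx0⟩

lemma abs_le (h : Nag f K a) (x : ℝ) : |f x| ≤ K * |x| := by
  have := h.lip.dist_le_mul x 0
  rw [Real.dist_eq, Real.dist_eq, h.f0] at this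
  simpa using this

/-- `-pot f x ≤ K x^2/2` for nonnegative `x` -/
lemma pot_ge (h : Nag f K a) {x : ℝ} (hx : 0 ≤ x) : - (K * x^2 / 2) ≤ pot f x := by
  have hm : MonotoneOn (fun x => pot f x + K * x^2/2) (Ici 0) := by
    have hd : ∀ x, HasDerivAt (fun x => pot f x + K * x^2/2) (f x + K * x) x := by
      intro x
      have h2 := (h.pot_deriv x).add (((hasDerivAt_pow 2 x).const_mul (K:ℝ)).div_const 2)
      refine h2.congr_deriv ?_
      norm_num
      ring
    apply monotoneOn_of_deriv_nonneg (convex_Ici 0)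
    · exact (continuous_iff_continuousAt.2 fun x => (hd x).continuousAt).continuousOn
    · intro x _; exact (hd x).differentiableAt.differentiableWithinAt
    · intro x hx
      rw [interior_Ici] at hx
      rw [(hd x).deriv]
      have := h.abs_le x
      rw [abs_of_pos (mem_Ioi.1 hx)] at this
      linarith [neg_abs_le (f x)]
  have := hm (mem_Ici.2 le_rfl) (mem_Ici.2 hx) hx
  simp [pot_zero] at this
  linarith

/-- pinching by the potential on `[a,1]` -/
lemma near (h : Nag f K a) {lo hi δ : ℝ} (hδ : 0 < δ) (hlh : lo ≤ hi) (hlo : a < lo - δ)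
    (hhi : hi + δ < 1) : ∃ η > 0, ∀ x0 ∈ Icc lo hi, ∀ X ∈ Icc a 1,
      (pot f X < pot f x0 + η → X < hi + δ) ∧ (pot f x0 - η < pot f X → lo - δ < X) := by
  have h1 : pot f hi < pot f (hi + δ) :=
    h.pot_mono ⟨by linarith, by linarith⟩ ⟨by linarith, by linarith⟩ (by linarith)
  have h2 : pot f (lo - δ) < pot f lo :=
    h.pot_mono ⟨by linarith, by linarith⟩ ⟨by linarith, by linarith⟩ (by linarith)
  refine ⟨min (pot f (hi + δ) - pot f hi) (pot f lo - pot f (lo - δ)),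
    lt_min (by linarith) (by linarith), ?_⟩
  intro x0 hx0 X hX
  have h3 : pot f x0 ≤ pot f hi :=
    h.pot_mono.monotoneOn ⟨by linarith [hx0.1], by linarith [hx0.2]⟩
      ⟨by linarith, by linarith⟩ hx0.2
  have h4 : pot f lo ≤ pot f x0 :=
    h.pot_mono.monotoneOn ⟨by linarith, by linarith⟩
      ⟨by linarith [hx0.1], by linarith [hx0.2]⟩ hx0.1
  have m1 := min_le_left (pot f (hi + δ) - pot f hi) (pot f lo - pot f (lo - δ))
  have m2 := min_le_right (pot f (hi + δ) - pot f hi) (pot f lo - pot f (lo - δ))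
  constructor
  · intro hh
    by_contra hc
    push Not at hc
    have := h.pot_mono.monotoneOn (show hi + δ ∈ Icc a 1 from ⟨by linarith, by linarith⟩) hX hc
    linarith
  · intro hh
    by_contra hc
    push Not at hc
    have := h.pot_mono.monotoneOn hX (show lo - δ ∈ Icc a 1 from ⟨by linarith, by linarith⟩) hc
    linarith

/-- conservation of energy for the scaled system -/
lemma energy (h : Nag f K a) (ν μ : ℝ) (z : ℝ × ℝ) (t : ℝ) :
    (flow f ν μ t z).2^2/2 + μ * pot f (flow f ν μ t z).1 - ν * (flow f ν μ t z).1^2/2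
      = z.2^2/2 + μ * pot f z.1 - ν * z.1^2/2 := by
  have hd : ∀ t, HasDerivAt (fun t => (flow f ν μ t z).2^2/2 + μ * pot f (flow f ν μ t z).1
      - ν * (flow f ν μ t z).1^2/2) 0 t := by
    intro t
    have h1 := flow_deriv1 h.lip ν μ z t
    have h2 := flow_deriv2 h.lip ν μ z t
    have h3 := (((h2.pow 2).div_const 2).add (((h.pot_deriv _).comp t h1).const_mul μ)).sub
      (((h1.pow 2).const_mul ν).div_const 2)
    refine h3.congr_deriv ?_
    simp
    ring
  have := is_const_of_deriv_eq_zero (fun t => (hd t).differentiableAt) (fun t => (hd t).deriv) t 0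
  simpa [flow_zero h.lip] using this

end Nag

end Flow

end

section
open Set Filter
open scoped NNReal

namespace Flow
variable {f : ℝ → ℝ} {K : ℝ≥0} {a : ℝ}
namespace Nag

lemma exists_rho (h : Nag f K a) {p : ℝ} (hp : a < p) (hp1 : p < 1) :
    ∃ ρ > 0, ∀ x v : ℝ, pot f ((a+p)/2) ≤ v^2/2 + pot f x → ρ ≤ (x-a)^2+v^2 := by
  have hc : Continuous (fun z : ℝ × ℝ => z.2^2/2 + pot f z.1) := by
    have := h.pot_cont
    fun_prop
  have hlt : pot f a < pot f ((a+p)/2) :=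
    h.pot_mono ⟨le_rfl, h.ha1.le⟩ ⟨by linarith, by linarith⟩ (by linarith)
  have hev : ∀ᶠ z : ℝ × ℝ in nhds (a, 0), z.2^2/2 + pot f z.1 < pot f ((a+p)/2) :=
    hc.continuousAt.eventually_lt continuousAt_const (by simpa using hlt)
  rw [Metric.eventually_nhds_iff] at hev
  obtain ⟨r, hr, hev⟩ := hev
  refine ⟨r^2, by positivity, fun x v hxv => ?_⟩
  by_contra hcon
  push Not at hcon
  have : dist ((x, v) : ℝ × ℝ) (a, 0) < r := by
    rw [Prod.dist_eq, max_lt_iff, Real.dist_eq, Real.dist_eq]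
    constructor
    · apply abs_lt_of_sq_lt_sq _ hr.le; nlinarith [sq_nonneg v]
    · apply abs_lt_of_sq_lt_sq _ hr.le; simp; nlinarith [sq_nonneg (x-a)]
  have := hev this
  simp only at this
  linarith

lemma sgn (h : Nag f K a) {x : ℝ} (h0 : 0 ≤ x) (h1 : x ≤ 1) : 0 ≤ (x - a) * f x := by
  rcases h0.eq_or_lt with h0 | h0
  · rw [← h0, h.f0]; simp
  rcases h1.eq_or_lt with h1 | h1
  · rw [h1, h.f1]; simp
  rcases lt_trichotomy x a with hx | hx | hx
  · have := h.neg x h0 hx; nlinarith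
  · rw [hx]; simp
  · have := h.pos x hx h1; nlinarith

set_option maxHeartbeats 1600000 in
lemma Klem (h : Nag f K a) {p q xh : ℝ} (hp : a < p) (hpq : p ≤ q) (hq : q < xh) (hxh : xh < 1)
    (hxh0 : pot f xh = 0) :
    ∃ ε0 > 0, ∃ c0 > 0, ∀ ν : ℝ, 0 ≤ ν → ν ≤ ε0 → ∀ z : ℝ × ℝ, z.1 ∈ Icc p q → z.2^2 ≤ ε0 →
      ∀ t, 0 < (flow f ν 1 t z).1 ∧ (flow f ν 1 t z).1 < xh ∧
        pot f ((a+p)/2) ≤ (flow f ν 1 t z).2^2/2 + pot f (flow f ν 1 t z).1 ∧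
        c0 ≤ ((flow f ν 1 t z).2^2 + ((flow f ν 1 t z).1 - a) *
          (f (flow f ν 1 t z).1 - ν * (flow f ν 1 t z).1)) /
            (((flow f ν 1 t z).1 - a)^2 + (flow f ν 1 t z).2^2) := by
  set c1 := pot f ((a+p)/2) with hc1
  set xu := (q + xh)/2 with hxu
  set c2 := (pot f q + pot f xu)/2 with hc2
  have hac1 : pot f a < c1 :=
    h.pot_mono ⟨le_rfl, h.ha1.le⟩ ⟨by linarith, by linarith⟩ (by linarith)
  have hc1p : c1 < pot f p := h.pot_mono ⟨by linarith, by linarith⟩ ⟨by linarith, by linarith⟩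
    (by linarith)
  have hqu : pot f q < pot f xu := h.pot_mono ⟨by linarith, by linarith⟩
    ⟨by linarith, by linarith⟩ (by linarith)
  have hu0 : pot f xu < 0 := by
    rw [← hxh0]
    exact h.pot_mono ⟨by linarith, by linarith⟩ ⟨by linarith, by linarith⟩ (by linarith)
  let S : Set (ℝ × ℝ) := {z | (0 ≤ z.1 ∧ z.1 ≤ xu) ∧ (c1 ≤ z.2^2/2 + pot f z.1 ∧
    z.2^2/2 + pot f z.1 ≤ c2)}
  have hPc := h.pot_cont
  have hfc := h.lip.continuous
  have hSclosed : IsClosed S := by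
    apply IsClosed.inter
    · exact (isClosed_le continuous_const continuous_fst).inter
        (isClosed_le continuous_fst continuous_const)
    · have hEc : Continuous (fun z : ℝ × ℝ => z.2^2/2 + pot f z.1) := by fun_prop
      exact (isClosed_le continuous_const hEc).inter (isClosed_le hEc continuous_const)
  have hSb : S ⊆ Icc (0:ℝ) 1 ×ˢ Icc (-(2+K:ℝ)) (2+K) := by
    intro z hz
    obtain ⟨⟨h1, h2⟩, h3, h4⟩ := hz
    refine ⟨⟨h1, by linarith⟩, ?_⟩
    have h5 := h.pot_ge h1
    have h6 : z.2^2 ≤ K := by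
      have : z.1^2 ≤ 1 := by nlinarith
      have hK : (0:ℝ) ≤ K := K.2
      nlinarith
    rw [mem_Icc, ← _root_.abs_le]
    apply abs_le_of_sq_le_sq _ (by positivity)
    have hK : (0:ℝ) ≤ K := K.2
    nlinarith
  have hScomp : IsCompact S :=
    (isCompact_Icc.prod isCompact_Icc).of_isClosed_subset hSclosed hSb
  have hnum : Continuous (fun z : ℝ × ℝ => z.2^2 + (z.1 - a) * f z.1) := by fun_prop
  have hpS : (p, 0) ∈ S := by
    have : pot f p ≤ pot f q := h.pot_mono.monotoneOn ⟨by linarith, by linarith⟩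
      ⟨by linarith, by linarith⟩ hpq
    refine ⟨⟨by linarith [h.ha0], by simp only; linarith⟩, ?_, ?_⟩ <;> simp <;> linarith
  obtain ⟨zm, hzm, hmin⟩ := hScomp.exists_isMinOn ⟨_, hpS⟩ hnum.continuousOn
  set nm := zm.2^2 + (zm.1 - a) * f zm.1 with hnm
  have hnmpos : 0 < nm := by
    obtain ⟨⟨h1, h2⟩, h3, h4⟩ := hzm
    have hs := h.sgn h1 (by linarith)
    by_contra hcon
    have hv : zm.2^2 = 0 := by nlinarith [sq_nonneg zm.2]
    have hxf : (zm.1 - a) * f zm.1 = 0 := by nlinarith [sq_nonneg zm.2]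
    rw [hv] at h3 h4
    rcases mul_eq_zero.1 hxf with h5 | h5
    · have : zm.1 = a := by linarith
      rw [this] at h3; linarith
    · rcases h1.eq_or_lt with h1 | h1
      · rw [← h1, pot_zero] at h4; linarith
      · rcases lt_trichotomy zm.1 a with hx | hx | hx
        · have := h.neg _ h1 hx; linarith
        · rw [hx] at h3; linarith
        · have := h.pos _ hx (by linarith); linarith
  have hDpos : (0:ℝ) < 1 + (2+K)^2 := by positivity
  refine ⟨min (nm/2) (min (pot f p - c1) ((c2 - pot f q)/2)),
    lt_min (by linarith) (lt_min (by linarith) (by linarith)), (nm/2)/(1 + (2+K)^2),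
    by positivity, ?_⟩
  intro ν hν0 hν z hz1 hz2 t
  have m1 := min_le_left (nm/2) (min (pot f p - c1) ((c2 - pot f q)/2))
  have m2 := (min_le_right (nm/2) (min (pot f p - c1) ((c2 - pot f q)/2))).trans (min_le_left _ _)
  have m3 := (min_le_right (nm/2) (min (pot f p - c1) ((c2 - pot f q)/2))).trans (min_le_right _ _)
  have hz1p : pot f p ≤ pot f z.1 := h.pot_mono.monotoneOn ⟨by linarith, by linarith⟩
      ⟨by linarith [hz1.1], by linarith [hz1.2]⟩ hz1.1
  have hz1q : pot f z.1 ≤ pot f q := h.pot_mono.monotoneOn ⟨by linarith [hz1.1], by linarith [hz1.2]⟩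
      ⟨by linarith, by linarith⟩ hz1.2
  have hE : ∀ t, 0 ≤ (flow f ν 1 t z).1 → (flow f ν 1 t z).1 ≤ 1 →
      c1 ≤ (flow f ν 1 t z).2^2/2 + pot f (flow f ν 1 t z).1 ∧
      (flow f ν 1 t z).2^2/2 + pot f (flow f ν 1 t z).1 ≤ c2 := by
    intro t h0 h1
    have he := h.energy ν 1 z t
    have a1 : (flow f ν 1 t z).1^2 ≤ 1 := by nlinarith
    have a2 : z.1^2 ≤ 1 := by nlinarith [hz1.1, hz1.2, h.ha0]
    have a3 : 0 ≤ ν * (flow f ν 1 t z).1^2 := by positivity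
    have a4 : 0 ≤ ν * z.1^2 := by positivity
    have a5 : ν * (flow f ν 1 t z).1^2 ≤ ν * 1 := by gcongr
    have a6 : ν * z.1^2 ≤ ν * 1 := by gcongr
    have a7 := sq_nonneg z.2
    constructor <;> linarith
  have hc := (continuous_fst.comp (flow_cont_t h.lip ν 1 z))
  have hX : ∀ t, 0 < (flow f ν 1 t z).1 ∧ (flow f ν 1 t z).1 < xu := by
    have hno0 : ∀ t, (flow f ν 1 t z).1 ≠ 0 := by
      intro t h0
      have := (hE t (by rw [h0]) (by rw [h0]; norm_num)).2
      rw [h0, pot_zero] at this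
      nlinarith [sq_nonneg (flow f ν 1 t z).2]
    have hnou : ∀ t, (flow f ν 1 t z).1 ≠ xu := by
      intro t h0
      have := (hE t (by rw [h0]; linarith [h.ha0]) (by rw [h0]; linarith)).2
      rw [h0] at this
      nlinarith [sq_nonneg (flow f ν 1 t z).2]
    have hs0 : (flow f ν 1 0 z).1 = z.1 := by rw [flow_zero h.lip]
    intro t
    constructor
    · by_contra hcon
      push Not at hcon
      obtain ⟨s, hs⟩ := mem_range_of_exists_le_of_exists_ge hc ⟨t, hcon⟩
        ⟨0, show (0:ℝ) ≤ (flow f ν 1 0 z).1 by rw [hs0]; linarith [hz1.1, h.ha0]⟩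
      exact hno0 s hs
    · by_contra hcon
      push Not at hcon
      obtain ⟨s, hs⟩ := mem_range_of_exists_le_of_exists_ge hc
        ⟨0, show (flow f ν 1 0 z).1 ≤ xu by rw [hs0]; linarith [hz1.2]⟩ ⟨t, hcon⟩
      exact hnou s hs
  obtain ⟨hX0, hXu⟩ := hX t
  obtain ⟨hE1, hE2⟩ := hE t hX0.le (by linarith)
  have hS : flow f ν 1 t z ∈ S := ⟨⟨hX0.le, hXu.le⟩, hE1, hE2⟩
  refine ⟨hX0, by linarith, hE1, ?_⟩
  have hmin' : nm ≤ (flow f ν 1 t z).2^2 + ((flow f ν 1 t z).1 - a) * f (flow f ν 1 t z).1 :=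
    hmin hS
  obtain ⟨r, hr, hρ⟩ := h.exists_rho hp (by linarith)
  have hD0 := hρ _ _ hE1
  have hb := hSb hS
  generalize flow f ν 1 t z = w at *
  have hb2 := hb.2
  rw [mem_Icc, ← _root_.abs_le] at hb2
  have hv2 : w.2^2 ≤ (2+K)^2 := sq_le_sq' (by linarith [neg_abs_le w.2]) ((le_abs_self _).trans hb2)
  have hx2 : (w.1 - a)^2 ≤ 1 := by nlinarith [h.ha0, h.ha1]
  have hν1 : (w.1 - a) * (ν * w.1) ≤ nm/2 := by
    have : (w.1 - a) * w.1 ≤ 1 := by nlinarith [h.ha0, h.ha1]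
    nlinarith
  apply div_le_div₀ (by nlinarith) (by nlinarith) (by linarith) (by linarith)

/-- angular velocity with guarded denominator -/
noncomputable def Om (f : ℝ → ℝ) (a ρ ν : ℝ) (z : ℝ × ℝ) : ℝ :=
  (z.2^2 + (z.1 - a) * (f z.1 - ν * z.1)) / max ρ ((z.1 - a)^2 + z.2^2)

noncomputable def ang0 (a p : ℝ) (z : ℝ × ℝ) : ℝ := - Real.arctan (z.2 / max (z.1 - a) (p - a))

/-- the angle -/
noncomputable def th (f : ℝ → ℝ) (a p ρ ν : ℝ) (z : ℝ × ℝ) (t : ℝ) : ℝ :=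
  ang0 a p z + ∫ s in (0:ℝ)..t, Om f a ρ ν (flow f ν 1 s z)

lemma Om_cont (h : Nag f K a) {ρ : ℝ} (hρ : 0 < ρ) :
    Continuous (fun q : ℝ × (ℝ × ℝ) => Om f a ρ q.1 q.2) := by
  have hfc := h.lip.continuous
  unfold Om
  apply Continuous.div (by fun_prop) (by fun_prop)
  intro q
  exact (lt_of_lt_of_le hρ (le_max_left _ _)).ne'

lemma ang0_cont {p : ℝ} (hp : a < p) : Continuous (ang0 a p) := by
  unfold ang0
  refine (Real.continuous_arctan.comp (Continuous.div (by fun_prop) (by fun_prop) ?_)).neg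
  intro z
  exact (lt_of_lt_of_le (by linarith) (le_max_right _ _)).ne'

lemma th_cont (h : Nag f K a) {p ρ : ℝ} (hp : a < p) (hρ : 0 < ρ) :
    Continuous (fun q : ℝ × (ℝ × ℝ) × ℝ => th f a p ρ q.1 q.2.1 q.2.2) := by
  unfold th
  apply Continuous.add ((ang0_cont hp).comp (by fun_prop))
  apply intervalIntegral.continuous_parametric_intervalIntegral_of_continuous
    (f := fun (q : ℝ × (ℝ × ℝ) × ℝ) s => Om f a ρ q.1 (flow f q.1 1 s q.2.1)) _ (by fun_prop)
  have h1 : Continuous (fun q : (ℝ × (ℝ × ℝ) × ℝ) × ℝ => flow f q.1.1 1 q.2 q.1.2.1) :=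
    (flow_cont h.lip 1).comp (f := fun q : (ℝ × (ℝ × ℝ) × ℝ) × ℝ => (q.1.1, q.2, q.1.2.1))
      (by fun_prop)
  exact (h.Om_cont hρ).comp (f := fun q : (ℝ × (ℝ × ℝ) × ℝ) × ℝ =>
    (q.1.1, flow f q.1.1 1 q.2 q.1.2.1)) (by fun_prop)

lemma Om_cont_t (h : Nag f K a) {ρ : ℝ} (hρ : 0 < ρ) (ν : ℝ) (z : ℝ × ℝ) :
    Continuous (fun s => Om f a ρ ν (flow f ν 1 s z)) :=
  (h.Om_cont hρ).comp (f := fun s => (ν, flow f ν 1 s z))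
    (by have := flow_cont_t h.lip ν 1 z; fun_prop)

lemma th_deriv (h : Nag f K a) {p ρ : ℝ} (hρ : 0 < ρ) (ν : ℝ) (z : ℝ × ℝ) (t : ℝ) :
    HasDerivAt (th f a p ρ ν z) (Om f a ρ ν (flow f ν 1 t z)) t := by
  unfold th
  exact ((h.Om_cont_t hρ ν z).integral_hasStrictDerivAt 0 t |>.hasDerivAt).const_add _

lemma th_zero {p ρ ν : ℝ} {z : ℝ × ℝ} : th f a p ρ ν z 0 = ang0 a p z := by simp [th]

lemma ang0_zero {p x : ℝ} : ang0 a p (x, 0) = 0 := by simp [ang0]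

/-- restarting at a point -/
lemma th_add (h : Nag f K a) {p ρ : ℝ} (hρ : 0 < ρ) (ν : ℝ) (z : ℝ × ℝ) (s t : ℝ) :
    th f a p ρ ν z (t + s) = th f a p ρ ν z s - ang0 a p (flow f ν 1 s z)
      + th f a p ρ ν (flow f ν 1 s z) t := by
  have hd : ∀ t, HasDerivAt (fun t => th f a p ρ ν z (t + s) - th f a p ρ ν (flow f ν 1 s z) t)
      0 t := by
    intro t
    have h1 := (h.th_deriv (p := p) hρ ν z (t + s)).comp_add_const t s
    have h2 := (h.th_deriv (p := p) hρ ν (flow f ν 1 s z) t)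
    refine (h1.sub h2).congr_deriv ?_
    rw [flow_add h.lip]; simp
  have := is_const_of_deriv_eq_zero (fun t => (hd t).differentiableAt) (fun t => (hd t).deriv) t 0
  simp only [zero_add, th_zero] at this
  linarith

/-- polar representation -/
lemma polar (h : Nag f K a) {p ρ ν : ℝ} (hp : a < p) (hρ : 0 < ρ) {z : ℝ × ℝ} (hz : p ≤ z.1)
    (hD : ∀ t, ρ ≤ ((flow f ν 1 t z).1 - a)^2 + (flow f ν 1 t z).2^2) (t : ℝ) :
    ∃ C > 0, (flow f ν 1 t z).1 - a = C * Real.cos (th f a p ρ ν z t) ∧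
      (flow f ν 1 t z).2 = - (C * Real.sin (th f a p ρ ν z t)) := by
  set X := fun t => (flow f ν 1 t z).1 with hXd
  set V := fun t => (flow f ν 1 t z).2 with hVd
  set θ := th f a p ρ ν z with hθ
  set S := fun t => (X t - a) * Real.sin (θ t) + V t * Real.cos (θ t) with hS
  set C := fun t => (X t - a) * Real.cos (θ t) - V t * Real.sin (θ t) with hC
  set D := fun t => (X t - a)^2 + V t^2 with hDd
  have hDp : ∀ t, 0 < D t := fun t => lt_of_lt_of_le hρ (hD t)
  have hOm : ∀ t, Om f a ρ ν (flow f ν 1 t z)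
      = (V t^2 + (X t - a) * (f (X t) - ν * X t)) / D t := by
    intro t; unfold Om; rw [max_eq_right (hD t)]
  have hX : ∀ t, HasDerivAt X (V t) t := fun t => flow_deriv1 h.lip ν 1 z t
  have hV : ∀ t, HasDerivAt V (ν * X t - 1 * f (X t)) t := fun t => flow_deriv2 h.lip ν 1 z t
  have hT : ∀ t, HasDerivAt θ ((V t^2 + (X t - a) * (f (X t) - ν * X t)) / D t) t := by
    intro t; rw [← hOm]; exact h.th_deriv hρ ν z t
  have hQ : ∀ t, HasDerivAt (fun t => S t^2 / D t) 0 t := by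
    intro t
    have hSd := (((hX t).sub_const a).mul (hT t).sin).add ((hV t).mul (hT t).cos)
    have hDd' := (((hX t).sub_const a).pow 2).add ((hV t).pow 2)
    have hq := (hSd.pow 2).div hDd' (hDp t).ne'
    refine hq.congr_deriv ?_
    have hne := (hDp t).ne'
    simp only [Pi.add_apply, Pi.mul_apply, Pi.pow_apply]
    have hDe : (X t - a)^2 + V t^2 = D t := rfl
    rw [hDe]
    field_simp
    have hDe' : D t = (X t - a)^2 + V t^2 := rfl
    simp only [hDe', Nat.add_one_sub_one, pow_one]
    push_cast
    ring
  have hS0 : S 0 = 0 := by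
    simp only [hS, hXd, hVd, hθ, flow_zero h.lip, th_zero, ang0]
    rw [max_eq_left (by linarith), Real.sin_neg, Real.cos_neg, Real.sin_arctan, Real.cos_arctan]
    have : z.1 - a ≠ 0 := by
      have : 0 < z.1 - a := by linarith
      exact this.ne'
    field_simp
    ring
  have hC0 : 0 < C 0 := by
    simp only [hC, hXd, hVd, hθ, flow_zero h.lip, th_zero, ang0]
    rw [max_eq_left (by linarith), Real.sin_neg, Real.cos_neg, Real.sin_arctan, Real.cos_arctan]
    have hpos : 0 < z.1 - a := by linarith
    have e : z.2 * -(z.2 / (z.1 - a) / √(1 + (z.2 / (z.1 - a)) ^ 2)) ≤ 0 := by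
      have : z.2 * -(z.2 / (z.1 - a) / √(1 + (z.2 / (z.1 - a)) ^ 2))
        = -(z.2^2 / (z.1 - a) / √(1 + (z.2 / (z.1 - a)) ^ 2)) := by ring
      rw [this]
      have : 0 ≤ z.2^2 / (z.1 - a) / √(1 + (z.2 / (z.1 - a)) ^ 2) := by positivity
      linarith
    have e2 : 0 < (z.1 - a) * (1 / √(1 + (z.2 / (z.1 - a)) ^ 2)) := by positivity
    linarith
  have hSz : ∀ t, S t = 0 := by
    intro t
    have := is_const_of_deriv_eq_zero (fun t => (hQ t).differentiableAt)
      (fun t => (hQ t).deriv) t 0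
    simp only [hS0] at this
    have h2 : S t^2 = 0 := by
      have h3 := (hDp t).ne'
      field_simp at this
      simpa using this
    simpa using h2
  have hCS : ∀ t, C t^2 + S t^2 = D t := by
    intro t
    have := Real.sin_sq_add_cos_sq (θ t)
    simp only [hC, hS, hDd]
    linear_combination ((X t - a)^2 + V t^2) * this
  have hCne : ∀ t, C t ≠ 0 := by
    intro t hc
    have := hCS t
    rw [hSz t, hc] at this
    have := hDp t
    simp at *
    linarith
  have hXc : Continuous X := continuous_iff_continuousAt.2 fun t => (hX t).continuousAt
  have hVc : Continuous V := continuous_iff_continuousAt.2 fun t => (hV t).continuousAt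
  have hTc : Continuous θ := continuous_iff_continuousAt.2 fun t => (hT t).continuousAt
  have hCc : Continuous C := by fun_prop
  have hCpos : ∀ t, 0 < C t := by
    intro t
    by_contra hcon
    push Not at hcon
    obtain ⟨s, hs⟩ := mem_range_of_exists_le_of_exists_ge hCc ⟨t, hcon⟩ ⟨0, hC0.le⟩
    exact hCne s hs
  have := Real.sin_sq_add_cos_sq (θ t)
  have hs := hSz t
  refine ⟨C t, hCpos t, ?_, ?_⟩
  · simp only [hS] at hs
    show X t - a = _
    simp only [hC]
    linear_combination (-(X t - a)) * this + Real.sin (θ t) * hs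
  · simp only [hS] at hs
    show V t = _
    simp only [hC]
    linear_combination (-(V t)) * this + Real.cos (θ t) * hs

end Nag
end Flow

end

section
open Set Filter
open scoped NNReal

namespace Flow
variable {f : ℝ → ℝ} {K : ℝ≥0} {a : ℝ}
namespace Nag

/-- an orbit which rotates around `(a,0)` -/
structure Adm (f : ℝ → ℝ) (a p ρ xh c0 ν : ℝ) (z : ℝ × ℝ) : Prop where
  pos : ∀ t, 0 < (flow f ν 1 t z).1
  lt : ∀ t, (flow f ν 1 t z).1 < xh
  en : ∀ t, pot f ((a+p)/2) ≤ (flow f ν 1 t z).2^2/2 + pot f (flow f ν 1 t z).1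
  grow : ∀ s t, s ≤ t → c0 * (t - s) ≤ th f a p ρ ν z t - th f a p ρ ν z s
  pol : ∀ t, ∃ C > 0, (flow f ν 1 t z).1 - a = C * Real.cos (th f a p ρ ν z t) ∧
      (flow f ν 1 t z).2 = - (C * Real.sin (th f a p ρ ν z t))

lemma exists_adm (h : Nag f K a) {p q xh ρ : ℝ} (hp : a < p) (hpq : p ≤ q) (hq : q < xh)
    (hxh : xh < 1) (hxh0 : pot f xh = 0) (hρ : 0 < ρ)
    (hρ2 : ∀ x v : ℝ, pot f ((a+p)/2) ≤ v^2/2 + pot f x → ρ ≤ (x-a)^2+v^2) :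
    ∃ ε0 > 0, ∃ c0 > 0, ∀ ν : ℝ, 0 ≤ ν → ν ≤ ε0 → ∀ z : ℝ × ℝ, z.1 ∈ Icc p q → z.2^2 ≤ ε0 →
      Adm f a p ρ xh c0 ν z := by
  obtain ⟨ε0, hε0, c0, hc0, H⟩ := h.Klem hp hpq hq hxh hxh0
  refine ⟨ε0, hε0, c0, hc0, fun ν hν0 hν z hz1 hz2 => ?_⟩
  have H' := H ν hν0 hν z hz1 hz2
  have hD : ∀ t, ρ ≤ ((flow f ν 1 t z).1 - a)^2 + (flow f ν 1 t z).2^2 :=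
    fun t => hρ2 _ _ (H' t).2.2.1
  refine ⟨fun t => (H' t).1, fun t => (H' t).2.1, fun t => (H' t).2.2.1, ?_,
    h.polar hp hρ hz1.1 hD⟩
  have hm : Monotone (fun t => th f a p ρ ν z t - c0 * t) := by
    have hd : ∀ t, HasDerivAt (fun t => th f a p ρ ν z t - c0 * t)
        (Om f a ρ ν (flow f ν 1 t z) - c0) t := by
      intro t
      have := (h.th_deriv (p := p) hρ ν z t).sub ((hasDerivAt_id t).const_mul c0)
      exact HasDerivAt.congr_deriv (f := fun t => th f a p ρ ν z t - c0 * t) this (by simp)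
    apply monotone_of_deriv_nonneg (fun t => (hd t).differentiableAt)
    intro t
    rw [(hd t).deriv]
    unfold Om
    rw [max_eq_right (hD t)]
    linarith [(H' t).2.2.2]
  intro s t hst
  have := hm hst
  simp only at this
  linarith

section
variable {p ρ xh c0 ν : ℝ} {z : ℝ × ℝ}

lemma Adm.mono (A : Adm f a p ρ xh c0 ν z) (hc0 : 0 < c0) {s t : ℝ} (hst : s ≤ t) :
    th f a p ρ ν z s ≤ th f a p ρ ν z t := by
  have := A.grow s t hst
  have : 0 ≤ c0 * (t - s) := mul_nonneg hc0.le (by linarith)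
  linarith

lemma th_cont_t (h : Nag f K a) (hρ : 0 < ρ) : Continuous (th f a p ρ ν z) :=
  continuous_iff_continuousAt.2 fun t => (h.th_deriv hρ ν z t).continuousAt

lemma Adm.cross (h : Nag f K a) (hρ : 0 < ρ) (A : Adm f a p ρ xh c0 ν z) (hc0 : 0 < c0) {s L : ℝ}
    (hL : th f a p ρ ν z s ≤ L) :
    ∃ t, s ≤ t ∧ c0 * (t - s) ≤ L - th f a p ρ ν z s ∧ th f a p ρ ν z t = L := by
  set u := s + (L - th f a p ρ ν z s)/c0 with hu
  have hsu : s ≤ u := by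
    have : 0 ≤ (L - th f a p ρ ν z s)/c0 := div_nonneg (by linarith) hc0.le
    linarith
  have h1 := A.grow s u hsu
  have h2 : c0 * (u - s) = L - th f a p ρ ν z s := by rw [hu]; field_simp; ring
  obtain ⟨t, ht, ht2⟩ := intermediate_value_Icc hsu (h.th_cont_t (p := p) (ν := ν) (z := z) hρ).continuousOn
    (show L ∈ Icc _ _ from ⟨hL, by linarith⟩)
  refine ⟨t, ht.1, ?_, ht2⟩
  rw [← h2]
  have := ht.2
  gcongr

lemma Adm.turn (A : Adm f a p ρ xh c0 ν z) {t : ℝ} (k : ℕ)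
    (ht : th f a p ρ ν z t = 2 * Real.pi * k) :
    (flow f ν 1 t z).2 = 0 ∧ a < (flow f ν 1 t z).1 := by
  obtain ⟨C, hC, h1, h2⟩ := A.pol t
  have e : 2 * Real.pi * k = k * (2 * Real.pi) := by ring
  rw [ht, e, Real.cos_nat_mul_two_pi] at h1
  rw [ht] at h2
  have : Real.sin (2 * Real.pi * k) = 0 := by
    have := Real.sin_nat_mul_pi (2 * k)
    rw [← this]; congr 1; push_cast; ring
  rw [this] at h2
  constructor
  · simpa using h2
  · linarith

lemma turn_add (h : Nag f K a) (hρ : 0 < ρ) {s : ℝ} (hV : (flow f ν 1 s z).2 = 0) (t : ℝ) :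
    th f a p ρ ν z (t + s) = th f a p ρ ν z s + th f a p ρ ν ((flow f ν 1 s z).1, 0) t := by
  have e : flow f ν 1 s z = ((flow f ν 1 s z).1, 0) := by
    rw [← hV]
  rw [h.th_add hρ, e, ang0_zero]
  ring

lemma Adm.upper (h : Nag f K a) (hρ : 0 < ρ) (A : Adm f a p ρ xh c0 ν z) (hc0 : 0 < c0)
    (hz : th f a p ρ ν z 0 ≤ 0) {T : ℝ}
    (H : ∀ t, (flow f ν 1 t z).2 = 0 → a < (flow f ν 1 t z).1 →
      th f a p ρ ν ((flow f ν 1 t z).1, 0) T < 2 * Real.pi) (k : ℕ) :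
    th f a p ρ ν z (k * T) ≤ 2 * Real.pi * k := by
  induction k with
  | zero => simpa using hz
  | succ k ih =>
    obtain ⟨t, ht1, _, ht2⟩ := A.cross h hρ hc0 ih
    obtain ⟨h1, h2⟩ := A.turn k ht2
    have h3 := h.turn_add (p := p) hρ h1 T
    have h4 := H t h1 h2
    have h5 : th f a p ρ ν z ((k+1:ℕ) * T) ≤ th f a p ρ ν z (T + t) := by
      apply A.mono hc0
      push_cast
      linarith
    rw [h3, ht2] at h5
    push_cast at h5 ⊢
    linarith

lemma Adm.lower (h : Nag f K a) (hρ : 0 < ρ) (A : Adm f a p ρ xh c0 ν z) (hc0 : 0 < c0)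
    {t0 : ℝ} (hz : th f a p ρ ν z t0 = 0) {T : ℝ} (hT : 0 < T)
    (H : ∀ t, (flow f ν 1 t z).2 = 0 → a < (flow f ν 1 t z).1 →
      2 * Real.pi < th f a p ρ ν ((flow f ν 1 t z).1, 0) T) (k : ℕ) :
    2 * Real.pi * k ≤ th f a p ρ ν z (t0 + k * T) := by
  induction k with
  | zero => simp [hz]
  | succ k ih =>
    obtain ⟨t, ht, ht2⟩ := intermediate_value_Icc (show t0 ≤ t0 + k * T by
        have : 0 ≤ (k:ℝ) * T := by positivity
        linarith)
      (h.th_cont_t (p := p) (ν := ν) (z := z) hρ).continuousOn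
      (show 2 * Real.pi * k ∈ Icc _ _ from ⟨by rw [hz]; positivity, ih⟩)
    obtain ⟨h1, h2⟩ := A.turn k ht2
    have h3 := h.turn_add (p := p) hρ h1 T
    have h4 := H t h1 h2
    have h5 : th f a p ρ ν z (T + t) ≤ th f a p ρ ν z (t0 + (k+1:ℕ) * T) := by
      apply A.mono hc0
      push_cast
      have := ht.2
      linarith
    rw [h3, ht2] at h5
    push_cast at h5 ⊢
    linarith

end

/-- slow orbits close to the homoclinic -/
lemma exists_slow (h : Nag f K a) {p p1 xh ρ T1 : ℝ} (hp : a < p) (hp1 : p ≤ p1) (hq : p1 < xh)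
    (hxh : xh < 1) (hxh0 : pot f xh = 0) (hρ : 0 < ρ) (hT1 : 0 < T1)
    (hρ2 : ∀ x v : ℝ, pot f ((a+p)/2) ≤ v^2/2 + pot f x → ρ ≤ (x-a)^2+v^2) :
    ∃ q1, p1 < q1 ∧ q1 < xh ∧ th f a p ρ 0 (q1, 0) T1 < 2 * Real.pi := by
  set η := a * Real.exp (-(√K * T1)) with hη
  have hη0 : 0 < η := mul_pos h.ha0 (Real.exp_pos _)
  have hηa : η ≤ a := by
    rw [hη]
    have : Real.exp (-(√K * T1)) ≤ 1 := by
      rw [Real.exp_le_one_iff]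
      have : 0 ≤ √K * T1 := by positivity
      linarith
    nlinarith [h.ha0]
  have hPη : pot f η < 0 := by
    have := h.pot_anti (left_mem_Icc.2 h.ha0.le) ⟨hη0.le, hηa⟩ hη0
    rwa [pot_zero] at this
  have hev : ∀ᶠ x in nhdsWithin xh (Iio xh), pot f η < pot f x := by
    apply Filter.Eventually.filter_mono nhdsWithin_le_nhds
    exact continuousAt_const.eventually_lt h.pot_cont.continuousAt (by rw [hxh0]; exact hPη)
  have hev2 : ∀ᶠ x in nhdsWithin xh (Iio xh), p1 < x ∧ x < xh :=
    Ioo_mem_nhdsLT hq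
  obtain ⟨q1, hq1, hpq, hqx⟩ := (hev.and hev2).exists
  refine ⟨q1, hpq, hqx, ?_⟩
  obtain ⟨ε0, hε0, c0, hc0, H⟩ := h.exists_adm hp (hp1.trans hpq.le) hqx hxh hxh0 hρ hρ2
  have A := H 0 le_rfl hε0.le (q1, 0) ⟨by simp only; linarith, le_rfl⟩ (by simpa using hε0.le)
  have hPq : pot f q1 < 0 := by
    rw [← hxh0]
    exact h.pot_mono ⟨by linarith, by linarith⟩ ⟨by linarith, by linarith⟩ hqx
  have hE : ∀ t, (flow f 0 1 t (q1, 0)).2^2/2 + pot f (flow f 0 1 t (q1, 0)).1 = pot f q1 := by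
    intro t
    have := h.energy 0 1 (q1, 0) t
    simpa using this
  have hV : ∀ t, -(√K * (flow f 0 1 t (q1, 0)).1) ≤ (flow f 0 1 t (q1, 0)).2 := by
    intro t
    have h1 := hE t
    have h2 := h.pot_ge (A.pos t).le
    have h3 : (flow f 0 1 t (q1, 0)).2^2 ≤ (√K * (flow f 0 1 t (q1, 0)).1)^2 := by
      rw [mul_pow, Real.sq_sqrt (NNReal.coe_nonneg K)]
      linarith
    have h4 := abs_le_of_sq_le_sq h3 (mul_nonneg (Real.sqrt_nonneg _) (A.pos t).le)
    exact (_root_.abs_le.1 h4).1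
  have hX : ∀ t ∈ Icc 0 T1, η ≤ (flow f 0 1 t (q1, 0)).1 := by
    have hm : Monotone (fun t => (flow f 0 1 t (q1, 0)).1 * Real.exp (√K * t)) := by
      have hd : ∀ t, HasDerivAt (fun t => (flow f 0 1 t (q1, 0)).1 * Real.exp (√K * t))
          ((flow f 0 1 t (q1, 0)).2 * Real.exp (√K * t)
            + (flow f 0 1 t (q1, 0)).1 * (Real.exp (√K * t) * √K)) t := by
        intro t
        have := (flow_deriv1 h.lip 0 1 (q1, 0) t).mul (((hasDerivAt_id t).const_mul (√K)).exp)
        exact HasDerivAt.congr_deriv (f := fun t => (flow f 0 1 t (q1, 0)).1 * Real.exp (√K * t)) this (by simp)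
      apply monotone_of_deriv_nonneg (fun t => (hd t).differentiableAt)
      intro t
      rw [(hd t).deriv]
      have := hV t
      have he := Real.exp_pos (√K * t)
      nlinarith
    intro t ht
    have h1 := hm ht.1
    simp only [flow_zero h.lip, mul_zero, Real.exp_zero, mul_one] at h1
    have h2 : q1 * Real.exp (-(√K * t)) ≤ (flow f 0 1 t (q1, 0)).1 := by
      rw [Real.exp_neg, ← div_eq_mul_inv, div_le_iff₀ (Real.exp_pos _)]
      exact h1
    refine le_trans ?_ h2
    rw [hη]
    have := ht.2
    have h3 : a ≤ q1 := by linarith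
    have h4 := h.ha0
    have h5 : 0 ≤ q1 := by linarith
    gcongr
  by_contra hcon
  push Not at hcon
  have h00 : th f a p ρ 0 (q1, 0) 0 = 0 := by rw [th_zero, ang0_zero]
  obtain ⟨t, ht, ht2⟩ := intermediate_value_Icc hT1.le
      (h.th_cont_t (p := p) (ν := 0) (z := (q1, 0)) hρ).continuousOn
      (show Real.pi ∈ Icc _ _ from ⟨by rw [h00]; positivity, by linarith [Real.pi_pos]⟩)
  obtain ⟨C, hC, h1, h2⟩ := A.pol t
  rw [ht2, Real.cos_pi] at h1
  rw [ht2, Real.sin_pi] at h2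
  have h3 := hE t
  rw [h2] at h3
  have h4 := h.pot_anti.antitoneOn ⟨hη0.le, hηa⟩
    ⟨(A.pos t).le, by linarith⟩ (hX t ht)
  simp at h3
  linarith

end Nag
end Flow

end

section
open Set Filter
open scoped NNReal

namespace Flow
variable {f : ℝ → ℝ} {K : ℝ≥0} {a : ℝ}
namespace Nag

lemma twist_pts (h : Nag f K a) {p xh ρ : ℝ} (hp : a < p) (hq : p < xh)
    (hxh : xh < 1) (hxh0 : pot f xh = 0) (hρ : 0 < ρ)
    (hρ2 : ∀ x v : ℝ, pot f ((a+p)/2) ≤ v^2/2 + pot f x → ρ ≤ (x-a)^2+v^2) :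
    ∃ xm q, p < xm ∧ xm < q ∧ q < xh ∧
      ∀ w0 > 0, ∃ xp, xm < xp ∧ xp < xm + w0 ∧ xp < q ∧ ∃ Tm Tp, 0 < Tm ∧ Tm < Tp ∧
        2 * Real.pi < th f a p ρ 0 (xm, 0) Tm ∧ th f a p ρ 0 (xp, 0) Tp < 2 * Real.pi := by
  set p1 := (p + xh)/2 with hp1
  obtain ⟨ε0, hε0, c0, hc0, H⟩ := h.exists_adm (q := p1) hp (by linarith) (by linarith) hxh hxh0 hρ hρ2
  set T1 := 7 / c0 with hT1
  have hT1p : 0 < T1 := by positivity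
  have A1 := H 0 le_rfl hε0.le (p1, 0) ⟨by simp only; linarith, le_rfl⟩ (by simpa using hε0.le)
  have h1 : 2 * Real.pi ≤ th f a p ρ 0 (p1, 0) T1 := by
    have := A1.grow 0 T1 hT1p.le
    rw [th_zero, ang0_zero, hT1] at this
    have e : c0 * (7 / c0 - 0) = 7 := by field_simp; ring
    rw [e] at this
    have := Real.pi_lt_d2
    rw [hT1]
    linarith
  obtain ⟨q1, hq1, hq2, hq3⟩ := h.exists_slow (p1 := p1) (T1 := T1) hp (by linarith) (by linarith) hxh hxh0 hρ hT1p hρ2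
  have hcx : ∀ T, Continuous (fun x => th f a p ρ 0 (x, 0) T) := fun T =>
    (h.th_cont hp hρ).comp (f := fun x : ℝ => ((0:ℝ), (x, (0:ℝ)), T)) (by fun_prop)
  have hct : ∀ x, Continuous (fun T => th f a p ρ 0 (x, 0) T) := fun x =>
    (h.th_cont hp hρ).comp (f := fun T : ℝ => ((0:ℝ), (x, (0:ℝ)), T)) (by fun_prop)
  have hcomp : IsCompact (Icc p1 q1 ∩ {x | 2 * Real.pi ≤ th f a p ρ 0 (x, 0) T1}) :=
    isCompact_Icc.inter_right (isClosed_le continuous_const (hcx T1))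
  obtain ⟨xm, ⟨hxm1, hxm2⟩, hmax⟩ := hcomp.exists_isGreatest ⟨p1, ⟨le_rfl, hq1.le⟩, h1⟩
  have hxmq : xm < q1 := by
    rcases hxm1.2.lt_or_eq with h | h
    · exact h
    · subst h
      replace hxm2 : 2 * Real.pi ≤ th f a p ρ 0 (xm, 0) T1 := hxm2
      linarith
  refine ⟨xm, (q1+xh)/2, by linarith [hxm1.1], by linarith, by linarith, fun w0 hw0 => ?_⟩
  set xp := min q1 (xm + w0/2) with hxp
  have hxp1 : xm < xp := lt_min hxmq (by linarith)
  have hxp2 : xp ≤ q1 := min_le_left _ _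
  have hxp3 : xp ≤ xm + w0/2 := min_le_right _ _
  have h2 : th f a p ρ 0 (xp, 0) T1 < 2 * Real.pi := by
    by_contra hcon
    push Not at hcon
    have := hmax ⟨⟨by linarith [hxm1.1], hxp2⟩, hcon⟩
    linarith
  have hev : ∀ᶠ T in nhdsWithin T1 (Ioi T1), th f a p ρ 0 (xp, 0) T < 2 * Real.pi := by
    apply Filter.Eventually.filter_mono nhdsWithin_le_nhds
    exact (hct xp).continuousAt.eventually_lt continuousAt_const h2
  obtain ⟨Tp, hTp, hTp2⟩ := (hev.and self_mem_nhdsWithin).exists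
  replace hTp2 : T1 < Tp := hTp2
  refine ⟨xp, hxp1, by linarith, by linarith, (T1+Tp)/2, Tp, by linarith, by linarith, ?_, hTp⟩
  obtain ⟨ε1, hε1, c1, hc1, H1⟩ := h.exists_adm (q := q1) hp (by linarith) (by linarith) hxh hxh0 hρ hρ2
  have A2 := H1 0 le_rfl hε1.le (xm, 0) ⟨by simp only; linarith [hxm1.1], hxm1.2⟩ (by simpa using hε1.le)
  have := A2.grow T1 ((T1+Tp)/2) (by linarith)
  have h3 : 0 < c1 * ((T1+Tp)/2 - T1) := mul_pos hc1 (by linarith)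
  replace hxm2 : 2 * Real.pi ≤ th f a p ρ 0 (xm, 0) T1 := hxm2
  linarith

/-- phase points at a bounded slope stay close in energy -/
lemma turning (h : Nag f K a) {lo hi δ : ℝ} (hδ : 0 < δ) (hlh : lo ≤ hi) (hlo : a < lo - δ)
    (hhi : hi + δ < 1) : ∃ ε > 0, ∀ ν, 0 ≤ ν → ν ≤ ε → ∀ z : ℝ × ℝ, z.1 ∈ Icc lo hi → z.2^2 ≤ ε →
      ∀ t, (flow f ν 1 t z).1 ∈ Icc a 1 →
      (flow f ν 1 t z).1 < hi + δ ∧ ((flow f ν 1 t z).2^2 ≤ ε → lo - δ < (flow f ν 1 t z).1) := by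
  obtain ⟨η, hη, H⟩ := h.near hδ hlh hlo hhi
  refine ⟨η/2, by linarith, fun ν hν0 hν z hz1 hz2 t ht => ?_⟩
  have hE := h.energy ν 1 z t
  obtain ⟨H1, H2⟩ := H z.1 hz1 _ ht
  have ha := h.ha0
  have e1 : ν * (flow f ν 1 t z).1^2 ≤ ν * 1 := by
    apply mul_le_mul_of_nonneg_left _ hν0
    nlinarith [ht.1, ht.2]
  have e2 : ν * z.1^2 ≤ ν * 1 := by
    apply mul_le_mul_of_nonneg_left _ hν0
    nlinarith [hz1.1, hz1.2]
  have e3 : 0 ≤ ν * (flow f ν 1 t z).1^2 := by positivity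
  have e4 : 0 ≤ ν * z.1^2 := by positivity
  constructor
  · apply H1
    nlinarith [sq_nonneg (flow f ν 1 t z).2]
  · intro hV
    apply H2
    nlinarith [sq_nonneg z.2]

lemma robust (h : Nag f K a) {p ρ x0 T : ℝ} (hp : a < p) (hρ : 0 < ρ) {S : Set ℝ} (hS : IsOpen S)
    (hx : th f a p ρ 0 (x0, 0) T ∈ S) :
    ∃ δ > 0, ∀ ν, 0 ≤ ν → ν ≤ δ → ∀ X, x0 - δ < X → X < x0 + δ → th f a p ρ ν (X, 0) T ∈ S := by
  have hc : Continuous (fun q : ℝ × ℝ => th f a p ρ q.1 (q.2, 0) T) :=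
    (h.th_cont hp hρ).comp (f := fun q : ℝ × ℝ => (q.1, (q.2, (0:ℝ)), T)) (by fun_prop)
  obtain ⟨ε, hε, H⟩ := Metric.isOpen_iff.1 (hS.preimage hc) (0, x0) hx
  refine ⟨ε/2, by linarith, fun ν h0 h1 X h2 h3 => ?_⟩
  apply @H (ν, X)
  rw [Metric.mem_ball, Prod.dist_eq]
  simp only [Real.dist_eq]
  apply max_lt
  · rw [abs_lt]; constructor <;> linarith
  · rw [abs_lt]; constructor <;> linarith

set_option maxHeartbeats 1000000 in
theorem twist (h : Nag f K a) {g xh p : ℝ} (hg : 0 < g) (hp : a < p) (hq : p < xh)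
    (hxh : xh < 1) (hxh0 : pot f xh = 0) :
    ∃ xm q, p < xm ∧ xm < q ∧ q < xh ∧ ∀ w0 > 0, ∃ xp δ, 0 < δ ∧ xm < xp ∧ xp - xm + 2 * δ < w0 ∧
      p < xm - δ ∧ xp + δ < q ∧ ∀ α > 0, ∀ Y > 0, ∀ᶠ n in atTop, 0 < n ∧ ∃ N : ℕ,
      ∃ Θ : ℝ × ℝ → ℝ, Continuous Θ ∧ ∀ z : ℝ × ℝ, z.1 ∈ Icc xm xp → z.2 ∈ Icc 0 Y →
        (∀ t, 0 < (flow f g n t z).1 ∧ (flow f g n t z).1 < 1) ∧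
        (z.1 = xm → 2 * Real.pi * (N + 1) + Real.pi/2 ≤ Θ z) ∧
        (z.1 = xp → Θ z ≤ 2 * Real.pi * N) ∧
        ∀ j : ℕ, Θ z ∈ Icc (2 * Real.pi * j) (2 * Real.pi * j + Real.pi/2) →
          (flow f g n α z).2 ≤ 0 ∧ (flow f g n α z).1 ≤ xp + δ ∧
          (-Y < (flow f g n α z).2 → xm - δ < (flow f g n α z).1) ∧
          (Θ z = 2 * Real.pi * j → (flow f g n α z).2 = 0) ∧
          (Θ z = 2 * Real.pi * j + Real.pi/2 → (flow f g n α z).2 ≤ -Y) := by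
  obtain ⟨ρ, hρ, hρ2⟩ := h.exists_rho hp (by linarith)
  obtain ⟨xm, q, hpm, hmq, hqx, H⟩ := h.twist_pts hp hq hxh hxh0 hρ hρ2
  obtain ⟨ε0, hε0, c0, hc0, HA⟩ := h.exists_adm (q := q) hp (by linarith) hqx hxh hxh0 hρ hρ2
  refine ⟨xm, q, hpm, hmq, hqx, fun w0 hw0 => ?_⟩
  obtain ⟨xp, hmp, hpw, hpq, Tm, Tp, hTm, hTmp, hm, hpp⟩ := H (w0/2) (by linarith)
  obtain ⟨δ, hδ, hδ1⟩ : ∃ δ > 0, δ < w0/4 ∧ δ < xm - p ∧ δ < q - xp := by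
    refine ⟨min (w0/4) (min (xm - p) (q - xp)) / 2, ?_, ?_⟩
    · have : 0 < min (w0/4) (min (xm - p) (q - xp)) :=
        lt_min (by linarith) (lt_min (by linarith) (by linarith))
      linarith
    · have h0 : 0 < min (w0/4) (min (xm - p) (q - xp)) :=
        lt_min (by linarith) (lt_min (by linarith) (by linarith))
      have h1 : min (w0/4) (min (xm - p) (q - xp)) ≤ w0/4 := min_le_left _ _
      have h2 : min (w0/4) (min (xm - p) (q - xp)) ≤ xm - p := (min_le_right _ _).trans (min_le_left _ _)
      have h3 : min (w0/4) (min (xm - p) (q - xp)) ≤ q - xp := (min_le_right _ _).trans (min_le_right _ _)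
      refine ⟨by linarith, by linarith, by linarith⟩
  obtain ⟨hδ1, hδ2, hδ3⟩ := hδ1
  refine ⟨xp, δ, hδ, hmp, by linarith, by linarith, by linarith, fun α hα Y hY => ?_⟩
  -- robustness
  obtain ⟨d1, hd1, R1⟩ := h.robust hp hρ isOpen_Ioi (show _ ∈ Ioi (2 * Real.pi) from hm)
  obtain ⟨d2, hd2, R2⟩ := h.robust hp hρ isOpen_Iio (show _ ∈ Iio (2 * Real.pi) from hpp)
  have hd1' : min d1 δ > 0 := lt_min hd1 hδ
  have hd2' : min d2 δ > 0 := lt_min hd2 hδ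
  obtain ⟨e1, he1, Q1⟩ := h.turning (lo := xm) (hi := xm) hd1' le_rfl
    (by linarith [min_le_right d1 δ]) (by linarith [min_le_right d1 δ])
  obtain ⟨e2, he2, Q2⟩ := h.turning (lo := xp) (hi := xp) hd2' le_rfl
    (by linarith [min_le_right d2 δ]) (by linarith [min_le_right d2 δ])
  obtain ⟨e3, he3, Q3⟩ := h.turning (lo := xm) (hi := xp) hδ hmp.le (by linarith) (by linarith)
  set κ := pot f ((a+p)/2) - pot f a with hκ
  have hκ0 : 0 < κ := by
    have := h.pot_mono ⟨le_rfl, h.ha1.le⟩ (show (a+p)/2 ∈ Icc a 1 from ⟨by linarith, by linarith⟩) (by linarith)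
    linarith
  have ev1 : ∀ ε > 0, ∀ c : ℝ, ∀ᶠ n in atTop, c / n ≤ ε := by
    intro ε hε c
    have : Tendsto (fun n : ℝ => c / n) atTop (nhds 0) := tendsto_const_nhds.div_atTop tendsto_id
    exact this.eventually_le_const hε
  have ev2 : ∀ᶠ n in atTop, ((Real.pi/2)/c0 + 3 * Tm) / (1 - Tm/Tp) / α ≤ √n :=
    Real.tendsto_sqrt_atTop.eventually_ge_atTop _
  filter_upwards [eventually_gt_atTop 0, ev1 ε0 hε0 g, ev1 ε0 hε0 (Y^2), ev1 e1 he1 g,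
    ev1 e1 he1 (Y^2), ev1 e2 he2 g, ev1 e2 he2 (Y^2), ev1 e3 he3 g, ev1 e3 he3 (Y^2),
    ev1 d1 hd1 g, ev1 d2 hd2 g, ev1 (2*κ) (by linarith) (Y^2), ev2] with n hn k1 k2 k3 k4 k5 k6 k7
      k8 k9 k10 k11 k12
  refine ⟨hn, ?_⟩
  set w := √n with hw
  have hw0 : 0 < w := Real.sqrt_pos.2 hn
  have hw2 : w^2 = n := Real.sq_sqrt hn.le
  set τ := w * α with hτ
  have hτ0 : 0 < τ := mul_pos hw0 hα
  set N := ⌈τ/Tp⌉₊ with hN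
  have hTp : 0 < Tp := by linarith
  have hN1 : τ ≤ N * Tp := by
    have := Nat.le_ceil (τ/Tp)
    rwa [div_le_iff₀ hTp] at this
  have hN2 : (Real.pi/2)/c0 + ((N:ℝ)+2) * Tm ≤ τ := by
    have h1 : (N:ℝ) < τ/Tp + 1 := Nat.ceil_lt_add_one (by positivity)
    have hpos : 0 < 1 - Tm/Tp := by
      have : Tm/Tp < 1 := (div_lt_one hTp).2 hTmp
      linarith
    rw [div_le_iff₀ hα, div_le_iff₀ hpos] at k12
    have h2 : ((N:ℝ)+2) * Tm ≤ (τ/Tp + 3) * Tm := by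
      apply mul_le_mul_of_nonneg_right _ hTm.le; linarith
    have h3 : τ/Tp * Tm = τ * (Tm/Tp) := by ring
    rw [← hτ] at k12
    have h4 : τ * (1 - Tm/Tp) = τ - τ/Tp * Tm := by rw [h3]; ring
    linarith
  set ν := g / n with hν
  have hν0 : 0 ≤ ν := by positivity
  refine ⟨N, fun z => th f a p ρ ν (z.1, z.2/w) τ, ?_, ?_⟩
  · exact (h.th_cont hp hρ).comp (f := fun z : ℝ × ℝ => (ν, (z.1, z.2/w), τ)) (by fun_prop)
  intro z hz1 hz2
  have hsc : ∀ t, flow f g n t z = ((flow f ν 1 (w*t) (z.1, z.2/w)).1, w * (flow f ν 1 (w*t) (z.1, z.2/w)).2) := by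
    intro t
    have := flow_scale h.lip g w hw0.ne' t z
    rwa [hw2] at this
  set z' := (z.1, z.2/w) with hz'
  have hv : z'.2^2 ≤ Y^2/n := by
    simp only [hz', div_pow, hw2]
    have := hz2.1
    have := hz2.2
    gcongr
  have A := HA ν hν0 k1 z' ⟨by simp only [hz']; linarith [hz1.1], by simp only [hz']; linarith [hz1.2]⟩ (hv.trans k2)
  have hIcc : ∀ t, a ≤ (flow f ν 1 t z').1 → (flow f ν 1 t z').1 ∈ Icc a 1 := fun t ht =>
    ⟨ht, by linarith [A.lt t]⟩
  have hang : -(Real.pi/2) < th f a p ρ ν z' 0 ∧ th f a p ρ ν z' 0 ≤ 0 := by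
    rw [th_zero, ang0]
    have h1 := Real.arctan_lt_pi_div_two (z'.2 / max (z'.1 - a) (p - a))
    have h2 : 0 ≤ Real.arctan (z'.2 / max (z'.1 - a) (p - a)) := by
      rw [Real.arctan_nonneg]
      apply div_nonneg (div_nonneg hz2.1 hw0.le)
      exact le_max_of_le_right (by linarith)
    constructor <;> linarith
  simp only [hsc]
  rw [← hτ]
  refine ⟨fun t => ⟨A.pos _, by linarith [A.lt (w*t)]⟩, ?_, ?_, ?_⟩
  · intro hzx
    obtain ⟨t0, ht0, ht1, ht2⟩ := A.cross h hρ hc0 (s := 0) (L := 0) hang.2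
    have ht3 : t0 ≤ (Real.pi/2)/c0 := by
      rw [le_div_iff₀ hc0]; linarith [hang.1]
    have hl := A.lower h hρ hc0 ht2 hTm (fun t ht hta => by
      have := Q1 ν hν0 k3 z' (by simp [hz', hzx]) (hv.trans k4) t (hIcc t hta.le)
      refine R1 ν hν0 k9 _ ?_ ?_
      · have := this.2 (by rw [ht]; simpa using he1.le)
        linarith [min_le_left d1 δ]
      · linarith [min_le_left d1 δ]) (N+2)
    have hmono := A.mono hc0 (s := t0 + (N+2:ℕ) * Tm) (t := τ) (by push_cast; linarith)
    push_cast at hl hmono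
    linarith [Real.pi_pos]
  · intro hzx
    have hl := A.upper h hρ hc0 hang.2 (T := Tp) (fun t ht hta => by
      have := Q2 ν hν0 k5 z' (by simp [hz', hzx]) (hv.trans k6) t (hIcc t hta.le)
      refine R2 ν hν0 k10 _ ?_ ?_
      · have := this.2 (by rw [ht]; simpa using he2.le)
        linarith [min_le_left d2 δ]
      · linarith [min_le_left d2 δ]) N
    have hmono := A.mono hc0 hN1
    linarith
  · intro j hj
    obtain ⟨C, hC, hX, hV⟩ := A.pol τ
    set φ := th f a p ρ ν z' τ - j * (2 * Real.pi) with hφ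
    have hφ1 : 0 ≤ φ := by linarith [hj.1]
    have hφ2 : φ ≤ Real.pi/2 := by linarith [hj.2]
    have ec : Real.cos (th f a p ρ ν z' τ) = Real.cos φ := by
      rw [hφ, Real.cos_sub_nat_mul_two_pi]
    have es : Real.sin (th f a p ρ ν z' τ) = Real.sin φ := by
      rw [hφ, Real.sin_sub_nat_mul_two_pi]
    rw [ec] at hX
    rw [es] at hV
    have hcos : 0 ≤ Real.cos φ := Real.cos_nonneg_of_mem_Icc ⟨by linarith, hφ2⟩
    have hsin : 0 ≤ Real.sin φ := Real.sin_nonneg_of_nonneg_of_le_pi hφ1 (by linarith [Real.pi_pos])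
    have hXa : a ≤ (flow f ν 1 τ z').1 := by
      have := mul_nonneg hC.le hcos
      linarith
    have hV0 : (flow f ν 1 τ z').2 ≤ 0 := by
      have := mul_nonneg hC.le hsin
      linarith
    have hwV : w * (flow f ν 1 τ z').2 ≤ 0 := mul_nonpos_of_nonneg_of_nonpos hw0.le hV0
    obtain ⟨q3, q4⟩ := Q3 ν hν0 k7 z' hz1 (hv.trans k8) τ (hIcc τ hXa)
    refine ⟨hwV, q3.le, ?_, ?_, ?_⟩
    · intro hYw
      apply q4
      refine le_trans ?_ k8
      rw [le_div_iff₀ hn, ← hw2]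
      have : (flow f ν 1 τ z').2^2 * w^2 = (w * (flow f ν 1 τ z').2)^2 := by ring
      rw [this]
      apply sq_le_sq'
      · exact hYw.le
      · exact hwV.trans hY.le
    · intro e
      have : φ = 0 := by rw [hφ]; linarith
      rw [this, Real.sin_zero] at hV
      rw [hV]; simp
    · intro e
      have : φ = Real.pi/2 := by rw [hφ]; linarith
      rw [this, Real.cos_pi_div_two] at hX
      have hXa : (flow f ν 1 τ z').1 = a := by linarith
      have hen := A.en τ
      rw [hXa] at hen
      have hVk : 2 * κ ≤ (flow f ν 1 τ z').2^2 := by rw [hκ]; linarith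
      rw [div_le_iff₀ hn] at k11
      have : Y^2 ≤ (w * -(flow f ν 1 τ z').2)^2 := by
        have e : (w * -(flow f ν 1 τ z').2)^2 = (flow f ν 1 τ z').2^2 * n := by rw [← hw2]; ring
        rw [e]
        exact k11.trans (mul_le_mul_of_nonneg_right hVk hn.le)
      have := abs_le_of_sq_le_sq this (mul_nonneg hw0.le (by linarith))
      rw [abs_of_pos hY] at this
      linarith

end Nag
end Flow

end

section
open Set Filter
open scoped NNReal

namespace Flow
variable {f : ℝ → ℝ} {K : ℝ≥0} {g n : ℝ}

lemma xy_mono (hf : LipschitzWith K f) (hG : ∀ x, 0 ≤ x * (g * x - n * f x)) (z : ℝ × ℝ) :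
    Monotone (fun t => (flow f g n t z).1 * (flow f g n t z).2) := by
  have hd : ∀ t, HasDerivAt (fun t => (flow f g n t z).1 * (flow f g n t z).2)
      ((flow f g n t z).2 * (flow f g n t z).2 + (flow f g n t z).1 *
        (g * (flow f g n t z).1 - n * f (flow f g n t z).1)) t := fun t =>
    (flow_deriv1 hf g n z t).mul (flow_deriv2 hf g n z t)
  apply monotone_of_deriv_nonneg (fun t => (hd t).differentiableAt)
  intro t
  rw [(hd t).deriv]
  have := hG (flow f g n t z).1
  nlinarith [mul_self_nonneg (flow f g n t z).2]

lemma sq_conv (hf : LipschitzWith K f) (hG : ∀ x, 0 ≤ x * (g * x - n * f x)) (z : ℝ × ℝ) :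
    ConvexOn ℝ univ (fun t => (flow f g n t z).1^2) := by
  have hd : ∀ t, HasDerivAt (fun t => (flow f g n t z).1^2)
      (2 * ((flow f g n t z).1 * (flow f g n t z).2)) t := fun t =>
    ((flow_deriv1 hf g n z t).pow 2).congr_deriv (by simp; ring)
  apply Monotone.convexOn_univ_of_deriv (fun t => (hd t).differentiableAt)
  intro s t hst
  rw [(hd s).deriv, (hd t).deriv]
  have := xy_mono hf hG z hst
  simp only at this
  linarith

lemma stay (hf : LipschitzWith K f) (hG : ∀ x, 0 ≤ x * (g * x - n * f x)) (z : ℝ × ℝ) {T : ℝ}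
    (h0 : |z.1| ≤ 1) (h1 : |(flow f g n T z).1| ≤ 1) {t : ℝ} (ht : t ∈ Icc 0 T) :
    |(flow f g n t z).1| ≤ 1 := by
  have hc := sq_conv hf hG z
  have hseg : t ∈ segment ℝ 0 T := by
    rw [segment_eq_Icc (ht.1.trans ht.2)]; exact ht
  have := hc.le_max_of_mem_segment (mem_univ 0) (mem_univ T) hseg
  simp only [flow_zero hf] at this
  rw [← sq_le_one_iff_abs_le_one] at *
  exact this.trans (max_le h0 h1)

lemma n1_main (hf : LipschitzWith K f) (hG : ∀ x, 0 ≤ x * (g * x - n * f x)) {lo hi d T : ℝ}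
    (hlo : 0 < lo) (hd0 : 0 ≤ d) (hd : ∀ x ∈ Icc lo hi, d ≤ g * x - n * f x) (hT : 0 < T)
    (hw : hi - lo < d * T^2/2) (z : ℝ × ℝ) (hz1 : lo ≤ z.1) (hz2 : 0 ≤ z.2) :
    hi < (flow f g n T z).1 := by
  set X := fun t => (flow f g n t z).1 with hX
  set V := fun t => (flow f g n t z).2 with hV
  have hX0 : X 0 = z.1 := by simp [hX, flow_zero hf]
  have hV0 : V 0 = z.2 := by simp [hV, flow_zero hf]
  have dX : ∀ t, HasDerivAt X (V t) t := fun t => flow_deriv1 hf g n z t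
  have dV : ∀ t, HasDerivAt V (g * X t - n * f (X t)) t := fun t => flow_deriv2 hf g n z t
  have cX : Continuous X := continuous_iff_continuousAt.2 fun t => (dX t).continuousAt
  have cV : Continuous V := continuous_iff_continuousAt.2 fun t => (dV t).continuousAt
  have hxy : ∀ t, 0 ≤ t → 0 ≤ X t * V t := by
    intro t ht
    have h1 := xy_mono hf hG z ht
    simp only [flow_zero hf] at h1
    have : 0 ≤ z.1 * z.2 := mul_nonneg (by linarith) hz2
    exact this.trans h1
  have hsq : MonotoneOn (fun t => X t^2) (Ici 0) := by
    have hd : ∀ t, HasDerivAt (fun t => X t^2) (2 * (X t * V t)) t := fun t =>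
      ((dX t).pow 2).congr_deriv (by simp; ring)
    apply monotoneOn_of_deriv_nonneg (convex_Ici 0) (by fun_prop)
      (fun t _ => (hd t).differentiableAt.differentiableWithinAt)
    intro t ht
    rw [(hd t).deriv]
    rw [interior_Ici] at ht
    have := hxy t (le_of_lt ht)
    linarith
  have hpos : ∀ t, 0 ≤ t → 0 < X t := by
    intro t ht
    by_contra hcon
    push Not at hcon
    obtain ⟨s, hs, hs2⟩ := intermediate_value_Icc' ht cX.continuousOn
      (show (0:ℝ) ∈ Icc (X t) (X 0) from ⟨hcon, by rw [hX0]; linarith⟩)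
    have := hsq (self_mem_Ici (a := (0:ℝ))) (show s ∈ Ici (0:ℝ) from hs.1) hs.1
    simp only [hs2, hX0] at this
    nlinarith
  have hVn : ∀ t, 0 ≤ t → 0 ≤ V t := by
    intro t ht
    have h1 := hxy t ht
    have h2 := hpos t ht
    by_contra hcon
    push Not at hcon
    nlinarith
  have hXm : MonotoneOn X (Ici 0) := by
    apply monotoneOn_of_deriv_nonneg (convex_Ici 0) cX.continuousOn
      (fun t _ => (dX t).differentiableAt.differentiableWithinAt)
    intro t ht
    rw [(dX t).deriv]
    rw [interior_Ici] at ht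
    exact hVn t (le_of_lt ht)
  by_contra hcon
  replace hcon : X T ≤ hi := not_lt.1 hcon
  have hmem : ∀ t ∈ Icc 0 T, X t ∈ Icc lo hi := by
    intro t ht
    constructor
    · have := hXm (self_mem_Ici (a := (0:ℝ))) (show t ∈ Ici (0:ℝ) from ht.1) ht.1
      rw [hX0] at this; linarith
    · have := hXm (show t ∈ Ici (0:ℝ) from ht.1) (show T ∈ Ici (0:ℝ) from hT.le) ht.2
      linarith
  have hVd : ∀ t ∈ Icc 0 T, d * t ≤ V t := by
    have hm : MonotoneOn (fun t => V t - d * t) (Icc 0 T) := by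
      have hd' : ∀ t, HasDerivAt (fun t => V t - d * t) (g * X t - n * f (X t) - d) t := fun t =>
        ((dV t).sub ((hasDerivAt_id t).const_mul d)).congr_deriv (by simp)
      apply monotoneOn_of_deriv_nonneg (convex_Icc 0 T) (by fun_prop)
        (fun t _ => (hd' t).differentiableAt.differentiableWithinAt)
      intro t ht
      rw [(hd' t).deriv]
      have := hd _ (hmem t (interior_subset ht))
      linarith
    intro t ht
    have := hm (left_mem_Icc.2 hT.le) ht ht.1
    simp only [hV0] at this
    linarith
  have hm : MonotoneOn (fun t => X t - d * t^2/2) (Icc 0 T) := by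
    have hd' : ∀ t, HasDerivAt (fun t => X t - d * t^2/2) (V t - d * t) t := fun t =>
      ((dX t).sub ((((hasDerivAt_id t).pow 2).const_mul d).div_const 2)).congr_deriv (by simp; ring)
    apply monotoneOn_of_deriv_nonneg (convex_Icc 0 T) (by fun_prop)
      (fun t _ => (hd' t).differentiableAt.differentiableWithinAt)
    intro t ht
    rw [(hd' t).deriv]
    have := hVd _ ((interior_subset ht))
    linarith
  have := hm (left_mem_Icc.2 hT.le) (right_mem_Icc.2 hT.le) hT.le
  simp only [hX0] at this
  linarith

lemma n2_main (hf : LipschitzWith K f) {hi C T Y : ℝ}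
    (hC : ∀ x ≤ 1, g * x - n * f x ≤ C) (hC0 : 0 ≤ C) (hi1 : hi < 1)
    (hT : 0 < T) (hY : C * T + hi / T ≤ Y) (hhi : 0 ≤ hi) (z : ℝ × ℝ) (hz1 : z.1 ≤ hi) (hz2 : z.2 ≤ -Y) :
    (flow f g n T z).1 ≤ 0 := by
  set X := fun t => (flow f g n t z).1 with hX
  set V := fun t => (flow f g n t z).2 with hV
  have hX0 : X 0 = z.1 := by simp [hX, flow_zero hf]
  have hV0 : V 0 = z.2 := by simp [hV, flow_zero hf]
  have dX : ∀ t, HasDerivAt X (V t) t := fun t => flow_deriv1 hf g n z t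
  have dV : ∀ t, HasDerivAt V (g * X t - n * f (X t)) t := fun t => flow_deriv2 hf g n z t
  have cX : Continuous X := continuous_iff_continuousAt.2 fun t => (dX t).continuousAt
  have cV : Continuous V := continuous_iff_continuousAt.2 fun t => (dV t).continuousAt
  have hdiv : 0 ≤ hi / T := by positivity
  have key : ∀ S, 0 ≤ S → S ≤ T → (∀ t ∈ Icc 0 S, X t ≤ 1) → X S ≤ z.1 - hi/T * S := by
    intro S hS hST hX1
    have hVd : ∀ t ∈ Icc 0 S, V t ≤ -(hi/T) := by
      have hm : AntitoneOn (fun t => V t - C * t) (Icc 0 S) := by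
        have hd' : ∀ t, HasDerivAt (fun t => V t - C * t) (g * X t - n * f (X t) - C) t := fun t =>
          ((dV t).sub ((hasDerivAt_id t).const_mul C)).congr_deriv (by simp)
        apply antitoneOn_of_deriv_nonpos (convex_Icc 0 S) (by fun_prop)
          (fun t _ => (hd' t).differentiableAt.differentiableWithinAt)
        intro t ht
        rw [(hd' t).deriv]
        have := hC _ (hX1 t (interior_subset ht))
        linarith
      intro t ht
      have := hm (left_mem_Icc.2 hS) ht ht.1
      simp only [hV0] at this
      have : C * t ≤ C * T := mul_le_mul_of_nonneg_left (ht.2.trans hST) hC0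
      linarith
    have hm : AntitoneOn (fun t => X t + hi/T * t) (Icc 0 S) := by
      have hd' : ∀ t, HasDerivAt (fun t => X t + hi/T * t) (V t + hi/T) t := fun t =>
        ((dX t).add ((hasDerivAt_id t).const_mul (hi/T))).congr_deriv (by simp)
      apply antitoneOn_of_deriv_nonpos (convex_Icc 0 S) (by fun_prop)
        (fun t _ => (hd' t).differentiableAt.differentiableWithinAt)
      intro t ht
      rw [(hd' t).deriv]
      have := hVd _ ((interior_subset ht))
      linarith
    have := hm (left_mem_Icc.2 hS) (right_mem_Icc.2 hS) hS
    simp only [hX0] at this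
    linarith
  have hle : ∀ t ∈ Icc 0 T, X t ≤ 1 := by
    by_contra hcon
    push Not at hcon
    obtain ⟨t1, ht1, ht2⟩ := hcon
    have hcomp : IsCompact (Icc 0 T ∩ {t | 1 ≤ X t}) :=
      isCompact_Icc.inter_right (isClosed_le continuous_const cX)
    obtain ⟨S, ⟨hS1, hS2⟩, hmin⟩ := hcomp.exists_isLeast ⟨t1, ht1, ht2.le⟩
    replace hS2 : 1 ≤ X S := hS2
    have hX1 : ∀ t ∈ Icc 0 S, X t ≤ 1 := by
      have hcl : Icc 0 S ⊆ closure (Ico 0 S) := by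
        rw [closure_Ico]
        · rintro rfl; rw [hX0] at hS2; linarith
      have hcl2 : IsClosed {t | X t ≤ 1} := isClosed_le cX continuous_const
      have : Ico 0 S ⊆ {t | X t ≤ 1} := by
        intro t ht
        by_contra hc
        replace hc : 1 < X t := not_le.1 hc
        have := hmin ⟨⟨ht.1, ht.2.le.trans hS1.2⟩, hc.le⟩
        exact absurd ht.2 (not_lt.2 this)
      exact fun t ht => (hcl2.closure_subset_iff.2 this) (hcl ht)
    have := key S hS1.1 hS1.2 hX1
    have : 0 ≤ hi/T * S := mul_nonneg hdiv hS1.1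
    linarith
  have := key T hT.le le_rfl hle
  have e : hi/T * T = hi := by field_simp
  change X T ≤ 0
  linarith

/-- backward versions -/
lemma rev_pt (hf : LipschitzWith K f) (T : ℝ) (w : ℝ × ℝ) :
    (flow f g n T ((flow f g n T w).1, -(flow f g n T w).2)) = (w.1, -w.2) := by
  have h1 := flow_rev hf g n T (flow f g n T w)
  rw [← flow_add hf, neg_add_cancel, flow_zero hf] at h1
  set u := flow f g n T ((flow f g n T w).1, -(flow f g n T w).2)
  have e1 := congrArg Prod.fst h1
  have e2 := congrArg Prod.snd h1
  simp only at e1 e2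
  ext
  · exact e1.symm
  · simp only; linarith

end Flow

end

section
open Set Filter
open scoped NNReal

namespace Shoe

/-- abstract horseshoe data -/
structure Data (φ : (ℝ × ℝ) ≃ₜ (ℝ × ℝ)) (Θ : ℝ × ℝ → ℝ) (xm xp Y e : ℝ) (lo : Fin 2 → ℝ) : Prop where
  hx : xm < xp
  hY : 0 < Y
  he : 0 < e
  hlo : lo 0 + e < lo 1
  cont : Continuous Θ
  left : ∀ z : ℝ × ℝ, z.1 = xm → z.2 ∈ Icc 0 Y → lo 1 + e ≤ Θ z
  right : ∀ z : ℝ × ℝ, z.1 = xp → z.2 ∈ Icc 0 Y → Θ z ≤ lo 0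
  d1 : ∀ z : ℝ × ℝ, z.1 ∈ Icc xm xp → z.2 ∈ Icc 0 Y → ∀ b, Θ z = lo b → xp < (φ z).1
  d2 : ∀ z : ℝ × ℝ, z.1 ∈ Icc xm xp → z.2 ∈ Icc 0 Y → ∀ b, Θ z = lo b + e → (φ z).1 < xm
  d3 : ∀ z : ℝ × ℝ, z.1 ∈ Icc xm xp → z.2 ∈ Icc 0 Y → ∀ b, Θ z ∈ Icc (lo b) (lo b + e) →
    (φ z).1 ∈ Icc xm xp → (φ z).2 ∈ Ioo 0 Y

variable {φ : (ℝ × ℝ) ≃ₜ (ℝ × ℝ)} {Θ : ℝ × ℝ → ℝ} {xm xp Y e : ℝ} {lo : Fin 2 → ℝ}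

lemma Data.lo_bd (D : Data φ Θ xm xp Y e lo) (b : Fin 2) : lo 0 ≤ lo b ∧ lo b ≤ lo 1 := by
  have h1 := D.hlo
  have h2 := D.he
  fin_cases b <;> simp <;> linarith

lemma Data.cycle (D : Data φ Θ xm xp Y e lo) (ℓ : ℕ) [NeZero ℓ] (j : ZMod ℓ → Fin 2) :
    ∃ z : ZMod ℓ → ℝ × ℝ, ∀ i, (z i).1 ∈ Icc xm xp ∧ (z i).2 ∈ Icc 0 Y ∧
      Θ (z i) ∈ Icc (lo (j i)) (lo (j i) + e) ∧ φ (z i) = z (i + 1) := by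
  have hφ := φ.continuous
  have hΘ := D.cont
  have hY := D.hY
  have he := D.he
  let pt : (ZMod ℓ ⊕ ZMod ℓ → ℝ) → ZMod ℓ → ℝ × ℝ := fun u i => (u (Sum.inl i), u (Sum.inr i))
  have hpt : ∀ i, Continuous (fun u => pt u i) := fun i => by fun_prop
  let f : (ZMod ℓ ⊕ ZMod ℓ → ℝ) → ZMod ℓ ⊕ ZMod ℓ → ℝ := fun u => Sum.elim
    (fun i => min (max ((φ (pt u i)).1 - u (Sum.inl (i+1))) (lo (j i) - Θ (pt u i)))
      (lo (j i) + e - Θ (pt u i)))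
    (fun i => u (Sum.inr i) - max 0 (min Y (φ (pt u (i-1))).2))
  have hf : Continuous f := by
    apply continuous_pi
    rintro (i | i)
    · have h1 : Continuous (fun u => φ (pt u i)) := hφ.comp (hpt i)
      have h2 : Continuous (fun u => Θ (pt u i)) := hΘ.comp (hpt i)
      simp only [f, Sum.elim_inl]
      fun_prop
    · have h1 : Continuous (fun u => φ (pt u (i-1))) := hφ.comp (hpt (i-1))
      simp only [f, Sum.elim_inr]
      fun_prop
  let l : ZMod ℓ ⊕ ZMod ℓ → ℝ := Sum.elim (fun _ => xm) (fun _ => 0)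
  let u : ZMod ℓ ⊕ ZMod ℓ → ℝ := Sum.elim (fun _ => xp) (fun _ => Y)
  have hmem1 : ∀ v ∈ Icc l u, ∀ i, (pt v i).1 ∈ Icc xm xp := fun v hv i =>
    ⟨hv.1 (Sum.inl i), hv.2 (Sum.inl i)⟩
  have hmem2 : ∀ v ∈ Icc l u, ∀ i, (pt v i).2 ∈ Icc 0 Y := fun v hv i =>
    ⟨hv.1 (Sum.inr i), hv.2 (Sum.inr i)⟩
  obtain ⟨v, hv, hv0⟩ := PMir.miranda l u
    (by rintro (i | i)
        · exact D.hx.le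
        · exact hY.le) f hf.continuousOn
    (by rintro v hv (i | i) hvi
        · have h1 := D.left (pt v i) hvi (hmem2 v hv i)
          have h2 := (D.lo_bd (j i)).2
          simp only [f, Sum.elim_inl]
          exact (min_le_right _ _).trans (by linarith)
        · simp only [f, Sum.elim_inr]
          have h1 : v (Sum.inr i) = 0 := hvi
          have h2 : 0 ≤ max 0 (min Y (φ (pt v (i-1))).2) := le_max_left _ _
          linarith)
    (by rintro v hv (i | i) hvi
        · have h1 := D.right (pt v i) hvi (hmem2 v hv i)
          have h2 := (D.lo_bd (j i)).1
          simp only [f, Sum.elim_inl]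
          apply le_min
          · exact le_max_of_le_right (by linarith)
          · linarith
        · simp only [f, Sum.elim_inr]
          have h1 : v (Sum.inr i) = Y := hvi
          have h2 : max 0 (min Y (φ (pt v (i-1))).2) ≤ Y := max_le hY.le (min_le_left _ _)
          linarith)
  have key : ∀ i, Θ (pt v i) ∈ Icc (lo (j i)) (lo (j i) + e) ∧ (φ (pt v i)).1 = v (Sum.inl (i+1)) := by
    intro i
    have h0 : min (max ((φ (pt v i)).1 - v (Sum.inl (i+1))) (lo (j i) - Θ (pt v i)))
      (lo (j i) + e - Θ (pt v i)) = 0 := hv0 (Sum.inl i)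
    have m1 := hmem1 v hv i
    have m2 := hmem2 v hv i
    have m3 : v (Sum.inl (i+1)) ∈ Icc xm xp := hmem1 v hv (i+1)
    have D1 := D.d1 _ m1 m2 (j i)
    have D2 := D.d2 _ m1 m2 (j i)
    have a1 : 0 ≤ lo (j i) + e - Θ (pt v i) := by rw [← h0]; exact min_le_right _ _
    have a2 : 0 ≤ max ((φ (pt v i)).1 - v (Sum.inl (i+1))) (lo (j i) - Θ (pt v i)) := by
      rw [← h0]; exact min_le_left _ _
    have a3 : Θ (pt v i) ≠ lo (j i) + e := by
      intro h
      have := D2 h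
      rcases le_max_iff.1 a2 with h' | h'
      · linarith [m3.1]
      · linarith
    have a4 : 0 < lo (j i) + e - Θ (pt v i) := lt_of_le_of_ne a1 (fun h => a3 (by linarith))
    have a5 : max ((φ (pt v i)).1 - v (Sum.inl (i+1))) (lo (j i) - Θ (pt v i)) = 0 := by
      rcases min_choice (max ((φ (pt v i)).1 - v (Sum.inl (i+1))) (lo (j i) - Θ (pt v i)))
        (lo (j i) + e - Θ (pt v i)) with h | h
      · rw [← h]; exact h0
      · rw [h] at h0; linarith
    have a6 : (φ (pt v i)).1 - v (Sum.inl (i+1)) ≤ 0 := by rw [← a5]; exact le_max_left _ _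
    have a7 : lo (j i) - Θ (pt v i) ≤ 0 := by rw [← a5]; exact le_max_right _ _
    have a8 : Θ (pt v i) ≠ lo (j i) := by
      intro h
      have := D1 h
      linarith [m3.2]
    refine ⟨⟨by linarith, by linarith⟩, ?_⟩
    rcases le_max_iff.1 a2 with h' | h'
    · linarith
    · exact absurd (by linarith) a8
  refine ⟨pt v, fun i => ⟨hmem1 v hv i, hmem2 v hv i, (key i).1, ?_⟩⟩
  have h1 := (key i).2
  have h2 := D.d3 _ (hmem1 v hv i) (hmem2 v hv i) (j i) (key i).1 (by rw [h1]; exact hmem1 v hv (i+1))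
  have h3 : v (Sum.inr (i+1)) - max 0 (min Y (φ (pt v (i+1-1))).2) = 0 := hv0 (Sum.inr (i+1))
  rw [add_sub_cancel_right, min_eq_right h2.2.le, max_eq_right h2.1.le] at h3
  ext
  · exact h1
  · change (φ (pt v i)).2 = v (Sum.inr (i+1))
    linarith

/-- basic region -/
def reg (Θ : ℝ × ℝ → ℝ) (xm xp Y e : ℝ) (lo : Fin 2 → ℝ) : Set (ℝ × ℝ) :=
  (Icc xm xp ×ˢ Icc 0 Y) ∩ {z | ∃ b, Θ z ∈ Icc (lo b) (lo b + e)}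

/-- invariant set -/
def inv (φ : (ℝ × ℝ) ≃ₜ (ℝ × ℝ)) (Θ : ℝ × ℝ → ℝ) (xm xp Y e : ℝ) (lo : Fin 2 → ℝ) : Set (ℝ × ℝ) :=
  {z | ∀ k : ℤ, (φ^k) z ∈ reg Θ xm xp Y e lo}

open Classical in
/-- the itinerary -/
noncomputable def itin (φ : (ℝ × ℝ) ≃ₜ (ℝ × ℝ)) (Θ : ℝ × ℝ → ℝ) (lo : Fin 2 → ℝ) (z : ℝ × ℝ) (k : ℤ) :
    Fin 2 := if Θ ((φ^k) z) < lo 1 then 0 else 1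

lemma reg_compact (D : Data φ Θ xm xp Y e lo) : IsCompact (reg Θ xm xp Y e lo) := by
  apply (isCompact_Icc.prod isCompact_Icc).inter_right
  have : {z | ∃ b, Θ z ∈ Icc (lo b) (lo b + e)} = ⋃ b, Θ ⁻¹' Icc (lo b) (lo b + e) := by
    ext z; simp
  rw [this]
  exact isClosed_iUnion_of_finite fun b => isClosed_Icc.preimage D.cont

lemma inv_compact (D : Data φ Θ xm xp Y e lo) : IsCompact (inv φ Θ xm xp Y e lo) := by
  have hR := reg_compact D
  apply hR.of_isClosed_subset
  · have : inv φ Θ xm xp Y e lo = ⋂ k : ℤ, (φ^k) ⁻¹' reg Θ xm xp Y e lo := by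
      ext z; simp [inv]
    rw [this]
    exact isClosed_iInter fun k => hR.isClosed.preimage (φ^k).continuous
  · intro z hz
    simpa using hz 0

lemma inv_map {z : ℝ × ℝ} : φ z ∈ inv φ Θ xm xp Y e lo ↔ z ∈ inv φ Θ xm xp Y e lo := by
  have e1 : ∀ k : ℤ, (φ^k) (φ z) = (φ^(k+1)) z := by
    intro k
    rw [zpow_add_one, Homeomorph.mul_apply]
  constructor
  · intro h k
    have := h (k-1)
    rwa [e1, sub_add_cancel] at this
  · intro h k
    rw [e1]
    exact h (k+1)

lemma itin_map (z : ℝ × ℝ) : itin φ Θ lo (φ z) = fun k => itin φ Θ lo z (k+1) := by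
  ext k
  simp only [itin, zpow_add_one, Homeomorph.mul_apply]

lemma inv_image : φ '' inv φ Θ xm xp Y e lo = inv φ Θ xm xp Y e lo := by
  ext z
  constructor
  · rintro ⟨w, hw, rfl⟩
    exact inv_map.2 hw
  · intro hz
    refine ⟨φ.symm z, ?_, by simp⟩
    rw [← inv_map]
    simpa using hz

lemma inv_sub (D : Data φ Θ xm xp Y e lo) {z : ℝ × ℝ} (hz : z ∈ inv φ Θ xm xp Y e lo) :
    z.1 ∈ Icc xm xp ∧ 0 < z.2 := by
  rw [← inv_image] at hz
  obtain ⟨w, hw, rfl⟩ := hz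
  have h1 : w ∈ reg Θ xm xp Y e lo := by simpa using hw 0
  have h2 : φ w ∈ reg Θ xm xp Y e lo := by simpa using hw 1
  obtain ⟨⟨m1, m2⟩, b, hb⟩ := h1
  exact ⟨h2.1.1, (D.d3 w m1 m2 b hb h2.1.1).1⟩

lemma itin_eq (D : Data φ Θ xm xp Y e lo) {z : ℝ × ℝ} {k : ℤ} {b : Fin 2}
    (hb : Θ ((φ^k) z) ∈ Icc (lo b) (lo b + e)) : itin φ Θ lo z k = b := by
  have := D.hlo
  unfold itin
  fin_cases b
  · simp at hb
    rw [if_pos (by linarith [hb.2])]; rfl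
  · simp at hb
    rw [if_neg (by linarith [hb.1])]; rfl

lemma itin_cont (D : Data φ Θ xm xp Y e lo) : ContinuousOn (itin φ Θ lo) (inv φ Θ xm xp Y e lo) := by
  rw [continuousOn_pi]
  intro k z hz
  obtain ⟨-, b, hb⟩ := hz k
  have hc : Continuous (fun z => Θ ((φ^k) z)) := D.cont.comp (φ^k).continuous
  have hlo := D.hlo
  have he := D.he
  have hx0 : (fun y => itin φ Θ lo y k) z = (fun _ => b) z := itin_eq D hb
  refine ContinuousWithinAt.congr_of_eventuallyEq (f := fun _ => b) continuousWithinAt_const ?_ hx0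
  have hmem : ∀ᶠ w in nhdsWithin z (inv φ Θ xm xp Y e lo), w ∈ inv φ Θ xm xp Y e lo :=
    self_mem_nhdsWithin
  fin_cases b
  · simp at hb
    have h1 : ∀ᶠ w in nhdsWithin z (inv φ Θ xm xp Y e lo), Θ ((φ^k) w) < lo 1 :=
      Filter.Eventually.filter_mono nhdsWithin_le_nhds
        (hc.continuousAt.eventually_lt continuousAt_const (by linarith [hb.2]))
    filter_upwards [h1] with w hw
    simp [itin, hw]
  · simp at hb
    have h1 : ∀ᶠ w in nhdsWithin z (inv φ Θ xm xp Y e lo), lo 0 + e < Θ ((φ^k) w) :=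
      Filter.Eventually.filter_mono nhdsWithin_le_nhds
        (continuousAt_const.eventually_lt hc.continuousAt (by linarith [hb.1]))
    filter_upwards [h1, hmem] with w hw hw2
    obtain ⟨-, b', hb'⟩ := hw2 k
    rw [itin_eq D hb']
    fin_cases b'
    · simp at hb'; linarith [hb'.2]
    · rfl

lemma per_mod {s : ℤ → Fin 2} {ℓ : ℕ} (hs : ∀ k : ℤ, s (k + (ℓ : ℤ)) = s k) (k : ℤ) :
    s (k % ℓ) = s k := by
  have hp : Function.Periodic s (ℓ:ℤ) := hs
  have := hp.int_mul (k / ℓ) (k % ℓ)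
  rw [← this]
  congr 1
  have := Int.emod_add_mul_ediv k ℓ
  simp only [Int.cast_id]
  linarith

lemma exists_per (D : Data φ Θ xm xp Y e lo) (s : ℤ → Fin 2) (ℓ : ℕ) (hℓ : 1 ≤ ℓ)
    (hs : ∀ k : ℤ, s (k + (ℓ : ℤ)) = s k) :
    ∃ z ∈ inv φ Θ xm xp Y e lo, itin φ Θ lo z = s ∧ φ^[ℓ] z = z := by
  have : NeZero ℓ := ⟨by omega⟩
  obtain ⟨z, hz⟩ := D.cycle ℓ (fun i => s (i.val : ℤ))
  have horb : ∀ k : ℤ, (φ^k) (z 0) = z (k : ZMod ℓ) := by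
    intro k
    induction k using Int.induction_on with
    | zero => simp
    | succ n ih =>
      rw [add_comm, zpow_add, Homeomorph.mul_apply, ih, zpow_one, (hz _).2.2.2]
      congr 1; push_cast; ring
    | pred n ih =>
      rw [sub_eq_add_neg, add_comm, zpow_add, Homeomorph.mul_apply, ih, zpow_neg_one]
      change φ.symm _ = _
      rw [Homeomorph.symm_apply_eq, (hz _).2.2.2]
      congr 1; push_cast; ring
  have hsym : ∀ k : ℤ, Θ ((φ^k) (z 0)) ∈ Icc (lo (s k)) (lo (s k) + e) := by
    intro k
    have h1 := (hz (k : ZMod ℓ)).2.2.1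
    rw [ZMod.val_intCast, per_mod hs] at h1
    rw [horb]; exact h1
  refine ⟨z 0, ?_, ?_, ?_⟩
  · intro k
    refine ⟨?_, s k, hsym k⟩
    rw [horb]
    exact ⟨(hz _).1, (hz _).2.1⟩
  · ext1 k
    exact itin_eq D (hsym k)
  · have h1 : ∀ n : ℕ, φ^[n] (z 0) = z (n : ZMod ℓ) := by
      intro n
      induction n with
      | zero => simp
      | succ n ih =>
        rw [Function.iterate_succ_apply', ih, (hz _).2.2.2]
        push_cast; rfl
    rw [h1]; simp

lemma itin_surj (D : Data φ Θ xm xp Y e lo) : itin φ Θ lo '' inv φ Θ xm xp Y e lo = univ := by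
  have hcl : IsClosed (itin φ Θ lo '' inv φ Θ xm xp Y e lo) :=
    ((inv_compact D).image_of_continuousOn (itin_cont D)).isClosed
  apply eq_univ_of_forall
  intro s
  let sm : ℕ → ℤ → Fin 2 := fun m k => s ((k + m) % ((2 * m + 1 : ℕ) : ℤ) - m)
  have hsm : ∀ m, sm m ∈ itin φ Θ lo '' inv φ Θ xm xp Y e lo := by
    intro m
    obtain ⟨z, hz, h1, -⟩ := exists_per D (sm m) (2*m+1) (by omega) (by
      intro k
      simp only [sm]
      congr 2
      rw [add_right_comm, Int.add_emod_right])
    exact ⟨z, hz, h1⟩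
  have hlim : Tendsto sm atTop (nhds s) := by
    rw [tendsto_pi_nhds]
    intro k
    apply tendsto_nhds_of_eventually_eq
    filter_upwards [eventually_ge_atTop k.natAbs] with m hm
    simp only [sm]
    congr 1
    rw [Int.emod_eq_of_lt] <;> push_cast <;> omega
  exact hcl.mem_of_tendsto hlim (Eventually.of_forall hsm)

end Shoe

end

section
open Set Filter
open scoped NNReal

namespace Flow

lemma clamp_lip {F : ℝ → ℝ} (hF : ContDiff ℝ 1 F) {R : ℝ} (hR : 0 ≤ R) :
    ∃ K : ℝ≥0, LipschitzWith K (fun x => F (max (-R) (min R x))) := by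
  obtain ⟨K, hK⟩ := (hF.contDiffOn (s := Icc (-R) R)).exists_lipschitzOnWith (by norm_num)
    (convex_Icc _ _) isCompact_Icc
  have h1 : LipschitzWith 1 (fun x : ℝ => max (-R) (min R x)) :=
    (LipschitzWith.id.const_min R).const_max (-R)
  refine ⟨K * 1, ?_⟩
  rw [← lipschitzOnWith_univ] at h1 ⊢
  exact hK.comp h1 (fun x _ => ⟨le_max_left _ _, max_le (by linarith) (min_le_left _ _)⟩)

lemma clamp_eq {R x : ℝ} (hx : |x| ≤ R) : max (-R) (min R x) = x := by
  rw [abs_le] at hx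
  rw [min_eq_right hx.2, max_eq_right hx.1]

lemma deriv_right {v : ℝ × ℝ → ℝ × ℝ} (hv : Continuous v) {ζ : ℝ → ℝ × ℝ} {s t : ℝ} (hst : s < t)
    (hc : ContinuousOn ζ (Icc s t)) (hd : ∀ u ∈ Ioo s t, HasDerivAt ζ (v (ζ u)) u) :
    ∀ u ∈ Ico s t, HasDerivWithinAt ζ (v (ζ u)) (Ici u) u := by
  intro u hu
  rcases hu.1.eq_or_lt with rfl | h
  · have hmem : Ioo s t ∈ nhdsWithin s (Ioi s) := Ioo_mem_nhdsGT hst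
    apply hasDerivWithinAt_Ici_of_tendsto_deriv (s := Ioo s t)
      (fun u hu => (hd u hu).differentiableAt.differentiableWithinAt)
      ((hc s (left_mem_Icc.2 hst.le)).mono Ioo_subset_Icc_self) hmem
    have h1 : Tendsto (fun u => v (ζ u)) (nhdsWithin s (Ioi s)) (nhds (v (ζ s))) := by
      apply (hv.tendsto _).comp
      have := (hc s (left_mem_Icc.2 hst.le)).mono Ioo_subset_Icc_self
      have h2 : Tendsto ζ (nhdsWithin s (Ioo s t)) (nhds (ζ s)) := this
      rwa [nhdsWithin_Ioo_eq_nhdsGT hst] at h2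
    apply h1.congr'
    filter_upwards [hmem] with u hu
    rw [(hd u hu).deriv]
  · exact (hd u ⟨h, hu.2⟩).hasDerivWithinAt

lemma bridge {F f : ℝ → ℝ} {K : ℝ≥0} (hF : ContDiff ℝ 1 F) (hf : LipschitzWith K f)
    (hfF : ∀ x, |x| ≤ 1 → f x = F x) {g n s t : ℝ} (hst : s < t) {ζ : ℝ → ℝ × ℝ}
    (hc : ContinuousOn ζ (Icc s t))
    (hd : ∀ u ∈ Ioo s t, HasDerivAt ζ ((ζ u).2, g * (ζ u).1 - n * F ((ζ u).1)) u)
    (hb : ∀ u ∈ Icc 0 (t - s), |(flow f g n u (ζ s)).1| ≤ 1) :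
    ζ t = flow f g n (t - s) (ζ s) := by
  obtain ⟨B, hB⟩ := isCompact_Icc.exists_bound_of_continuousOn hc
  set R := max 1 B with hR
  have hR1 : 1 ≤ R := le_max_left _ _
  have hζR : ∀ u ∈ Icc s t, |(ζ u).1| ≤ R := fun u hu =>
    (norm_fst_le (ζ u)).trans ((hB u hu).trans (le_max_right _ _))
  obtain ⟨K', hK'⟩ := clamp_lip hF (R := R) (by linarith)
  set f' := fun x => F (max (-R) (min R x)) with hf'
  have hf'F : ∀ x, |x| ≤ R → f' x = F x := fun x hx => by
    simp only [hf', clamp_eq hx]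
  obtain ⟨M, hM⟩ := fld_lip' hK' g n
  have hflow : ∀ u, HasDerivAt (fun u => flow f g n (u - s) (ζ s)) (fld f g n (flow f g n (u - s) (ζ s))) u := by
    intro u
    exact (flow_deriv hf g n (ζ s) (u - s)).comp_sub_const u s
  have h1 := ODE_solution_unique_of_mem_Icc_right (v := fun _ => fld f' g n) (s := fun _ => univ)
    (K := M) (f := ζ) (g := fun u => flow f g n (u - s) (ζ s)) (a := s) (b := t)
    (fun _ _ => hM.lipschitzOnWith) hc
    (deriv_right hM.continuous hst hc (fun u hu => by
      have := hd u hu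
      rw [fld, hf'F _ (hζR u (Ioo_subset_Icc_self hu))]
      exact this)) (fun _ _ => mem_univ _)
    (fun u _ => (hflow u).continuousAt.continuousWithinAt)
    (fun u hu => by
      have h2 := hb (u - s) ⟨by linarith [hu.1], by linarith [hu.2]⟩
      have h3 := hflow u
      have h4 : fld f g n (flow f g n (u - s) (ζ s)) = fld f' g n (flow f g n (u - s) (ζ s)) := by
        rw [fld, fld, hfF _ h2, hf'F _ (h2.trans hR1)]
      rw [h4] at h3
      exact h3.hasDerivWithinAt) (fun _ _ => mem_univ _)
    (by simp [flow_zero hf])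
  exact h1 (right_mem_Icc.2 hst.le)

/-- the flow as a homeomorphism -/
noncomputable def flowH {f : ℝ → ℝ} {K : ℝ≥0} (hf : LipschitzWith K f) (g n t : ℝ) :
    (ℝ × ℝ) ≃ₜ (ℝ × ℝ) where
  toFun := flow f g n t
  invFun := flow f g n (-t)
  left_inv z := by rw [← flow_add hf, neg_add_cancel, flow_zero hf]
  right_inv z := by rw [← flow_add hf, add_neg_cancel, flow_zero hf]
  continuous_toFun := flow_cont_z hf g n t
  continuous_invFun := flow_cont_z hf g n (-t)

end Flow

end

section
open Set Filter
open scoped NNReal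

namespace Flow

/-- facts about `m₀*` with `M` the maximum of `F(s)/s` -/
lemma m0_facts {g : ℝ} (hg : 0 < g) {F : ℝ → ℝ} (hFc : Continuous F) {a : ℝ} (ha0 : 0 < a)
    (ha1 : a < 1) (hFpos₂ : ∀ s, a < s → s < 1 → 0 < F s)
    (hconc : StrictConcaveOn ℝ (Set.Icc a 1) F) :
    0 < g / sSup ((fun s => F s / s) '' Set.Icc a 1) ∧
    (∀ x ∈ Icc a 1, 0 ≤ g * x - g / sSup ((fun s => F s / s) '' Set.Icc a 1) * F x) ∧
    (∀ xh, a < xh → xh < 1 → ∃ p, a < p ∧ p < xh ∧ ∀ x, p ≤ x → x < xh →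
      0 < g * x - g / sSup ((fun s => F s / s) '' Set.Icc a 1) * F x) := by
  set M := sSup ((fun s => F s / s) '' Set.Icc a 1) with hM
  have hbdd : BddAbove ((fun s => F s / s) '' Set.Icc a 1) := by
    apply IsCompact.bddAbove
    apply isCompact_Icc.image_of_continuousOn
    apply ContinuousOn.div hFc.continuousOn continuousOn_id
    intro x hx
    simp only [id]
    linarith [hx.1]
  have hle : ∀ x ∈ Icc a 1, F x ≤ M * x := by
    intro x hx
    have := le_csSup hbdd (mem_image_of_mem _ hx)
    simp only [← hM] at this
    rwa [div_le_iff₀ (by linarith [hx.1])] at this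
  have hM0 : 0 < M := by
    have h1 := hle ((a+1)/2) ⟨by linarith, by linarith⟩
    have h2 := hFpos₂ ((a+1)/2) (by linarith) (by linarith)
    by_contra hcon
    push Not at hcon
    nlinarith
  have hD : ∀ x, g * x - g / M * F x = g / M * (M * x - F x) := by
    intro x; field_simp
  have hgM : 0 < g / M := by positivity
  refine ⟨hgM, ?_, ?_⟩
  · intro x hx
    rw [hD]
    exact mul_nonneg hgM.le (by linarith [hle x hx])
  · intro xh h1 h2
    have huniq : ∀ s ∈ Icc a 1, ∀ t ∈ Icc a 1, F s = M * s → F t = M * t → s < t → False := by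
      intro s hs t ht es et hst
      have hmid := hconc.2 hs ht hst.ne (show (0:ℝ) < 1/2 by norm_num) (show (0:ℝ) < 1/2 by norm_num)
        (by norm_num)
      simp only [smul_eq_mul] at hmid
      have := hle (1/2 * s + 1/2 * t) ⟨by linarith [hs.1, ht.1], by linarith [hs.2, ht.2]⟩
      rw [es, et] at hmid
      linarith
    by_cases hs : ∃ s ∈ Icc a 1, F s = M * s ∧ s < xh
    · obtain ⟨s, hs1, hs2, hs3⟩ := hs
      refine ⟨(s + xh)/2, by linarith [hs1.1], by linarith, fun x hx1 hx2 => ?_⟩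
      rw [hD]
      have hxm : x ∈ Icc a 1 := ⟨by linarith [hs1.1], by linarith⟩
      apply mul_pos hgM
      rcases (hle x hxm).eq_or_lt with h | h
      · exact (huniq s hs1 x hxm hs2 h (by linarith)).elim
      · linarith
    · refine ⟨(a + xh)/2, by linarith, by linarith, fun x hx1 hx2 => ?_⟩
      rw [hD]
      have hxm : x ∈ Icc a 1 := ⟨by linarith, by linarith⟩
      apply mul_pos hgM
      rcases (hle x hxm).eq_or_lt with h | h
      · exact (hs ⟨x, hxm, h, hx2⟩).elim
      · linarith

/-- horseshoe data from the twist conditions -/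
lemma mkData {f : ℝ → ℝ} {K : ℝ≥0} (hf : LipschitzWith K f) {g n0 n1 α γ xm xp δ Y d C : ℝ} {N : ℕ}
    {Θ : ℝ × ℝ → ℝ} (hΘ : Continuous Θ) (hG : ∀ x, 0 ≤ x * (g * x - n0 * f x))
    (hlo : 0 < xm - δ) (hd0 : 0 ≤ d) (hδ : 0 < δ) (hmp : xm < xp) (hγ : 0 < γ) (hY0 : 0 < Y)
    (hd : ∀ x ∈ Icc (xm - δ) (xp + δ), d ≤ g * x - n0 * f x)
    (hw : xp - xm + 2 * δ < d * γ^2/2)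
    (hC : ∀ x ≤ 1, g * x - n0 * f x ≤ C) (hC0 : 0 ≤ C) (hi1 : xp + δ < 1)
    (hY : C * γ + (xp + δ) / γ ≤ Y)
    (H : ∀ z : ℝ × ℝ, z.1 ∈ Icc xm xp → z.2 ∈ Icc 0 Y →
        (∀ t, 0 < (flow f g n1 t z).1 ∧ (flow f g n1 t z).1 < 1) ∧
        (z.1 = xm → 2 * Real.pi * (N + 1) + Real.pi/2 ≤ Θ z) ∧
        (z.1 = xp → Θ z ≤ 2 * Real.pi * N) ∧
        ∀ j : ℕ, Θ z ∈ Icc (2 * Real.pi * j) (2 * Real.pi * j + Real.pi/2) →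
          (flow f g n1 α z).2 ≤ 0 ∧ (flow f g n1 α z).1 ≤ xp + δ ∧
          (-Y < (flow f g n1 α z).2 → xm - δ < (flow f g n1 α z).1) ∧
          (Θ z = 2 * Real.pi * j → (flow f g n1 α z).2 = 0) ∧
          (Θ z = 2 * Real.pi * j + Real.pi/2 → (flow f g n1 α z).2 ≤ -Y)) :
    Shoe.Data ((flowH hf g n1 α).trans (flowH hf g n0 γ)) Θ xm xp Y (Real.pi/2)
      (fun b : Fin 2 => 2 * Real.pi * ((N + (b:ℕ) : ℕ) : ℝ)) := by
  have hpi := Real.pi_pos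
  have N1 : ∀ w : ℝ × ℝ, xm - δ ≤ w.1 → 0 ≤ w.2 → xp + δ < (flow f g n0 γ w).1 := fun w h1 h2 =>
    n1_main hf hG hlo hd0 hd hγ (by linarith) w h1 h2
  have N2 : ∀ w : ℝ × ℝ, w.1 ≤ xp + δ → w.2 ≤ -Y → (flow f g n0 γ w).1 ≤ 0 := fun w h1 h2 =>
    n2_main hf hC hC0 hi1 hγ hY (by linarith) w h1 h2
  refine ⟨hmp, hY0, by linarith, ?_, hΘ, ?_, ?_, ?_, ?_, ?_⟩
  · simp; nlinarith
  · intro z hz1 hz2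
    have := (H z ⟨hz1.ge, by linarith⟩ hz2).2.1 hz1
    simpa using this
  · intro z hz1 hz2
    have := (H z ⟨by linarith, hz1.le⟩ hz2).2.2.1 hz1
    simpa using this
  · intro z hz1 hz2 b hb
    change Θ z = 2 * Real.pi * ((N + (b:ℕ) : ℕ) : ℝ) at hb
    change xp < (flow f g n0 γ (flow f g n1 α z)).1
    obtain ⟨c1, c2, c3, c4, c5⟩ := (H z hz1 hz2).2.2.2 (N + b) ⟨hb.ge, by linarith⟩
    have c6 := c4 hb
    have := N1 _ (c3 (by rw [c6]; linarith)).le c6.ge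
    linarith
  · intro z hz1 hz2 b hb
    change Θ z = 2 * Real.pi * ((N + (b:ℕ) : ℕ) : ℝ) + _ at hb
    change (flow f g n0 γ (flow f g n1 α z)).1 < xm
    obtain ⟨c1, c2, c3, c4, c5⟩ := (H z hz1 hz2).2.2.2 (N + b) ⟨by linarith, hb.le⟩
    have := N2 _ c2 (c5 hb)
    linarith
  · intro z hz1 hz2 b hb hx
    change (flow f g n0 γ (flow f g n1 α z)).1 ∈ _ at hx
    change (flow f g n0 γ (flow f g n1 α z)).2 ∈ _
    obtain ⟨c1, c2, c3, -, -⟩ := (H z hz1 hz2).2.2.2 (N + b) hb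
    set w := flow f g n1 α z with hw
    have hwY : -Y < w.2 := by
      by_contra hcon
      have := N2 w c2 (not_lt.1 hcon)
      linarith [hx.1]
    have c6 := c3 hwY
    have hrev := rev_pt (g := g) (n := n0) hf γ w
    constructor
    · by_contra hcon
      have := N1 ((flow f g n0 γ w).1, -(flow f g n0 γ w).2) (by simp only; linarith [hx.1])
        (by simp only; linarith)
      rw [hrev] at this
      simp only at this
      linarith
    · by_contra hcon
      have := N2 ((flow f g n0 γ w).1, -(flow f g n0 γ w).2) (by simp only; linarith [hx.2])
        (by simp only; linarith)
      rw [hrev] at this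
      simp only at this
      linarith

end Flow

end


/-- Complex dynamics (topological horseshoe) for the Poincaré map of the Nagumo-type
equation `x'' - g x + n(t) F(x) = 0` with stepwise periodic weight, for `n₁` large. -/
theorem chaotic_dynamics_n1_large
    (g : ℝ) (hg : 0 < g)
    (F : ℝ → ℝ) (hFC1 : ContDiff ℝ 1 F)
    (a : ℝ) (ha0 : 0 < a) (ha1 : a < 1)
    (hF0 : F 0 = 0) (hFa : F a = 0) (hF1 : F 1 = 0)
    (hFneg₁ : ∀ s, 0 < s → s < a → F s < 0)
    (hFneg₂ : ∀ s, 1 < s → F s < 0)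
    (hFpos₁ : ∀ s, s < 0 → 0 < F s)
    (hFpos₂ : ∀ s, a < s → s < 1 → 0 < F s)
    (hconv : StrictConvexOn ℝ (Set.Icc 0 a) F)
    (hconc : StrictConcaveOn ℝ (Set.Icc a 1) F)
    (hint : 0 < ∫ s in (0:ℝ)..1, F s)
    (hbdd : ∀ s, s ∉ Set.Icc (0:ℝ) 1 → |F s| ≤ 1)
    (α β : ℝ) (hα : 0 < α) (hαβ : α < β) :
    ∃ ωstar : ℝ, m0star g F a < ωstar ∧
      ∀ n₀ n₁ : ℝ, 0 < n₀ → n₀ < m0star g F a → ωstar < n₁ →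
        ∀ ψ : ℝ × ℝ → ℝ × ℝ,
          (∀ z : ℝ × ℝ, ∃ ζ : ℝ → ℝ × ℝ,
            ContinuousOn ζ (Set.Icc 0 β) ∧ ζ 0 = z ∧ ζ β = ψ z ∧
            (∀ t ∈ Set.Ioo 0 α,
              HasDerivAt ζ ((ζ t).2, g * (ζ t).1 - n₁ * F ((ζ t).1)) t) ∧
            (∀ t ∈ Set.Ioo α β,
              HasDerivAt ζ ((ζ t).2, g * (ζ t).1 - n₀ * F ((ζ t).1)) t)) →
          ∃ Λ : Set (ℝ × ℝ), Λ.Nonempty ∧ IsCompact Λ ∧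
            Λ ⊆ Set.Ioo a 1 ×ˢ Set.Ioi (0:ℝ) ∧
            ψ '' Λ = Λ ∧
            ∃ h : ℝ × ℝ → (ℤ → Fin 2),
              ContinuousOn h Λ ∧ h '' Λ = Set.univ ∧
              (∀ z ∈ Λ, h (ψ z) = fun k => h z (k + 1)) ∧
              (∀ s : ℤ → Fin 2, ∀ ℓ : ℕ, 1 ≤ ℓ → (∀ k : ℤ, s (k + (ℓ : ℤ)) = s k) →
                ∃ z ∈ Λ, h z = s ∧ ψ^[ℓ] z = z) := by
  obtain ⟨hm0, hmD, hmp⟩ := Flow.m0_facts hg hFC1.continuous ha0 ha1 hFpos₂ hconc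
  change 0 < m0star g F a at hm0
  change ∀ x ∈ Icc a 1, 0 ≤ g * x - m0star g F a * F x at hmD
  change (∀ xh, a < xh → xh < 1 → ∃ p, a < p ∧ p < xh ∧ ∀ x, p ≤ x → x < xh →
      0 < g * x - m0star g F a * F x) at hmp
  set m := m0star g F a with hm
  -- truncation
  obtain ⟨K, hlip⟩ := Flow.clamp_lip hFC1 (R := 1) zero_le_one
  set f : ℝ → ℝ := fun x => F (max (-1) (min 1 x)) with hfdef
  have hfF : ∀ x, |x| ≤ 1 → f x = F x := fun x hx => by simp only [hfdef, Flow.clamp_eq hx]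
  have hfF' : ∀ x, 0 ≤ x → x ≤ 1 → f x = F x := fun x h0 h1 => hfF x (by rw [abs_le]; constructor <;> linarith)
  have hN : Flow.Nag f K a := by
    refine ⟨hlip, ha0, ha1, ?_, ?_, ?_, ?_, ?_, ?_⟩
    · rw [hfF' 0 le_rfl zero_le_one, hF0]
    · rw [hfF' a ha0.le ha1.le, hFa]
    · rw [hfF' 1 zero_le_one le_rfl, hF1]
    · intro s h1 h2; rw [hfF' s h1.le (by linarith)]; exact hFneg₁ s h1 h2
    · intro s h1 h2; rw [hfF' s (by linarith) h2.le]; exact hFpos₂ s h1 h2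
    · have : ∫ s in (0:ℝ)..1, f s = ∫ s in (0:ℝ)..1, F s := by
        apply intervalIntegral.integral_congr
        intro s hs
        rw [uIcc_of_le zero_le_one] at hs
        exact hfF' s hs.1 hs.2
      rw [this]; exact hint
  have hfpos : ∀ x, x ≤ 0 → 0 ≤ f x := by
    intro x hx
    simp only [hfdef]
    have h1 : max (-1) (min 1 x) ≤ 0 := max_le (by norm_num) ((min_le_right _ _).trans hx)
    rcases h1.lt_or_eq with h | h
    · exact (hFpos₁ _ h).le
    · rw [h, hF0]
  have hfone : ∀ x, 1 ≤ x → f x = 0 := by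
    intro x hx
    simp only [hfdef]
    rw [min_eq_left hx, max_eq_right (by norm_num), hF1]
  have hFnn : ∀ x ∈ Icc a 1, 0 ≤ F x := by
    intro x hx
    rcases hx.1.eq_or_lt with h | h
    · rw [← h, hFa]
    rcases hx.2.eq_or_lt with h' | h'
    · rw [h', hF1]
    exact (hFpos₂ x h h').le
  obtain ⟨B, hB⟩ := (isCompact_Icc (a := (-1:ℝ)) (b := 1)).exists_bound_of_continuousOn
    hFC1.continuous.continuousOn
  have hfB : ∀ x, |f x| ≤ B := fun x =>
    hB _ ⟨le_max_left _ _, max_le (by norm_num) (min_le_left _ _)⟩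
  have hB0 : 0 ≤ B := (abs_nonneg _).trans (hfB 0)
  obtain ⟨xh, hxa, hx1, hx0⟩ := hN.exists_xh
  obtain ⟨p, hpa, hpx, hpD⟩ := hmp xh hxa hx1
  obtain ⟨xm, q, hpm, hmq, hqx, H⟩ := hN.twist hg hpa hpx hx1 hx0
  obtain ⟨d, hd0, hd⟩ : ∃ d > 0, ∀ x ∈ Icc p q, d ≤ g * x - m * F x := by
    have hc : Continuous (fun x => g * x - m * F x) := by
      have := hFC1.continuous
      fun_prop
    obtain ⟨x0, hx0, hmin⟩ := (isCompact_Icc (a := p) (b := q)).exists_isMinOn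
      ⟨p, le_rfl, by linarith⟩ hc.continuousOn
    exact ⟨_, hpD x0 hx0.1 (lt_of_le_of_lt hx0.2 hqx), fun x hx => hmin hx⟩
  set γ := β - α with hγ
  have hγ0 : 0 < γ := by linarith
  obtain ⟨xp, δ, hδ, hmp', hw, hpδ, hδq, Hn⟩ := H (d * γ^2/2) (by positivity)
  set C := g + m * B with hC
  have hC0 : 0 ≤ C := by positivity
  set Y := C * γ + (xp + δ)/γ with hY
  have hxpδ : 0 < xp + δ := by linarith
  have hY0 : 0 < Y := by
    have : 0 < (xp + δ)/γ := by positivity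
    have : 0 ≤ C * γ := by positivity
    linarith
  obtain ⟨ω, hω⟩ := eventually_atTop.1 (Hn α hα Y hY0)
  refine ⟨max ω (m + 1), lt_of_lt_of_le (by linarith) (le_max_right _ _), ?_⟩
  intro n₀ n₁ hn0 hn0m hn1 ψ hψ
  obtain ⟨hn1p, N, Θ, hΘ, HΘ⟩ := hω n₁ ((le_max_left _ _).trans hn1.le)
  have hGD : ∀ x ∈ Icc a 1, g * x - m * F x ≤ g * x - n₀ * f x := by
    intro x hx
    rw [hfF' x (by linarith [hx.1]) hx.2]
    have := mul_le_mul_of_nonneg_right hn0m.le (hFnn x hx)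
    linarith
  have hG : ∀ x, 0 ≤ x * (g * x - n₀ * f x) := by
    intro x
    rcases le_total x 0 with h | h
    · have h1 := hfpos x h
      have h2 : g * x ≤ 0 := mul_nonpos_of_nonneg_of_nonpos hg.le h
      have h3 : 0 ≤ n₀ * f x := mul_nonneg hn0.le h1
      exact mul_nonneg_of_nonpos_of_nonpos h (by linarith)
    · apply mul_nonneg h
      have h2 : 0 ≤ g * x := mul_nonneg hg.le h
      rcases le_total x a with h' | h'
      · have h3 : f x ≤ 0 := by
          rw [hfF' x h (by linarith)]
          rcases h.eq_or_lt with e | e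
          · rw [← e, hF0]
          rcases h'.eq_or_lt with e' | e'
          · rw [e', hFa]
          exact (hFneg₁ x e e').le
        have := mul_nonpos_of_nonneg_of_nonpos hn0.le h3
        linarith
      · rcases le_total x 1 with h'' | h''
        · exact (hmD x ⟨h', h''⟩).trans (hGD x ⟨h', h''⟩)
        · rw [hfone x h'']; linarith
  have hCb : ∀ x ≤ 1, g * x - n₀ * f x ≤ C := by
    intro x hx
    have h1 : g * x ≤ g * 1 := mul_le_mul_of_nonneg_left hx hg.le
    have h2 := (abs_le.1 (hfB x)).1
    have h3 : n₀ * (-B) ≤ n₀ * f x := mul_le_mul_of_nonneg_left h2 hn0.le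
    have h4 : n₀ * B ≤ m * B := mul_le_mul_of_nonneg_right hn0m.le hB0
    linarith
  have D := Flow.mkData hlip (α := α) (d := d) (C := C) (n0 := n₀) (γ := γ) hΘ hG (by linarith) hd0.le hδ hmp' hγ0
    hY0 (fun x hx => (hd x ⟨by linarith [hx.1], by linarith [hx.2]⟩).trans
      (hGD x ⟨by linarith [hx.1], by linarith [hx.2]⟩)) hw hCb hC0 (by linarith) le_rfl HΘ
  set φ := (Flow.flowH hlip g n₁ α).trans (Flow.flowH hlip g n₀ γ) with hφ
  set Λ := Shoe.inv φ Θ xm xp Y (Real.pi/2) (fun b : Fin 2 => 2 * Real.pi * ((N + (b:ℕ) : ℕ) : ℝ)) with hΛ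
  have hΛreg : ∀ z ∈ Λ, z.1 ∈ Icc xm xp ∧ z.2 ∈ Icc 0 Y := by
    intro z hz
    have := hz 0
    simp only [zpow_zero] at this
    exact this.1
  have hψφ : ∀ z ∈ Λ, ψ z = φ z := by
    intro z hz
    obtain ⟨ζ, hc, hz0, hzβ, hd1, hd2⟩ := hψ z
    obtain ⟨m1, m2⟩ := hΛreg z hz
    have hb1 : ∀ t, |(Flow.flow f g n₁ t z).1| ≤ 1 := by
      intro t
      have := (HΘ z m1 m2).1 t
      rw [abs_le]; constructor <;> linarith [this.1, this.2]
    have e1 := Flow.bridge hFC1 hlip hfF hα (hc.mono (Icc_subset_Icc le_rfl hαβ.le)) hd1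
      (fun u _ => by rw [hz0]; exact hb1 u)
    rw [hz0, sub_zero] at e1
    have e0 : φ z = Flow.flow f g n₀ γ (Flow.flow f g n₁ α z) := rfl
    have hφz : |(Flow.flow f g n₀ γ (Flow.flow f g n₁ α z)).1| ≤ 1 := by
      rw [← e0]
      have := (hΛreg (φ z) (Shoe.inv_map.2 hz)).1
      rw [abs_le]; constructor <;> linarith [this.1, this.2]
    have e2 := Flow.bridge hFC1 hlip hfF hαβ (hc.mono (Icc_subset_Icc hα.le le_rfl)) hd2
      (fun u hu => by rw [e1]; exact Flow.stay hlip hG _ (hb1 α) hφz hu)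
    rw [← hzβ, e2, e1, e0]
  have hmaps : ∀ z ∈ Λ, ψ z ∈ Λ := fun z hz => by rw [hψφ z hz]; exact Shoe.inv_map.2 hz
  have hper : ∀ s : ℤ → Fin 2, ∀ ℓ : ℕ, 1 ≤ ℓ → (∀ k : ℤ, s (k + (ℓ : ℤ)) = s k) →
      ∃ z ∈ Λ, Shoe.itin φ Θ (fun b : Fin 2 => 2 * Real.pi * ((N + (b:ℕ) : ℕ) : ℝ)) z = s ∧ ψ^[ℓ] z = z := by
    intro s ℓ hℓ hs
    obtain ⟨z, hz, h1, h2⟩ := Shoe.exists_per D s ℓ hℓ hs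
    refine ⟨z, hz, h1, ?_⟩
    have hit : ∀ k : ℕ, ψ^[k] z = φ^[k] z ∧ ψ^[k] z ∈ Λ := by
      intro k
      induction k with
      | zero => exact ⟨rfl, hz⟩
      | succ k ih =>
        rw [Function.iterate_succ_apply', Function.iterate_succ_apply', ← ih.1]
        exact ⟨hψφ _ ih.2, hmaps _ ih.2⟩
    rw [(hit ℓ).1]; exact h2
  refine ⟨Λ, ?_, Shoe.inv_compact D, ?_, ?_, Shoe.itin φ Θ _, Shoe.itin_cont D, Shoe.itin_surj D, ?_, hper⟩
  · obtain ⟨z, hz, -⟩ := hper (fun _ => 0) 1 le_rfl (fun _ => rfl)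
    exact ⟨z, hz⟩
  · intro z hz
    have := Shoe.inv_sub D hz
    exact ⟨⟨by linarith [this.1.1], by linarith [this.1.2]⟩, this.2⟩
  · rw [image_congr hψφ]
    exact Shoe.inv_image
  · intro z hz
    rw [hψφ z hz]
    exact Shoe.itin_map z
end

section
/- Let n : [t₀,t₁] → [0,+∞) be a continuous nonnegative function and let F₀ : ℝ → ℝ be locally Lipschitz with F₀(s) > 0 for s < 0, F₀(s) < 0 for s > 1, and F₀(s) = F(s) for all s ∈ [0,1]. Let x : [t₀,t₁] → ℝ be twice continuously differentiable with x''(t) = g x(t) − n(t) F₀(x(t)) for all t ∈ [t₀,t₁], and suppose 0 < x(t₀) < 1 and 0 < x(t₁) < 1. Then 0 < x(t) < 1 for all t ∈ [t₀,t₁] (so that x is in fact a solution of x'' − g x + n(t) F(x) = 0). -/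
open Set

/-- At an interior local maximum the second derivative is not positive. -/
lemma no_pos_second_deriv {f f' : ℝ → ℝ} {c A B t : ℝ} (ht : t ∈ Set.Ioo A B)
    (h1 : ∀ s ∈ Set.Icc A B, HasDerivWithinAt f (f' s) (Set.Icc A B) s)
    (h2 : HasDerivWithinAt f' c (Set.Icc A B) t)
    (hmax : IsLocalMax f t) : c ≤ 0 := by
  by_contra! hc
  have hn : Set.Ioo A B ∈ nhds t := Ioo_mem_nhds ht.1 ht.2
  have e : deriv f =ᶠ[nhds t] f' := by
    filter_upwards [hn] with s hs
    exact ((h1 s (Set.Ioo_subset_Icc_self hs)).hasDerivAt (Icc_mem_nhds hs.1 hs.2)).deriv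
  have d2 : deriv (deriv f) t = c := by
    rw [e.deriv_eq]
    exact (h2.hasDerivAt (Icc_mem_nhds ht.1 ht.2)).deriv
  have hcont : ContinuousAt f t :=
    ((h1 t (Set.Ioo_subset_Icc_self ht)).hasDerivAt (Icc_mem_nhds ht.1 ht.2)).continuousAt
  have hmin : IsLocalMin f t :=
    isLocalMin_of_deriv_deriv_pos (by rw [d2]; exact hc) hmax.deriv_eq_zero hcont
  have hconst : f =ᶠ[nhds t] fun _ => f t := by
    filter_upwards [hmin, hmax] with s a b
    exact le_antisymm b a
  have := hconst.deriv.deriv_eq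
  simp at this
  linarith

/-- Lemma 3.0: a solution of `x'' = g x - n(t) F₀(x)` which starts and ends in `(0,1)`
remains in `(0,1)`. -/
theorem solution_stays_in_unit_interval
    (g : ℝ) (hg : 0 < g)
    (t₀ t₁ : ℝ) (ht : t₀ < t₁)
    (F : ℝ → ℝ) (hFC1 : ContDiff ℝ 1 F)
    (a : ℝ) (ha0 : 0 < a) (ha1 : a < 1)
    (hF0 : F 0 = 0) (hFa : F a = 0) (hF1 : F 1 = 0)
    (hFneg₁ : ∀ s, 0 < s → s < a → F s < 0)
    (hFneg₂ : ∀ s, 1 < s → F s < 0)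
    (hFpos₁ : ∀ s, s < 0 → 0 < F s)
    (hFpos₂ : ∀ s, a < s → s < 1 → 0 < F s)
    (n : ℝ → ℝ)
    (hn_cont : ContinuousOn n (Set.Icc t₀ t₁))
    (hn_nonneg : ∀ t ∈ Set.Icc t₀ t₁, 0 ≤ n t)
    (F₀ : ℝ → ℝ) (hF₀lip : LocallyLipschitz F₀)
    (hF₀pos : ∀ s, s < 0 → 0 < F₀ s)
    (hF₀neg : ∀ s, 1 < s → F₀ s < 0)
    (hF₀eq : ∀ s ∈ Set.Icc (0:ℝ) 1, F₀ s = F s)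
    (x x' x'' : ℝ → ℝ)
    (hx' : ∀ t ∈ Set.Icc t₀ t₁, HasDerivWithinAt x (x' t) (Set.Icc t₀ t₁) t)
    (hx'' : ∀ t ∈ Set.Icc t₀ t₁, HasDerivWithinAt x' (x'' t) (Set.Icc t₀ t₁) t)
    (hx''cont : ContinuousOn x'' (Set.Icc t₀ t₁))
    (heq : ∀ t ∈ Set.Icc t₀ t₁, x'' t = g * x t - n t * F₀ (x t))
    (hxt₀ : x t₀ ∈ Set.Ioo (0:ℝ) 1)
    (hxt₁ : x t₁ ∈ Set.Ioo (0:ℝ) 1) :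
    ∀ t ∈ Set.Icc t₀ t₁, x t ∈ Set.Ioo (0:ℝ) 1 := by
  have hxc : ContinuousOn x (Set.Icc t₀ t₁) := fun t h => (hx' t h).continuousWithinAt
  have hx'c : ContinuousOn x' (Set.Icc t₀ t₁) := fun t h => (hx'' t h).continuousWithinAt
  have hne : (Set.Icc t₀ t₁).Nonempty := Set.nonempty_Icc.2 ht.le
  have interior : ∀ t ∈ Set.Icc t₀ t₁, x t ∉ Set.Ioo (0:ℝ) 1 → t ∈ Set.Ioo t₀ t₁ := by
    intro t h hno
    refine ⟨lt_of_le_of_ne h.1 ?_, lt_of_le_of_ne h.2 ?_⟩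
    · rintro rfl; exact hno hxt₀
    · rintro rfl; exact hno hxt₁
  have h00 : F₀ 0 = 0 := by rw [hF₀eq 0 (by simp), hF0]
  have h01 : F₀ 1 = 0 := by rw [hF₀eq 1 (by simp), hF1]
  -- upper bound
  have hup : ∀ t ∈ Set.Icc t₀ t₁, x t < 1 := by
    obtain ⟨m, hm, hmax⟩ := isCompact_Icc.exists_isMaxOn hne hxc
    have key : x m < 1 := by
      by_contra! h
      have hi := interior m hm (fun h' => absurd h'.2 (not_lt.2 h))
      have := no_pos_second_deriv hi hx' (hx'' m hm)
        (hmax.isLocalMax (Icc_mem_nhds hi.1 hi.2))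
      rw [heq m hm] at this
      have hF : F₀ (x m) ≤ 0 := by
        rcases h.eq_or_lt with h | h
        · rw [← h, h01]
        · exact (hF₀neg _ h).le
      have := mul_nonpos_of_nonneg_of_nonpos (hn_nonneg m hm) hF
      have : 0 < g * x m := mul_pos hg (by linarith)
      linarith
    exact fun t h => (hmax h).trans_lt key
  obtain ⟨m, hm, hmin⟩ := isCompact_Icc.exists_isMinOn hne hxc
  have hlow : 0 ≤ x m := by
    by_contra! h
    have hi := interior m hm (fun h' => absurd h'.1 (not_lt.2 h.le))
    have := no_pos_second_deriv (f := fun t => - x t) (f' := fun t => - x' t) hi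
      (fun s hs => (hx' s hs).fun_neg) (hx'' m hm).fun_neg
      (hmin.isLocalMin (Icc_mem_nhds hi.1 hi.2)).neg
    rw [heq m hm] at this
    have := mul_nonneg (hn_nonneg m hm) (hF₀pos _ h).le
    have : g * x m < 0 := mul_neg_of_pos_of_neg hg h
    linarith
  have hnn : ∀ t ∈ Set.Icc t₀ t₁, 0 ≤ x t := fun t h => hlow.trans (hmin h)
  have hpos : 0 < x m := by
    by_contra! h
    have hxm : x m = 0 := le_antisymm h hlow
    have hi := interior m hm (fun h' => absurd h'.1 (not_lt.2 h))
    have hx'm : x' m = 0 :=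
      (hmin.isLocalMin (Icc_mem_nhds hi.1 hi.2)).hasDerivAt_eq_zero
        ((hx' m hm).hasDerivAt (Icc_mem_nhds hi.1 hi.2))
    obtain ⟨L, hL⟩ := (hF₀lip.locallyLipschitzOn (s := Set.Icc (0:ℝ) 1)).exists_lipschitzOnWith_of_compact
      isCompact_Icc
    obtain ⟨N, hN⟩ := isCompact_Icc.exists_bound_of_continuousOn hn_cont
    have hN0 : 0 ≤ N := (norm_nonneg _).trans (hN m hm)
    have sub : Set.Icc m t₁ ⊆ Set.Icc t₀ t₁ := Set.Icc_subset_Icc_left hm.1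
    have hz := eq_zero_of_abs_deriv_le_mul_abs_self_of_eq_zero_right
      (f := fun t => (x t, x' t)) (f' := fun t => (x' t, x'' t)) (K := 1 + (g + N * L))
      (a := m) (b := t₁) ((hxc.mono sub).prodMk (hx'c.mono sub)) ?_ ?_ ?_ t₁ ⟨hm.2, le_rfl⟩
    · have : x t₁ = 0 := congrArg Prod.fst hz
      linarith [hxt₁.1]
    · intro t htt
      have hmem : t ∈ Set.Icc t₀ t₁ := sub ⟨htt.1, htt.2.le⟩
      have hnb : Set.Icc t₀ t₁ ∈ nhdsWithin t (Set.Ici t) :=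
        Filter.mem_of_superset (Icc_mem_nhdsGE htt.2) (Set.Icc_subset_Icc_left hmem.1)
      exact ((hx' t hmem).mono_of_mem_nhdsWithin hnb).prodMk
        ((hx'' t hmem).mono_of_mem_nhdsWithin hnb)
    · simp [hxm, hx'm]
    · intro t htt
      have hmem : t ∈ Set.Icc t₀ t₁ := sub ⟨htt.1, htt.2.le⟩
      have hK : 0 ≤ g + N * L := by positivity
      have hFx : |F₀ (x t)| ≤ L * |x t| := by
        have := hL.dist_le_mul (x t) ⟨hnn t hmem, (hup t hmem).le⟩ 0 (by simp)
        simpa [h00, Real.dist_eq] using this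
      have hb : |x'' t| ≤ (g + N * L) * |x t| := by
        rw [heq t hmem]
        calc |g * x t - n t * F₀ (x t)| ≤ |g * x t| + |n t * F₀ (x t)| := abs_sub _ _
          _ = g * |x t| + |n t| * |F₀ (x t)| := by rw [abs_mul, abs_mul, abs_of_pos hg]
          _ ≤ g * |x t| + N * (L * |x t|) := by
              gcongr
              exact hN t hmem
          _ = _ := by ring
      have n1 : |x t| ≤ ‖(x t, x' t)‖ := norm_fst_le (x t, x' t)
      have n2 : |x' t| ≤ ‖(x t, x' t)‖ := norm_snd_le (x t, x' t)
      have n0 := norm_nonneg (x t, x' t)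
      have p1 := mul_le_mul_of_nonneg_left n1 hK
      have p2 := mul_nonneg hK n0
      refine (Prod.norm_mk _ _).trans_le (max_le ?_ ?_)
      · rw [Real.norm_eq_abs]; linarith
      · rw [Real.norm_eq_abs]; linarith
  exact fun t h => ⟨hpos.trans_le (hmin h), hup t h⟩
end

section
/- Let h : [t₀,t₁] × ℝ → ℝ be continuous with h(t,0) = 0 for all t ∈ [t₀,t₁], h(t,s) > 0 for all t ∈ [t₀,t₁] and all s < 0, and h(t,s) < 0 for all t ∈ [t₀,t₁] and all s ≥ 1. Let x : [t₀,t₁] → ℝ be twice continuously differentiable with x''(t) + h(t, x(t)) = 0 for all t ∈ [t₀,t₁], and suppose 0 < x(t₀) < 1 and 0 < x(t₁) < 1. Then 0 ≤ x(t) ≤ 1 for all t ∈ [t₀,t₁]. -/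
open Set

theorem no_interior_max (a b : ℝ) (x x' x'' : ℝ → ℝ)
    (hx' : ∀ t ∈ Set.Icc a b, HasDerivWithinAt x (x' t) (Set.Icc a b) t)
    (hx'' : ∀ t ∈ Set.Icc a b, HasDerivWithinAt x' (x'' t) (Set.Icc a b) t)
    (c : ℝ) (hc : c ∈ Set.Ioo a b) (hmax : IsMaxOn x (Set.Icc a b) c) (hp : 0 < x'' c) : False := by
  have hcn : Set.Icc a b ∈ nhds c := Icc_mem_nhds hc.1 hc.2
  have hd : ∀ t ∈ Set.Ioo a b, HasDerivAt x (x' t) t := fun t ht =>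
    (hx' t (Ioo_subset_Icc_self ht)).hasDerivAt (Icc_mem_nhds ht.1 ht.2)
  have hd2 : HasDerivAt x' (x'' c) c := (hx'' c (Ioo_subset_Icc_self hc)).hasDerivAt hcn
  have hev : deriv x =ᶠ[nhds c] x' := by
    filter_upwards [Ioo_mem_nhds hc.1 hc.2] with t ht using (hd t ht).deriv
  have hdd : deriv (deriv x) c = x'' c := by rw [hev.deriv_eq, hd2.deriv]
  have hlm : IsLocalMax x c := hmax.isLocalMax hcn
  have hmin : IsLocalMin x c :=
    isLocalMin_of_deriv_deriv_pos (by rw [hdd]; exact hp) hlm.deriv_eq_zero (hd c hc).continuousAt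
  have he : x =ᶠ[nhds c] fun _ => x c := by
    filter_upwards [hlm, hmin] with t h1 h2 using le_antisymm h1 h2
  have h0 : deriv (deriv x) c = 0 := by
    rw [he.deriv.deriv_eq]; simp
  linarith

/-- Lemma 5.1 (first part): a solution of `x'' + h(t,x) = 0` that starts and ends in
`(0,1)` remains in `[0,1]`. -/
theorem solution_stays_in_closed_unit_interval
    (t₀ t₁ : ℝ) (ht : t₀ < t₁)
    (h : ℝ → ℝ → ℝ)
    (hcont : ContinuousOn (fun p : ℝ × ℝ => h p.1 p.2) (Set.Icc t₀ t₁ ×ˢ (Set.univ : Set ℝ)))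
    (h0 : ∀ t ∈ Set.Icc t₀ t₁, h t 0 = 0)
    (hpos : ∀ t ∈ Set.Icc t₀ t₁, ∀ s : ℝ, s < 0 → 0 < h t s)
    (hneg : ∀ t ∈ Set.Icc t₀ t₁, ∀ s : ℝ, 1 ≤ s → h t s < 0)
    (x x' x'' : ℝ → ℝ)
    (hx' : ∀ t ∈ Set.Icc t₀ t₁, HasDerivWithinAt x (x' t) (Set.Icc t₀ t₁) t)
    (hx'' : ∀ t ∈ Set.Icc t₀ t₁, HasDerivWithinAt x' (x'' t) (Set.Icc t₀ t₁) t)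
    (hx''cont : ContinuousOn x'' (Set.Icc t₀ t₁))
    (heq : ∀ t ∈ Set.Icc t₀ t₁, x'' t + h t (x t) = 0)
    (hxt₀ : x t₀ ∈ Set.Ioo (0:ℝ) 1)
    (hxt₁ : x t₁ ∈ Set.Ioo (0:ℝ) 1) :
    ∀ t ∈ Set.Icc t₀ t₁, x t ∈ Set.Icc (0:ℝ) 1 := by
  have hxc : ContinuousOn x (Set.Icc t₀ t₁) := fun t ht => (hx' t ht).continuousWithinAt
  have hne : (Set.Icc t₀ t₁).Nonempty := ⟨t₀, left_mem_Icc.2 ht.le⟩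
  have hio : ∀ c ∈ Set.Icc t₀ t₁, x c ∉ Set.Ioo (0:ℝ) 1 → c ∈ Set.Ioo t₀ t₁ := by
    intro c hc hn
    refine ⟨lt_of_le_of_ne hc.1 ?_, lt_of_le_of_ne hc.2 ?_⟩
    · rintro rfl
      exact hn hxt₀
    · rintro rfl
      exact hn hxt₁
  intro t htm
  constructor
  · by_contra! hlt
    obtain ⟨c, hc, hmin⟩ := isCompact_Icc.exists_isMinOn hne hxc
    have h1 : x c < 0 := lt_of_le_of_lt (hmin htm) hlt
    refine no_interior_max t₀ t₁ (fun t => - x t) (fun t => - x' t) (fun t => - x'' t)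
      (fun t ht => (hx' t ht).neg) (fun t ht => (hx'' t ht).neg) c
      (hio c hc fun hh => by linarith [hh.1]) hmin.neg ?_
    have := hpos c hc _ h1
    have := heq c hc
    show 0 < - x'' c
    linarith
  · by_contra! hlt
    obtain ⟨c, hc, hmax⟩ := isCompact_Icc.exists_isMaxOn hne hxc
    have h1 : 1 < x c := lt_of_lt_of_le hlt (hmax htm)
    refine no_interior_max t₀ t₁ x x' x'' hx' hx'' c
      (hio c hc fun hh => by linarith [hh.2]) hmax ?_
    have := hneg c hc _ h1.le
    have := heq c hc
    linarith
end

section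
/- Let h : [t₀,t₁] × ℝ → ℝ be continuous with h(t,0) = 0 for all t ∈ [t₀,t₁], h(t,s) > 0 for all t ∈ [t₀,t₁] and all s < 0, and h(t,s) < 0 for all t ∈ [t₀,t₁] and all s ≥ 1. Let x : [t₀,t₁] → ℝ be twice continuously differentiable with x''(t) + h(t, x(t)) = 0 for all t ∈ [t₀,t₁], and suppose 0 < x(t₀) < 1 and 0 < x(t₁) < 1. If in addition h is Lipschitz in its second variable, uniformly in t, in a neighborhood of s = 0 (there exist ε, L > 0 with |h(t,s) − h(t,s')| ≤ L|s − s'| for all t ∈ [t₀,t₁] and all s, s' ∈ [−ε,ε]), then x(t) > 0 for all t ∈ [t₀,t₁]; if h is Lipschitz in its second variable, uniformly in t, in a neighborhood of s = 1, then x(t) < 1 for all t ∈ [t₀,t₁]. -/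
open Set

lemma aux_crit {a b c : ℝ} {y y' : ℝ → ℝ} (hc : c ∈ Ioo a b)
    (hy : ∀ t ∈ Icc a b, HasDerivWithinAt y (y' t) (Icc a b) t)
    (hmax : ∀ t ∈ Icc a b, y t ≤ y c) : y' c = 0 := by
  have hn : Icc a b ∈ nhds c := Icc_mem_nhds hc.1 hc.2
  have h1 : IsLocalMax y c := by
    filter_upwards [hn] with t ht using hmax t ht
  exact h1.hasDerivAt_eq_zero ((hy c (Ioo_subset_Icc_self hc)).hasDerivAt hn)

lemma aux_nomax {a b c d : ℝ} {y y' : ℝ → ℝ} (hc : c ∈ Ioo a b)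
    (hy : ∀ t ∈ Icc a b, HasDerivWithinAt y (y' t) (Icc a b) t)
    (hy' : HasDerivWithinAt y' d (Icc a b) c) (hd : 0 < d)
    (hmax : ∀ t ∈ Icc a b, y t ≤ y c) : False := by
  have hn : Icc a b ∈ nhds c := Icc_mem_nhds hc.1 hc.2
  have h0 := aux_crit hc hy hmax
  have h2 := (hy'.hasDerivAt hn)
  have h3 : ∀ᶠ t in nhdsWithin c (Ioi c), 0 < slope y' c t :=
    (h2.tendsto_slope.eventually (lt_mem_nhds hd)).filter_mono
      (nhdsWithin_mono _ (fun t (ht : c < t) => ne_of_gt ht))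
  obtain ⟨u, hu, hu'⟩ := (mem_nhdsGT_iff_exists_Ioo_subset).1 h3
  have hu : c < u := hu
  set e := min u b with he
  have hce : c < e := lt_min hu hc.2
  have hsub : Icc c e ⊆ Icc a b := fun t ht => ⟨hc.1.le.trans ht.1, ht.2.trans (min_le_right _ _)⟩
  have hm : StrictMonoOn y (Icc c e) := by
    apply strictMonoOn_of_deriv_pos (convex_Icc _ _)
    · exact fun t ht => ((hy t (hsub ht)).continuousWithinAt).mono hsub
    · intro t ht
      rw [interior_Icc] at ht
      have hb : t < b := ht.2.trans_le (min_le_right _ _)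
      rw [((hy t (hsub (Ioo_subset_Icc_self ht))).hasDerivAt
        (Icc_mem_nhds (hc.1.trans ht.1) hb)).deriv]
      have := hu' (show t ∈ Ioo c u from ⟨ht.1, ht.2.trans_le (min_le_left _ _)⟩)
      simp only [mem_setOf_eq, slope_def_field, h0, sub_zero] at this
      have h5 : 0 < t - c := sub_pos.2 ht.1
      exact (div_pos_iff_of_pos_right h5).1 this
  have := hm (left_mem_Icc.2 hce.le) (right_mem_Icc.2 hce.le) hce
  exact absurd (hmax e (hsub (right_mem_Icc.2 hce.le))) (not_le.2 this)

/-- Lemma 5.1 (second part): under local Lipschitz conditions at `s = 0` (resp. `s = 1`),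
the solution satisfies the strict bounds `x(t) > 0` (resp. `x(t) < 1`). -/
theorem solution_strict_bounds
    (t₀ t₁ : ℝ) (ht : t₀ < t₁)
    (h : ℝ → ℝ → ℝ)
    (hcont : ContinuousOn (fun p : ℝ × ℝ => h p.1 p.2) (Set.Icc t₀ t₁ ×ˢ (Set.univ : Set ℝ)))
    (h0 : ∀ t ∈ Set.Icc t₀ t₁, h t 0 = 0)
    (hpos : ∀ t ∈ Set.Icc t₀ t₁, ∀ s : ℝ, s < 0 → 0 < h t s)
    (hneg : ∀ t ∈ Set.Icc t₀ t₁, ∀ s : ℝ, 1 ≤ s → h t s < 0)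
    (x x' x'' : ℝ → ℝ)
    (hx' : ∀ t ∈ Set.Icc t₀ t₁, HasDerivWithinAt x (x' t) (Set.Icc t₀ t₁) t)
    (hx'' : ∀ t ∈ Set.Icc t₀ t₁, HasDerivWithinAt x' (x'' t) (Set.Icc t₀ t₁) t)
    (hx''cont : ContinuousOn x'' (Set.Icc t₀ t₁))
    (heq : ∀ t ∈ Set.Icc t₀ t₁, x'' t + h t (x t) = 0)
    (hxt₀ : x t₀ ∈ Set.Ioo (0:ℝ) 1)
    (hxt₁ : x t₁ ∈ Set.Ioo (0:ℝ) 1) :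
    ((∃ ε L : ℝ, 0 < ε ∧ 0 < L ∧
        ∀ t ∈ Set.Icc t₀ t₁, ∀ s ∈ Set.Icc (-ε) ε, ∀ s' ∈ Set.Icc (-ε) ε,
          |h t s - h t s'| ≤ L * |s - s'|) →
      ∀ t ∈ Set.Icc t₀ t₁, 0 < x t) ∧
    ((∃ ε L : ℝ, 0 < ε ∧ 0 < L ∧
        ∀ t ∈ Set.Icc t₀ t₁, ∀ s ∈ Set.Icc (1 - ε) (1 + ε), ∀ s' ∈ Set.Icc (1 - ε) (1 + ε),
          |h t s - h t s'| ≤ L * |s - s'|) →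
      ∀ t ∈ Set.Icc t₀ t₁, x t < 1) := by
  have hxc : ContinuousOn x (Icc t₀ t₁) := fun t h => (hx' t h).continuousWithinAt
  have hne : (Icc t₀ t₁).Nonempty := nonempty_Icc.2 ht.le
  constructor
  · rintro ⟨ε, L, hε, hL, hlip⟩
    obtain ⟨c, hcI, hcmin⟩ := isCompact_Icc.exists_isMinOn hne hxc
    have hnn : ∀ t ∈ Icc t₀ t₁, 0 ≤ x t := by
      by_contra! hcon
      obtain ⟨t, htI, htn⟩ := hcon
      have hxcn : x c < 0 := lt_of_le_of_lt (hcmin htI) htn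
      have hc : c ∈ Ioo t₀ t₁ := by
        refine ⟨lt_of_le_of_ne hcI.1 ?_, lt_of_le_of_ne hcI.2 ?_⟩
        · rintro rfl; linarith [hxt₀.1]
        · rintro rfl; linarith [hxt₁.1]
      have h1 := heq c hcI
      have h2 := hpos c hcI _ hxcn
      exact aux_nomax (y := fun t => - x t) (y' := fun t => - x' t) (d := - x'' c) hc
        (fun t h => (hx' t h).neg) (hx'' c hcI).neg (by linarith)
        (fun t h => neg_le_neg (hcmin h))
    by_contra! hcon
    obtain ⟨t, htI, htn⟩ := hcon
    have hZ : IsCompact (Icc t₀ t₁ ∩ x ⁻¹' {0}) :=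
      isCompact_Icc.of_isClosed_subset
        (hxc.preimage_isClosed_of_isClosed isClosed_Icc isClosed_singleton) inter_subset_left
    obtain ⟨τ, ⟨hτI, hτ0⟩, hτmax⟩ :=
      hZ.exists_isGreatest ⟨t, htI, le_antisymm htn (hnn t htI)⟩
    have hτ0 : x τ = 0 := hτ0
    have hτ : τ ∈ Ioo t₀ t₁ := by
      refine ⟨lt_of_le_of_ne hτI.1 ?_, lt_of_le_of_ne hτI.2 ?_⟩
      · rintro rfl; linarith [hxt₀.1]
      · rintro rfl; linarith [hxt₁.1]
    have hd0 : x' τ = 0 := by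
      have := aux_crit (y := fun t => - x t) (y' := fun t => - x' t) hτ
        (fun t h => (hx' t h).neg) (fun t h => by simpa [hτ0] using hnn t h)
      simpa using this
    have hev : ∀ᶠ t in nhds τ, x t < ε ∧ t < t₁ := by
      refine Filter.Eventually.and ?_ (gt_mem_nhds hτ.2)
      exact ((hxc τ hτI).continuousAt (Icc_mem_nhds hτ.1 hτ.2)).eventually
        (gt_mem_nhds (by rw [hτ0]; exact hε))
    obtain ⟨r, hr, hball⟩ := Metric.eventually_nhds_iff.1 hev
    set u := τ + r / 2 with hu
    have hloc : ∀ t ∈ Icc τ u, x t < ε ∧ t < t₁ := by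
      intro t ht
      apply hball
      rw [Real.dist_eq, abs_lt]
      constructor <;> linarith [ht.1, ht.2]
    have hsub : ∀ t ∈ Icc τ u, t ∈ Icc t₀ t₁ := fun t ht =>
      ⟨hτ.1.le.trans ht.1, (hloc t ht).2.le⟩
    have hright : ∀ t ∈ Ico τ u, ∀ f : ℝ → ℝ, ∀ f',
        HasDerivWithinAt f f' (Icc t₀ t₁) t → HasDerivWithinAt f f' (Ici t) t := by
      intro t ht f f' hf
      have h1 := hloc t ⟨ht.1, ht.2.le⟩
      exact (hf.hasDerivAt (Icc_mem_nhds (hτ.1.trans_le ht.1) h1.2)).hasDerivWithinAt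
    have hg := norm_le_gronwallBound_of_norm_deriv_right_le
      (f := fun t => (x t, x' t)) (f' := fun t => (x' t, x'' t)) (δ := 0) (K := max 1 L) (ε := 0)
      (a := τ) (b := u)
      (by
        apply ContinuousOn.prodMk
        · exact hxc.mono hsub
        · exact fun t h => ((hx'' t (hsub t h)).continuousWithinAt).mono hsub)
      (fun t h => (hright t h _ _ (hx' t (hsub t ⟨h.1, h.2.le⟩))).prodMk
        (hright t h _ _ (hx'' t (hsub t ⟨h.1, h.2.le⟩))))
      (by simp [hτ0, hd0])
      (by
        intro t hh
        have hI := hsub t ⟨hh.1, hh.2.le⟩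
        have h1 := hlip t hI (x t) ⟨by linarith [hnn t hI], (hloc t ⟨hh.1, hh.2.le⟩).1.le⟩ 0
          ⟨by linarith, hε.le⟩
        rw [h0 t hI, sub_zero, sub_zero] at h1
        have h2 : x'' t = - h t (x t) := by linarith [heq t hI]
        rw [add_zero]
        apply max_le
        · calc ‖x' t‖ = 1 * ‖x' t‖ := (one_mul _).symm
            _ ≤ _ := mul_le_mul (le_max_left _ _) (le_max_right _ _) (norm_nonneg _) (by positivity)
        · calc ‖x'' t‖ ≤ L * ‖x t‖ := by rw [h2, norm_neg]; exact h1
            _ ≤ _ := mul_le_mul (le_max_right _ _) (le_max_left _ _) (norm_nonneg _) (by positivity))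
      u ⟨by linarith, le_rfl⟩
    rw [gronwallBound_ε0_δ0] at hg
    have h3 : (x u, x' u) = 0 := norm_le_zero_iff.1 hg
    have h4 : x u = 0 := congrArg Prod.fst h3
    have h5 : u ≤ τ := hτmax ⟨hsub u ⟨by linarith, le_rfl⟩, h4⟩
    linarith
  · rintro -
    by_contra! hcon
    obtain ⟨t, htI, htn⟩ := hcon
    obtain ⟨c, hcI, hcmax⟩ := isCompact_Icc.exists_isMaxOn hne hxc
    have hxcn : 1 ≤ x c := htn.trans (hcmax htI)
    have hc : c ∈ Ioo t₀ t₁ := by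
      refine ⟨lt_of_le_of_ne hcI.1 ?_, lt_of_le_of_ne hcI.2 ?_⟩
      · rintro rfl; linarith [hxt₀.2]
      · rintro rfl; linarith [hxt₁.2]
    have h1 := heq c hcI
    have h2 := hneg c hcI _ hxcn
    exact aux_nomax hc hx' (hx'' c hcI) (by linarith) (fun t h => hcmax h)
end

section
/- Assume F is strictly concave on [a,1]. Then for every μ > m₀* there exist a_μ and c_μ with a < a_μ < c_μ < 1 such that g a_μ = μ F(a_μ), g c_μ = μ F(c_μ), g s − μ F(s) > 0 for every s ∈ (0, a_μ) ∪ (c_μ, +∞), and g s − μ F(s) < 0 for every s ∈ (a_μ, c_μ). In particular a_μ and c_μ are the only zeros of s ↦ g s − μ F(s) in (0,+∞). -/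
open Set

/-- For `μ > m₀*` the map `s ↦ g s - μ F(s)` has exactly two positive zeros
`a < a_μ < c_μ < 1`, being positive on `(0,a_μ) ∪ (c_μ,∞)` and negative on `(a_μ,c_μ)`. -/
theorem two_equilibria_above_m0star
    (g : ℝ) (hg : 0 < g)
    (F : ℝ → ℝ) (hFC1 : ContDiff ℝ 1 F)
    (a : ℝ) (ha0 : 0 < a) (ha1 : a < 1)
    (hF0 : F 0 = 0) (hFa : F a = 0) (hF1 : F 1 = 0)
    (hFneg₁ : ∀ s, 0 < s → s < a → F s < 0)
    (hFneg₂ : ∀ s, 1 < s → F s < 0)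
    (hFpos₁ : ∀ s, s < 0 → 0 < F s)
    (hFpos₂ : ∀ s, a < s → s < 1 → 0 < F s)
    (hconc : StrictConcaveOn ℝ (Set.Icc a 1) F)
    (μ : ℝ) (hμ : m0star g F a < μ) :
    ∃ aμ cμ : ℝ, a < aμ ∧ aμ < cμ ∧ cμ < 1 ∧
      g * aμ = μ * F aμ ∧ g * cμ = μ * F cμ ∧
      (∀ s ∈ Set.Ioo 0 aμ ∪ Set.Ioi cμ, 0 < g * s - μ * F s) ∧
      (∀ s ∈ Set.Ioo aμ cμ, g * s - μ * F s < 0) := by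
  have hcF : Continuous F := hFC1.continuous
  have hcq : ContinuousOn (fun s => F s / s) (Set.Icc a 1) :=
    hcF.continuousOn.div continuousOn_id (fun x hx => (lt_of_lt_of_le ha0 hx.1).ne')
  obtain ⟨b, hb, hbM, -⟩ := isCompact_Icc.exists_sSup_image_eq_and_ge
    (Set.nonempty_Icc.mpr ha1.le) hcq
  have hbdd : BddAbove ((fun s => F s / s) '' Set.Icc a 1) :=
    (isCompact_Icc.image_of_continuousOn hcq).bddAbove
  have hM : 0 < F b / b := by
    have hm : (a + 1) / 2 ∈ Set.Icc a 1 := ⟨by linarith, by linarith⟩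
    have h1 := le_csSup hbdd (Set.mem_image_of_mem (fun s => F s / s) hm)
    rw [hbM] at h1
    refine lt_of_lt_of_le ?_ h1
    exact div_pos (hFpos₂ _ (by linarith) (by linarith)) (by linarith)
  have hb0 : 0 < b := lt_of_lt_of_le ha0 hb.1
  have hFb : 0 < F b := by
    have := mul_pos hM hb0
    rwa [div_mul_cancel₀ _ hb0.ne'] at this
  have hab : a < b := lt_of_le_of_ne hb.1 (by rintro rfl; linarith)
  have hb1 : b < 1 := lt_of_le_of_ne hb.2 (by rintro rfl; linarith)
  unfold m0star at hμ
  rw [hbM] at hμ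
  have hμ0 : 0 < μ := (div_pos hg hM).trans hμ
  have hhb : g * b - μ * F b < 0 := by
    rw [div_lt_iff₀ hM, ← mul_div_assoc, lt_div_iff₀ hb0] at hμ
    linarith
  obtain ⟨h, hh⟩ : ∃ h : ℝ → ℝ, ∀ s, h s = g * s - μ * F s := ⟨_, fun _ => rfl⟩
  have hch : Continuous h := by
    have : h = fun s => g * s - μ * F s := funext hh
    rw [this]; fun_prop
  have key : ∀ x y z, a ≤ x → z ≤ 1 → x < y → y < z →
      h y * (z - x) < (z - y) * h x + (y - x) * h z := by
    intro x y z hx hz hxy hyz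
    have h1 := hconc.slope_anti_adjacent (x := x) (y := y) (z := z)
      ⟨hx, by linarith⟩ ⟨by linarith, hz⟩ hxy hyz
    rw [div_lt_div_iff₀ (by linarith) (by linarith)] at h1
    have h2 := mul_lt_mul_of_pos_left h1 hμ0
    rw [hh, hh, hh]
    linarith
  rw [← hh] at hhb
  have hha : 0 < h a := by rw [hh, hFa]; nlinarith
  have hh1 : 0 < h 1 := by rw [hh, hF1]; linarith
  obtain ⟨p, ⟨hap, hpb⟩, hp⟩ := intermediate_value_Ioo' hab.le hch.continuousOn
    (show (0 : ℝ) ∈ Set.Ioo (h b) (h a) from ⟨hhb, hha⟩)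
  obtain ⟨q, ⟨hbq, hq1⟩, hq⟩ := intermediate_value_Ioo hb1.le hch.continuousOn
    (show (0 : ℝ) ∈ Set.Ioo (h b) (h 1) from ⟨hhb, hh1⟩)
  refine ⟨p, q, hap, hpb.trans hbq, hq1, ?_, ?_, ?_, ?_⟩
  · rw [hh] at hp; linarith
  · rw [hh] at hq; linarith
  · rintro s (⟨hs0, hsp⟩ | hsq)
    · rcases lt_or_ge s a with hsa | hsa
      · have := mul_pos hμ0 (neg_pos.mpr (hFneg₁ s hs0 hsa))
        have := mul_pos hg hs0
        linarith
      · rw [← hh]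
        have k := key s p b hsa hb1.le hsp hpb
        rw [hp, zero_mul] at k
        have := mul_pos (sub_pos.mpr hsp) (neg_pos.mpr hhb)
        exact pos_of_mul_pos_right (a := b - p) (by linarith) (by linarith)
    · have hsq : q < s := hsq
      rcases lt_or_ge 1 s with hs1 | hs1
      · have := mul_pos hμ0 (neg_pos.mpr (hFneg₂ s hs1))
        have := mul_pos hg (show 0 < s by linarith)
        linarith
      · rw [← hh]
        have k := key b q s hab.le hs1 hbq hsq
        rw [hq, zero_mul] at k
        have := mul_pos (sub_pos.mpr hsq) (neg_pos.mpr hhb)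
        exact pos_of_mul_pos_right (a := q - b) (by linarith) (by linarith)
  · rintro s ⟨hps, hsq⟩
    rw [← hh]
    have k := key p s q hap.le hq1.le hps hsq
    rw [hp, hq] at k
    by_contra hc
    have := mul_nonneg (not_lt.mp hc) (show 0 ≤ q - p by linarith)
    linarith
end

section
/- For every ε with 0 < ε < (1−a)/2 there exists M ≥ m₀* such that for every μ ≥ M: (i) every s ∈ (a,1) with g s = μ F(s) satisfies s < a + ε or s > 1 − ε; and (ii) there exist s ∈ (a, a+ε) and s' ∈ (1−ε, 1) with g s = μ F(s) and g s' = μ F(s'). (Thus, denoting by a_μ < c_μ the smallest and largest zeros of g s − μ F(s) in (a,1), one has a_μ → a⁺ and c_μ → 1⁻ as μ → +∞.) -/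
open Set

/-- As `μ → +∞`, the zeros of `g s - μ F(s)` in `(a,1)` accumulate near `a` and `1`:
`a_μ → a⁺` and `c_μ → 1⁻`. -/
theorem equilibria_tend_to_endpoints
    (g : ℝ) (hg : 0 < g)
    (F : ℝ → ℝ) (hFC1 : ContDiff ℝ 1 F)
    (a : ℝ) (ha0 : 0 < a) (ha1 : a < 1)
    (hF0 : F 0 = 0) (hFa : F a = 0) (hF1 : F 1 = 0)
    (hFneg₁ : ∀ s, 0 < s → s < a → F s < 0)
    (hFneg₂ : ∀ s, 1 < s → F s < 0)
    (hFpos₁ : ∀ s, s < 0 → 0 < F s)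
    (hFpos₂ : ∀ s, a < s → s < 1 → 0 < F s) :
    ∀ ε : ℝ, 0 < ε → ε < (1 - a) / 2 →
      ∃ M : ℝ, m0star g F a ≤ M ∧
        ∀ μ : ℝ, M ≤ μ →
          (∀ s ∈ Set.Ioo a 1, g * s = μ * F s → s < a + ε ∨ 1 - ε < s) ∧
          (∃ s ∈ Set.Ioo a (a + ε), g * s = μ * F s) ∧
          (∃ s' ∈ Set.Ioo (1 - ε) 1, g * s' = μ * F s') := by
  intro ε hε hε2
  have hc : Continuous F := hFC1.continuous
  obtain ⟨x, hx, hmin⟩ := (isCompact_Icc (a := a + ε) (b := 1 - ε)).exists_isMinOn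
    ⟨a + ε, by constructor <;> linarith⟩ hc.continuousOn
  have hδ : 0 < F x := hFpos₂ x (by linarith [hx.1]) (by linarith [hx.2])
  have hmin' : ∀ s, a + ε ≤ s → s ≤ 1 - ε → F x ≤ F s := fun s h1 h2 => hmin ⟨h1, h2⟩
  refine ⟨max (m0star g F a) (g / F x), le_max_left _ _, fun μ hμ => ?_⟩
  have h1 : g / F x ≤ μ := (le_max_right _ _).trans hμ
  have h2 : g ≤ μ * F x := (div_le_iff₀ hδ).1 h1
  have hμ0 : 0 < μ := lt_of_lt_of_le (div_pos hg hδ) h1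
  have key : ∀ s, a + ε ≤ s → s ≤ 1 - ε → g * s < μ * F s := by
    intro s hs1 hs2
    have h3 : μ * F x ≤ μ * F s := mul_le_mul_of_nonneg_left (hmin' s hs1 hs2) hμ0.le
    have h4 : g * s < g * 1 := mul_lt_mul_of_pos_left (by linarith) hg
    linarith
  have hcc : Continuous fun s => μ * F s - g * s := by fun_prop
  refine ⟨?_, ?_, ?_⟩
  · intro s _ hs
    by_contra hcon
    push Not at hcon
    exact absurd hs (key s hcon.1 hcon.2).ne
  · have hk := key (a + ε) le_rfl (by linarith)
    have hga : 0 < g * a := mul_pos hg ha0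
    obtain ⟨s, hs, h⟩ := intermediate_value_Ioo (by linarith : a ≤ a + ε) hcc.continuousOn
      (show (0 : ℝ) ∈ _ from ⟨by simp only [hFa]; linarith, by linarith⟩)
    exact ⟨s, hs, by linarith [h]⟩
  · have hk := key (1 - ε) (by linarith) le_rfl
    obtain ⟨s, hs, h⟩ := intermediate_value_Ioo' (by linarith : 1 - ε ≤ 1) hcc.continuousOn
      (show (0 : ℝ) ∈ _ from ⟨by simp only [hF1]; linarith, by linarith⟩)
    exact ⟨s, hs, by linarith [h]⟩
end

section
/- Assume F is strictly concave on [a,1]. Then there exists a unique s* ∈ (a,1) satisfying s* F'(s*) = F(s*); moreover F(s)/s ≤ F(s*)/s* = F'(s*) for every s ∈ [a,1], so that m₀* = g / F'(s*). -/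
open Set

/-- There is a unique `s* ∈ (a,1)` with `s* F'(s*) = F(s*)`, it maximizes `F(s)/s`
on `[a,1]`, and `m₀* = g / F'(s*)`. -/
theorem maximal_slope_point
    (g : ℝ) (hg : 0 < g)
    (F : ℝ → ℝ) (hFC1 : ContDiff ℝ 1 F)
    (a : ℝ) (ha0 : 0 < a) (ha1 : a < 1)
    (hF0 : F 0 = 0) (hFa : F a = 0) (hF1 : F 1 = 0)
    (hFneg₁ : ∀ s, 0 < s → s < a → F s < 0)
    (hFneg₂ : ∀ s, 1 < s → F s < 0)
    (hFpos₁ : ∀ s, s < 0 → 0 < F s)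
    (hFpos₂ : ∀ s, a < s → s < 1 → 0 < F s)
    (hconc : StrictConcaveOn ℝ (Set.Icc a 1) F) :
    ∃ sstar : ℝ, sstar ∈ Set.Ioo a 1 ∧
      sstar * deriv F sstar = F sstar ∧
      (∀ s ∈ Set.Ioo a 1, s * deriv F s = F s → s = sstar) ∧
      (∀ s ∈ Set.Icc a 1, F s / s ≤ F sstar / sstar) ∧
      F sstar / sstar = deriv F sstar ∧
      m0star g F a = g / deriv F sstar := by
  have hdF : ∀ x, HasDerivAt F (deriv F x) x := fun x =>
    ((hFC1.differentiable (by norm_num)) x).hasDerivAt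
  have hcont : ContinuousOn (fun s => F s / s) (Set.Icc a 1) := by
    apply ContinuousOn.div hFC1.continuous.continuousOn continuousOn_id
    intro x hx
    exact (lt_of_lt_of_le ha0 hx.1).ne'
  obtain ⟨t, ht, hmax⟩ := isCompact_Icc.exists_isMaxOn (Set.nonempty_Icc.mpr ha1.le) hcont
  have hmax' : ∀ s ∈ Set.Icc a 1, F s / s ≤ F t / t := fun s hs => hmax hs
  have hposm : 0 < F t / t := by
    refine lt_of_lt_of_le ?_ (hmax' ((a + 1) / 2) ⟨by linarith, by linarith⟩)
    exact div_pos (hFpos₂ _ (by linarith) (by linarith)) (by linarith)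
  have hta : a < t := by
    rcases ht.1.lt_or_eq with h | h
    · exact h
    · rw [← h, hFa] at hposm; simp at hposm
  have ht1 : t < 1 := by
    rcases ht.2.lt_or_eq with h | h
    · exact h
    · rw [h, hF1] at hposm; simp at hposm
  have ht0 : 0 < t := ha0.trans hta
  have hd : deriv F t = F t / t := by
    have hloc : IsLocalMax (fun s => F s - F t / t * s) t := by
      filter_upwards [Icc_mem_nhds hta ht1] with s hs
      have h1 := (div_le_iff₀ (lt_of_lt_of_le ha0 hs.1)).mp (hmax' s hs)
      have h2 : F t / t * t = F t := div_mul_cancel₀ _ ht0.ne'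
      linarith
    have h := hloc.hasDerivAt_eq_zero ((hdF t).sub ((hasDerivAt_id t).const_mul (F t / t)))
    linarith
  have hcan : t * deriv F t = F t := by rw [hd]; field_simp
  refine ⟨t, ⟨hta, ht1⟩, hcan, ?_, hmax', hd.symm, ?_⟩
  · intro s hs hse
    have hs0 : 0 < s := ha0.trans hs.1
    have hsI : s ∈ Set.Icc a 1 := ⟨hs.1.le, hs.2.le⟩
    have h1 := (div_le_iff₀ hs0).mp (hmax' s hsI)
    rw [← hd] at h1
    -- deriv F s ≤ deriv F t
    have h2 : deriv F s ≤ deriv F t := by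
      rw [← hse, mul_comm] at h1
      exact le_of_mul_le_mul_right h1 hs0
    rcases lt_trichotomy s t with h | h | h
    · exfalso
      have h3 := hconc.slope_lt_of_hasDerivAt hsI ht h (hdF s)
      rw [slope_def_field, div_lt_iff₀ (by linarith)] at h3
      nlinarith
    · exact h
    · exfalso
      have h3 := hconc.lt_slope_of_hasDerivAt ht hsI h (hdF s)
      rw [slope_def_field, lt_div_iff₀ (by linarith)] at h3
      nlinarith
  · unfold m0star
    congr 1
    have hg' : IsGreatest ((fun s => F s / s) '' Set.Icc a 1) (F t / t) :=
      ⟨⟨t, ht, rfl⟩, by rintro _ ⟨s, hs, rfl⟩; exact hmax' s hs⟩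
    rw [hg'.csSup_eq, hd]
end
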